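/- Let Λ be a closed discrete subset of 𝔹₂. Then there exists a holomorphic map φ : 𝔻 → ℂ² which is injective, is an immersion (φ'(ζ) ≠ 0 for every ζ ∈ 𝔻), has image contained in 𝔹₂ with Λ ⊆ φ(𝔻), is proper as a map from 𝔻 into 𝔹₂, and is complete: for every divergent path γ : [0,1) → 𝔻 the path φ ∘ γ has infinite length. (Simply connected case of the Alarcón–Globevnik hitting theorem in 𝔹₂.) -/

import Mathlib

open Set Metric
open scoped ENNReal

noncomputable section

/-- A path `γ : [0,1) → E` is a divergent path in the open set `Ω` if it is continuous on
`[0,1)`, takes values in `Ω`, and eventually leaves every compact subset of `Ω`. -/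
def DivergentPathIn {E : Type*} [TopologicalSpace E] (Ω : Set E) (γ : ℝ → E) : Prop :=
  ContinuousOn γ (Set.Ico 0 1) ∧
  (∀ t ∈ Set.Ico (0 : ℝ) 1, γ t ∈ Ω) ∧
  ∀ K : Set E, K ⊆ Ω → IsCompact K →
    ∃ t₀ ∈ Set.Ico (0 : ℝ) 1, ∀ t ∈ Set.Ico t₀ 1, γ t ∉ K

section

open Filter Topology

/-- The disc automorphism `z ↦ (z - a) / (1 - conj a * z)`. -/
def discAut (a z : ℂ) : ℂ := (z - a) / (1 - (starRingEnd ℂ) a * z)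

theorem one_sub_conj_mul_ne_zero {a z : ℂ} (ha : ‖a‖ < 1) (hz : ‖z‖ < 1) :
    1 - (starRingEnd ℂ) a * z ≠ 0 := by
  intro h
  have h1 : (starRingEnd ℂ) a * z = 1 := by linear_combination -h
  have h2 : ‖a‖ * ‖z‖ = 1 := by
    have := congrArg norm h1
    simpa using this
  nlinarith [norm_nonneg a, norm_nonneg z]

theorem one_sub_norm_discAut_sq {a z : ℂ} (ha : ‖a‖ < 1) (hz : ‖z‖ < 1) :
    1 - ‖discAut a z‖ ^ 2 =
      (1 - ‖a‖ ^ 2) * (1 - ‖z‖ ^ 2) / ‖1 - (starRingEnd ℂ) a * z‖ ^ 2 := by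
  have h := one_sub_conj_mul_ne_zero ha hz
  have h' : ‖1 - (starRingEnd ℂ) a * z‖ ^ 2 ≠ 0 := by simpa using h
  rw [discAut, norm_div, div_pow, eq_div_iff h', sub_mul, div_mul_cancel₀ _ h']
  simp only [← Complex.normSq_eq_norm_sq, Complex.normSq_apply]
  simp
  ring

theorem norm_discAut_lt_one {a z : ℂ} (ha : ‖a‖ < 1) (hz : ‖z‖ < 1) : ‖discAut a z‖ < 1 := by
  have h := one_sub_norm_discAut_sq ha hz
  have h0 := norm_pos_iff.2 (one_sub_conj_mul_ne_zero ha hz)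
  have h1 : 0 < (1 - ‖a‖ ^ 2) * (1 - ‖z‖ ^ 2) / ‖1 - (starRingEnd ℂ) a * z‖ ^ 2 := by
    have := norm_nonneg a
    have := norm_nonneg z
    have : 0 < 1 - ‖a‖ ^ 2 := by nlinarith
    have : 0 < 1 - ‖z‖ ^ 2 := by nlinarith
    positivity
  nlinarith [norm_nonneg (discAut a z)]

theorem discAut_injOn {a : ℂ} (ha : ‖a‖ < 1) : InjOn (discAut a) (ball 0 1) := by
  intro z hz w hw h
  have hz' := one_sub_conj_mul_ne_zero ha (mem_ball_zero_iff.1 hz)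
  have hw' := one_sub_conj_mul_ne_zero ha (mem_ball_zero_iff.1 hw)
  rw [discAut, discAut, div_eq_div_iff hz' hw'] at h
  have h1 : (z - w) * (1 - (starRingEnd ℂ) a * a) = 0 := by linear_combination h
  rcases mul_eq_zero.1 h1 with h2 | h2
  · exact sub_eq_zero.1 h2
  · exact absurd h2 (one_sub_conj_mul_ne_zero ha ha)

theorem hasDerivAt_discAut {a z : ℂ} (ha : ‖a‖ < 1) (hz : ‖z‖ < 1) :
    HasDerivAt (discAut a)
      ((1 - (starRingEnd ℂ) a * a) / (1 - (starRingEnd ℂ) a * z) ^ 2) z := by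
  have hz' := one_sub_conj_mul_ne_zero ha hz
  have h := ((hasDerivAt_id z).sub_const a).div
    (((hasDerivAt_id z).const_mul ((starRingEnd ℂ) a)).const_sub 1) hz'
  refine h.congr_deriv ?_
  simp only [id]
  congr 1
  ring

theorem norm_deriv_discAut {a z : ℂ} (ha : ‖a‖ < 1) (hz : ‖z‖ < 1) :
    ‖deriv (discAut a) z‖ * (1 - ‖z‖ ^ 2) = 1 - ‖discAut a z‖ ^ 2 := by
  rw [(hasDerivAt_discAut ha hz).deriv, one_sub_norm_discAut_sq ha hz, norm_div, norm_pow]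
  have : ‖1 - (starRingEnd ℂ) a * a‖ = 1 - ‖a‖ ^ 2 := by
    rw [mul_comm, Complex.mul_conj, Complex.normSq_eq_norm_sq]
    have h1 : (1 : ℂ) - ((‖a‖ ^ 2 : ℝ) : ℂ) = ((1 - ‖a‖ ^ 2 : ℝ) : ℂ) := by push_cast; ring
    rw [h1, Complex.norm_real, Real.norm_of_nonneg]
    nlinarith [norm_nonneg a]
  rw [this]
  ring

/-- Every zero-free holomorphic function on `Ω` has a holomorphic square root. -/
def HasHolomorphicSqrt (Ω : Set ℂ) : Prop :=
  ∀ f : ℂ → ℂ, DifferentiableOn ℂ f Ω → (∀ z ∈ Ω, f z ≠ 0) →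
    ∃ g : ℂ → ℂ, DifferentiableOn ℂ g Ω ∧ ∀ z ∈ Ω, g z ^ 2 = f z

/-- A local form of the theorem of Hurwitz. -/
theorem hurwitz_exists_zero {ι : Type*} {l : Filter ι} [l.NeBot] {U : Set ℂ} (hU : IsOpen U)
    {F : ι → ℂ → ℂ} {f : ℂ → ℂ} (hF : TendstoLocallyUniformlyOn F f l U)
    (hd : ∀ n, DifferentiableOn ℂ (F n) U) {z₁ : ℂ} (hz₁ : z₁ ∈ U) (h0 : f z₁ = 0)
    (hne : ¬ ∀ᶠ z in 𝓝 z₁, f z = 0) {V : Set ℂ} (hV : V ∈ 𝓝 z₁) :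
    ∀ᶠ n in l, ∃ z ∈ V, F n z = 0 := by
  have hfd : DifferentiableOn ℂ f U := hF.differentiableOn (.of_forall hd) hU
  have han : AnalyticAt ℂ f z₁ := hfd.analyticAt (hU.mem_nhds hz₁)
  have hev : ∀ᶠ z in 𝓝[≠] z₁, f z ≠ 0 :=
    han.eventually_eq_zero_or_eventually_ne_zero.resolve_left hne
  rw [eventually_nhdsWithin_iff] at hev
  obtain ⟨r, hr, hball⟩ := Metric.nhds_basis_closedBall.mem_iff.1
    (inter_mem (inter_mem hev hV) (hU.mem_nhds hz₁))
  have hcU : closedBall z₁ r ⊆ U := fun x hx => (hball hx).2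
  have hcont : ContinuousOn (fun z => ‖f z‖) (sphere z₁ r) :=
    (hfd.continuousOn.mono (sphere_subset_closedBall.trans hcU)).norm
  obtain ⟨y, hy, hmin⟩ := (isCompact_sphere z₁ r).exists_isMinOn
    ((NormedSpace.sphere_nonempty (E := ℂ)).2 hr.le) hcont
  set m := ‖f y‖ with hm
  have hmpos : 0 < m := by
    refine norm_pos_iff.2 ((hball (sphere_subset_closedBall hy)).1.1 ?_)
    rintro rfl
    simp at hy
    exact hr.ne hy
  have hunif := (tendstoLocallyUniformlyOn_iff_forall_isCompact hU).1 hF _ hcU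
    (isCompact_closedBall z₁ r)
  filter_upwards [Metric.tendstoUniformlyOn_iff.1 hunif (m / 8) (by positivity)] with n hn
  have hdc : DiffContOnCl ℂ (F n) (ball z₁ r) := by
    refine ((hd n).mono hcU).diffContOnCl_ball subset_rfl
  have hz1c : z₁ ∈ closedBall z₁ r := mem_closedBall_self hr.le
  have hn1 := hn z₁ hz1c
  rw [h0, dist_zero_left] at hn1
  have hsph : ∀ z ∈ sphere z₁ r, m / 2 ≤ ‖F n z - F n z₁‖ := by
    intro z hz
    have h1 := hn z (sphere_subset_closedBall hz)
    have h2 : m ≤ ‖f z‖ := hmin hz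
    rw [dist_eq_norm] at h1
    have h3 : ‖f z‖ ≤ ‖f z - F n z‖ + ‖F n z - F n z₁‖ + ‖F n z₁‖ := by
      calc ‖f z‖ = ‖(f z - F n z) + (F n z - F n z₁) + F n z₁‖ := by congr 1; ring
        _ ≤ _ := norm_add₃_le
    linarith
  have hfreq : ∃ᶠ z in 𝓝 z₁, F n z ≠ F n z₁ := by
    intro hcon
    have hA : AnalyticOnNhd ℂ (F n) (ball z₁ r) :=
      ((hd n).mono (ball_subset_closedBall.trans hcU)).analyticOnNhd isOpen_ball
    have hE : EqOn (F n) (fun _ => F n z₁) (ball z₁ r) :=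
      hA.eqOn_of_preconnected_of_eventuallyEq analyticOnNhd_const
        (convex_ball _ _).isPreconnected (mem_ball_self hr)
        (hcon.mono fun z hz => not_not.1 hz)
    have hE2 : EqOn (F n) (fun _ => F n z₁) (closedBall z₁ r) := by
      exact fun x hx => (hE.of_subset_closure (s := ball z₁ r)
        ((hd n).continuousOn.mono hcU) continuousOn_const ball_subset_closedBall
        (by rw [closure_ball _ hr.ne'])) hx
    have h5 := hsph y hy
    rw [hE2 (sphere_subset_closedBall hy), sub_self, norm_zero] at h5
    linarith
  have := hdc.ball_subset_image_closedBall hr hsph hfreq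
  obtain ⟨z, hz, hz0⟩ := this (show (0 : ℂ) ∈ ball (F n z₁) (m / 2 / 2) by
    rw [mem_ball, dist_zero_left]; linarith)
  exact ⟨z, (hball hz).1.2, hz0⟩

/-- Injective holomorphic maps of `Ω` into the unit disc with nowhere vanishing derivative. -/
structure IsDiscChart (Ω : Set ℂ) (f : ℂ → ℂ) : Prop where
  diff : DifferentiableOn ℂ f Ω
  inj : InjOn f Ω
  maps : ∀ z ∈ Ω, ‖f z‖ < 1
  deriv_ne : ∀ z ∈ Ω, deriv f z ≠ 0

theorem deriv_sq_eq {Ω : Set ℂ} (hΩ : IsOpen Ω) {f g : ℂ → ℂ} (hg : DifferentiableOn ℂ g Ω)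
    (h : ∀ z ∈ Ω, g z ^ 2 = f z) {z : ℂ} (hz : z ∈ Ω) : deriv f z = 2 * g z * deriv g z := by
  have h1 : f =ᶠ[𝓝 z] fun x => g x ^ 2 := by
    filter_upwards [hΩ.mem_nhds hz] with x hx using (h x hx).symm
  rw [h1.deriv_eq]
  have := ((hg.differentiableAt (hΩ.mem_nhds hz)).hasDerivAt.fun_pow 2).deriv
  simpa using this

theorem exists_isDiscChart {Ω : Set ℂ} (hΩ : IsOpen Ω) {z₀ : ℂ} (hz₀ : z₀ ∈ Ω)
    (hne : Ω ≠ univ) (hsq : HasHolomorphicSqrt Ω) : ∃ f, IsDiscChart Ω f := by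
  obtain ⟨a, ha⟩ := (ne_univ_iff_exists_notMem _).1 hne
  have hza : ∀ z ∈ Ω, z - a ≠ 0 := fun z hz h => ha (sub_eq_zero.1 h ▸ hz)
  obtain ⟨g, hg, hgs⟩ := hsq (fun z => z - a) (by fun_prop) hza
  have hg0 : ∀ z ∈ Ω, g z ≠ 0 := fun z hz h => hza z hz (by rw [← hgs z hz, h]; simp)
  have hginj : ∀ z ∈ Ω, ∀ w ∈ Ω, g z ^ 2 = g w ^ 2 → z = w := by
    intro z hz w hw h
    rw [hgs z hz, hgs w hw] at h
    linear_combination h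
  have hgd : ∀ z ∈ Ω, deriv g z ≠ 0 := by
    intro z hz h
    have := deriv_sq_eq hΩ hg hgs hz
    rw [h] at this
    simp at this
  have himg : g '' Ω ∈ 𝓝 (g z₀) := by
    have hs : HasStrictDerivAt g (deriv g z₀) z₀ :=
      (hg.analyticAt (hΩ.mem_nhds hz₀)).hasStrictDerivAt
    rw [← hs.map_nhds_eq (hgd z₀ hz₀)]
    exact Filter.image_mem_map (hΩ.mem_nhds hz₀)
  obtain ⟨ε, hε, hball⟩ := Metric.mem_nhds_iff.1 himg
  have hfar : ∀ z ∈ Ω, ε ≤ ‖g z + g z₀‖ := by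
    intro z hz
    by_contra! hlt
    obtain ⟨w, hw, hwz⟩ := hball (show -g z ∈ ball (g z₀) ε by
      rw [mem_ball, dist_eq_norm, show -g z - g z₀ = -(g z + g z₀) by ring, norm_neg]
      exact hlt)
    obtain rfl : w = z := hginj w hw z hz (by rw [hwz]; ring)
    exact hg0 w hw (by linear_combination hwz / 2)
  have hpos : ∀ z ∈ Ω, g z + g z₀ ≠ 0 := fun z hz =>
    norm_pos_iff.1 (hε.trans_le (hfar z hz))
  have hder : ∀ z ∈ Ω, HasDerivAt (fun z => ((ε / 2 : ℝ) : ℂ) / (g z + g z₀))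
      (((0 : ℂ) * (g z + g z₀) - ((ε / 2 : ℝ) : ℂ) * deriv g z) / (g z + g z₀) ^ 2) z := by
    intro z hz
    exact (hasDerivAt_const z _).div
      ((hg.differentiableAt (hΩ.mem_nhds hz)).hasDerivAt.add_const _) (hpos z hz)
  refine ⟨fun z => ((ε / 2 : ℝ) : ℂ) / (g z + g z₀), ?_, ?_, ?_, ?_⟩
  · exact fun z hz => (hder z hz).differentiableAt.differentiableWithinAt
  · intro z hz w hw h
    have h2 : ((ε / 2 : ℝ) : ℂ) ≠ 0 := by
      exact_mod_cast (half_pos hε).ne'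
    have h' := mul_left_cancel₀ h2 ((div_eq_div_iff (hpos z hz) (hpos w hw)).1 h)
    refine hginj z hz w hw ?_
    rw [add_right_cancel h'.symm]
  · intro z hz
    rw [norm_div, Complex.norm_real, Real.norm_of_nonneg (half_pos hε).le, div_lt_one₀]
    · linarith [hfar z hz]
    · exact norm_pos_iff.2 (hpos z hz)
  · intro z hz
    rw [(hder z hz).deriv]
    have h2 : ((ε / 2 : ℝ) : ℂ) ≠ 0 := by
      exact_mod_cast (half_pos hε).ne'
    simp [hgd z hz, hpos z hz, hε.ne']

theorem IsDiscChart.norm_deriv_le {Ω : Set ℂ} {f : ℂ → ℂ} (h : IsDiscChart Ω f) {z : ℂ} {r : ℝ}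
    (hr : 0 < r) (hz : ball z r ⊆ Ω) : ‖deriv f z‖ ≤ 2 / r := by
  refine Complex.norm_deriv_le_div_of_mapsTo_ball (R₂ := 2) (h.diff.mono hz) ?_ hr
  intro x hx
  rw [mem_closedBall, dist_eq_norm]
  have h1 := h.maps x (hz hx)
  have h2 := h.maps z (hz (mem_ball_self hr))
  linarith [norm_sub_le (f x) (f z)]

theorem IsDiscChart.dist_le {Ω : Set ℂ} {f : ℂ → ℂ} (h : IsDiscChart Ω f) {z x : ℂ} {r : ℝ}
    (hz : ball z r ⊆ Ω) (hx : x ∈ ball z r) : dist (f x) (f z) ≤ 2 / r * dist x z := by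
  have hr : 0 < r := dist_nonneg.trans_lt (mem_ball.1 hx)
  refine Complex.dist_le_div_mul_dist_of_mapsTo_ball (h.diff.mono hz) ?_ hx
  intro x hx
  rw [mem_closedBall, dist_eq_norm]
  have h1 := h.maps x (hz hx)
  have h2 := h.maps z (hz (mem_ball_self hr))
  linarith [norm_sub_le (f x) (f z)]

/-- Montel's theorem for disc charts, along an ultrafilter. -/
theorem exists_tendstoLocallyUniformlyOn_of_isDiscChart {Ω : Set ℂ} (hΩ : IsOpen Ω)
    (l : Ultrafilter ℕ) (F : ℕ → ℂ → ℂ) (hF : ∀ n, IsDiscChart Ω (F n)) :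
    ∃ f : ℂ → ℂ, TendstoLocallyUniformlyOn F f l Ω ∧ ∀ z ∈ Ω, ‖f z‖ ≤ 1 := by
  have hlim : ∀ z, ∃ y : ℂ, z ∈ Ω → y ∈ closedBall (0 : ℂ) 1 ∧ Tendsto (F · z) l (𝓝 y) := by
    intro z
    by_cases hz : z ∈ Ω
    · obtain ⟨y, hy, hly⟩ := (isCompact_closedBall (0 : ℂ) 1).ultrafilter_le_nhds
        (l.map (F · z)) (by
          rw [le_principal_iff]
          exact Filter.mem_map.2 (Filter.univ_mem' fun n => by
            simpa using ((hF n).maps z hz).le))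
      exact ⟨y, fun _ => ⟨hy, hly⟩⟩
    · exact ⟨0, fun h => absurd h hz⟩
  choose f hf using hlim
  refine ⟨f, ?_, fun z hz => by simpa using (hf z hz).1⟩
  rw [Metric.tendstoLocallyUniformlyOn_iff]
  intro ε hε z hz
  obtain ⟨r, hr, hball⟩ := Metric.isOpen_iff.1 hΩ z hz
  have hlip : ∀ y ∈ ball z r, dist (f y) (f z) ≤ 2 / r * dist y z := by
    intro y hy
    refine le_of_tendsto ((hf y (hball hy)).2.dist (hf z hz).2) (.of_forall fun n => ?_)
    exact (hF n).dist_le hball hy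
  set δ := min r (ε * r / 8) with hδ
  have hδpos : 0 < δ := by positivity
  have hsmall : ∀ y ∈ ball z δ, 2 / r * dist y z ≤ ε / 4 := by
    intro y hy
    have h1 : dist y z ≤ ε * r / 8 := (mem_ball.1 hy).le.trans (min_le_right _ _)
    calc 2 / r * dist y z ≤ 2 / r * (ε * r / 8) := by gcongr
      _ = ε / 4 := by field_simp; norm_num
  refine ⟨ball z δ, mem_nhdsWithin_of_mem_nhds (ball_mem_nhds _ hδpos), ?_⟩
  filter_upwards [Metric.tendsto_nhds.1 (hf z hz).2 (ε / 4) (by positivity)] with n hn y hy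
  have hyr : y ∈ ball z r := ball_subset_ball (min_le_left _ _) hy
  have h1 := (hlip y hyr).trans (hsmall y hy)
  have h2 := ((hF n).dist_le hball hyr).trans (hsmall y hy)
  calc dist (f y) (F n y) ≤ dist (f y) (f z) + dist (f z) (F n z) + dist (F n z) (F n y) :=
        dist_triangle4 _ _ _ _
    _ < ε := by rw [dist_comm (f z), dist_comm (F n z) (F n y)]; linarith

theorem isDiscChart_of_tendstoLocallyUniformlyOn {Ω : Set ℂ} (hΩ : IsOpen Ω)
    (hc : IsPreconnected Ω) {l : Filter ℕ} [l.NeBot] {F : ℕ → ℂ → ℂ}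
    (hF : ∀ n, IsDiscChart Ω (F n)) {f : ℂ → ℂ} (hf : TendstoLocallyUniformlyOn F f l Ω)
    (hle : ∀ z ∈ Ω, ‖f z‖ ≤ 1) {z₀ : ℂ} (hz₀ : z₀ ∈ Ω) (hd0 : deriv f z₀ ≠ 0) :
    IsDiscChart Ω f := by
  have hdiff : DifferentiableOn ℂ f Ω := hf.differentiableOn (.of_forall fun n => (hF n).diff) hΩ
  have han : AnalyticOnNhd ℂ f Ω := hdiff.analyticOnNhd hΩ
  have hnc : ∀ c, ∀ z ∈ Ω, ¬ ∀ᶠ x in 𝓝 z, f x = c := by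
    intro c z hz h
    have hE : EqOn f (fun _ => c) Ω :=
      han.eqOn_of_preconnected_of_eventuallyEq analyticOnNhd_const hc hz h
    refine hd0 ?_
    have : f =ᶠ[𝓝 z₀] fun _ => c := by
      filter_upwards [hΩ.mem_nhds hz₀] with x hx using hE hx
    rw [this.deriv_eq, deriv_const]
  refine ⟨hdiff, ?_, ?_, ?_⟩
  · intro z hz w hw hzw
    by_contra hne
    have hT : TendstoLocallyUniformlyOn (fun n x => F n x - F n w) (fun x => f x - f w) l Ω := by
      rw [Metric.tendstoLocallyUniformlyOn_iff] at hf ⊢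
      intro ε hε x hx
      obtain ⟨t, ht, h⟩ := hf (ε / 2) (half_pos hε) x hx
      obtain ⟨t', ht', h'⟩ := hf (ε / 2) (half_pos hε) w hw
      refine ⟨t, ht, ?_⟩
      filter_upwards [h, h'] with n hn hn' y hy
      have h1 := hn y hy
      have h2 := hn' w (mem_of_mem_nhdsWithin hw ht')
      rw [dist_eq_norm] at h1 h2 ⊢
      calc ‖f y - f w - (F n y - F n w)‖ = ‖(f y - F n y) - (f w - F n w)‖ := by congr 1; ring
        _ ≤ ‖f y - F n y‖ + ‖f w - F n w‖ := norm_sub_le _ _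
        _ < ε := by linarith
    have hV : ({w}ᶜ ∩ Ω : Set ℂ) ∈ 𝓝 z := inter_mem (isOpen_ne.mem_nhds hne) (hΩ.mem_nhds hz)
    obtain ⟨n, x, hx, h0⟩ := (hurwitz_exists_zero hΩ hT (fun n => (hF n).diff.sub_const _) hz
      (by rw [hzw, sub_self]) (fun h => hnc (f w) z hz (h.mono fun x hx => sub_eq_zero.1 hx))
      hV).exists
    exact hx.1 ((hF n).inj hx.2 hw (sub_eq_zero.1 h0))
  · intro z hz
    refine lt_of_le_of_ne (hle z hz) fun h => ?_
    have hE := Complex.eqOn_of_isPreconnected_of_isMaxOn_norm hc hΩ hdiff hz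
      (fun x hx => by simpa [h] using hle x hx)
    exact hnc (f z) z hz (by filter_upwards [hΩ.mem_nhds hz] with x hx using hE hx)
  · intro z hz h0
    have hT := hf.deriv (.of_forall fun n => (hF n).diff) hΩ
    have hdan : AnalyticOnNhd ℂ (deriv f) Ω := han.deriv
    obtain ⟨n, x, hx, h0⟩ := (hurwitz_exists_zero hΩ hT (fun n => ((hF n).diff.deriv hΩ)) hz h0
      (fun h => hd0 (hdan.eqOn_of_preconnected_of_eventuallyEq analyticOnNhd_const hc hz
        (g := fun _ => 0) h hz₀)) (hΩ.mem_nhds hz)).exists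
    exact (hF n).deriv_ne x hx h0

theorem exists_maximal_isDiscChart {Ω : Set ℂ} (hΩ : IsOpen Ω) (hc : IsPreconnected Ω) {z₀ : ℂ}
    (hz₀ : z₀ ∈ Ω) {f₀ : ℂ → ℂ} (hf₀ : IsDiscChart Ω f₀) :
    ∃ f, IsDiscChart Ω f ∧ ∀ g, IsDiscChart Ω g → ‖deriv g z₀‖ ≤ ‖deriv f z₀‖ := by
  obtain ⟨r, hr, hball⟩ := Metric.isOpen_iff.1 hΩ z₀ hz₀
  set S : Set ℝ := (fun f : ℂ → ℂ => ‖deriv f z₀‖) '' {f | IsDiscChart Ω f} with hS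
  have hbdd : BddAbove S := ⟨2 / r, by
    rintro _ ⟨f, hf, rfl⟩
    exact hf.norm_deriv_le hr hball⟩
  have hne : S.Nonempty := ⟨_, f₀, hf₀, rfl⟩
  obtain ⟨u, -, hu, huS⟩ := exists_seq_tendsto_sSup hne hbdd
  choose F hF hFu using huS
  set l := hyperfilter ℕ with hl
  obtain ⟨f, hf, hle⟩ := exists_tendstoLocallyUniformlyOn_of_isDiscChart hΩ l F hF
  have hder : Tendsto (fun n => deriv (F n) z₀) l (𝓝 (deriv f z₀)) :=
    (hf.deriv (.of_forall fun n => (hF n).diff) hΩ).tendsto_at hz₀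
  have hlim : Tendsto u l (𝓝 (sSup S)) :=
    hu.mono_left (by rw [← Nat.cofinite_eq_atTop]; exact hyperfilter_le_cofinite)
  have heq : ‖deriv f z₀‖ = sSup S := by
    refine tendsto_nhds_unique hder.norm ?_
    simpa only [hFu] using hlim
  have hd0 : deriv f z₀ ≠ 0 := by
    rw [← norm_pos_iff, heq]
    exact (norm_pos_iff.2 (hf₀.deriv_ne z₀ hz₀)).trans_le (le_csSup hbdd ⟨_, hf₀, rfl⟩)
  refine ⟨f, isDiscChart_of_tendstoLocallyUniformlyOn hΩ hc hF hf hle hz₀ hd0, fun g hg => ?_⟩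
  rw [heq]
  exact le_csSup hbdd ⟨_, hg, rfl⟩

theorem IsDiscChart.discAut_comp {Ω : Set ℂ} (hΩ : IsOpen Ω) {f : ℂ → ℂ} (hf : IsDiscChart Ω f)
    {a : ℂ} (ha : ‖a‖ < 1) : IsDiscChart Ω (fun z => discAut a (f z)) ∧
      ∀ z ∈ Ω, deriv (fun z => discAut a (f z)) z = deriv (discAut a) (f z) * deriv f z := by
  have hd : ∀ z ∈ Ω, HasDerivAt (fun z => discAut a (f z))
      (deriv (discAut a) (f z) * deriv f z) z := fun z hz =>
    HasDerivAt.comp z ((hasDerivAt_discAut ha (hf.maps z hz)).differentiableAt.hasDerivAt)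
      (hf.diff.differentiableAt (hΩ.mem_nhds hz)).hasDerivAt
  refine ⟨⟨fun z hz => (hd z hz).differentiableAt.differentiableWithinAt, ?_, ?_, ?_⟩,
    fun z hz => (hd z hz).deriv⟩
  · exact (discAut_injOn ha).comp hf.inj fun z hz => mem_ball_zero_iff.2 (hf.maps z hz)
  · exact fun z hz => norm_discAut_lt_one ha (hf.maps z hz)
  · intro z hz
    rw [(hd z hz).deriv]
    refine mul_ne_zero (fun h => ?_) (hf.deriv_ne z hz)
    have := norm_deriv_discAut ha (hf.maps z hz)
    rw [h, norm_zero, zero_mul] at this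
    have := norm_discAut_lt_one ha (hf.maps z hz)
    nlinarith [norm_nonneg (discAut a (f z))]

/-- The Riemann mapping theorem for domains with holomorphic square roots. -/
theorem exists_isDiscChart_surjOn {Ω : Set ℂ} (hΩ : IsOpen Ω) (hc : IsPreconnected Ω) {z₀ : ℂ}
    (hz₀ : z₀ ∈ Ω) (hne : Ω ≠ univ) (hsq : HasHolomorphicSqrt Ω) :
    ∃ f, IsDiscChart Ω f ∧ SurjOn f Ω (ball 0 1) := by
  obtain ⟨f₀, hf₀⟩ := exists_isDiscChart hΩ hz₀ hne hsq
  obtain ⟨f, hf, hmax⟩ := exists_maximal_isDiscChart hΩ hc hz₀ hf₀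
  refine ⟨f, hf, ?_⟩
  intro w hw
  rw [mem_ball_zero_iff] at hw
  by_contra hnot
  obtain ⟨hg, hgd⟩ := hf.discAut_comp hΩ hw
  set g : ℂ → ℂ := fun z => discAut w (f z) with hgdef
  have hg0 : ∀ z ∈ Ω, g z ≠ 0 := by
    intro z hz h
    rw [hgdef] at h
    rcases div_eq_zero_iff.1 h with h | h
    · exact hnot ⟨z, hz, sub_eq_zero.1 h⟩
    · exact one_sub_conj_mul_ne_zero hw (hf.maps z hz) h
  obtain ⟨h, hh, hhs⟩ := hsq g hg.diff hg0
  have hhd : ∀ z ∈ Ω, deriv g z = 2 * h z * deriv h z := fun z hz => deriv_sq_eq hΩ hh hhs hz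
  have hnorm : ∀ z ∈ Ω, ‖h z‖ ^ 2 = ‖g z‖ := fun z hz => by rw [← hhs z hz, norm_pow]
  have hchart : IsDiscChart Ω h := by
    refine ⟨hh, ?_, ?_, ?_⟩
    · intro x hx y hy hxy
      exact hg.inj hx hy (by rw [← hhs x hx, ← hhs y hy, hxy])
    · intro z hz
      have := hg.maps z hz
      rw [← hnorm z hz] at this
      nlinarith [norm_nonneg (h z)]
    · intro z hz h0
      have := hhd z hz
      rw [h0, mul_zero] at this
      exact hg.deriv_ne z hz this
  obtain ⟨hk, hkd⟩ := hchart.discAut_comp hΩ (hchart.maps z₀ hz₀)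
  have hm := hmax _ hk
  rw [hkd z₀ hz₀, norm_mul] at hm
  have e1 := norm_deriv_discAut (hchart.maps z₀ hz₀) (hchart.maps z₀ hz₀)
  have e0 : discAut (h z₀) (h z₀) = 0 := by simp [discAut]
  rw [e0, norm_zero] at e1
  have e2 := norm_deriv_discAut hw (hf.maps z₀ hz₀)
  have e3 : ‖deriv (discAut w) (f z₀)‖ * ‖deriv f z₀‖ = 2 * ‖h z₀‖ * ‖deriv h z₀‖ := by
    rw [← norm_mul, ← hgd z₀ hz₀, hhd z₀ hz₀]
    simp
  have e4 := hnorm z₀ hz₀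
  have hv0 : 0 < ‖h z₀‖ := by
    rw [norm_pos_iff]
    intro h0
    exact hg0 z₀ hz₀ (by rw [← hhs z₀ hz₀, h0]; simp)
  have hv1 := hchart.maps z₀ hz₀
  have hc1 := hf.maps z₀ hz₀
  have hD := norm_pos_iff.2 (hf.deriv_ne z₀ hz₀)
  change _ = 1 - ‖g z₀‖ ^ 2 at e2
  rw [← e4] at e2
  set v := ‖h z₀‖
  set A := ‖deriv (discAut (h z₀)) (h z₀)‖
  set B := ‖deriv (discAut w) (f z₀)‖
  set D := ‖deriv f z₀‖
  set H := ‖deriv h z₀‖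
  set c := ‖f z₀‖
  have hc0 : 0 ≤ c := norm_nonneg _
  have hu : 0 < 1 - v ^ 2 := by nlinarith
  have hA : A = 1 / (1 - v ^ 2) := by
    rw [eq_div_iff hu.ne']; linarith
  have hB : 1 - (v ^ 2) ^ 2 ≤ B := by
    have : 0 ≤ B := norm_nonneg _
    nlinarith [sq_nonneg c]
  rw [hA, one_div, inv_mul_le_iff₀ hu] at hm
  have h5 : B * D ≤ 2 * v * ((1 - v ^ 2) * D) := by
    rw [e3]; exact mul_le_mul_of_nonneg_left hm (by positivity)
  have h6 : B ≤ 2 * v * (1 - v ^ 2) := by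
    by_contra! hcon
    nlinarith
  have h7 : (1 - v ^ 2) * (1 - v) ^ 2 ≤ 0 := by nlinarith
  have : 0 < (1 - v ^ 2) * (1 - v) ^ 2 := by
    have : 0 < 1 - v := by linarith
    positivity
  linarith

/-- The complex line integral of `u` along the segment from `a` to `b`. -/
def segInt (u : ℂ → ℂ) (a b : ℂ) : ℂ := ∫ t in (0 : ℝ)..1, u (a + t • (b - a)) * (b - a)

theorem add_smul_mem_segment {a b : ℂ} {t : ℝ} (ht : t ∈ Icc (0 : ℝ) 1) :
    a + t • (b - a) ∈ segment ℝ a b := by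
  rw [segment_eq_image']
  exact ⟨t, ht, rfl⟩

theorem continuousOn_comp_segment {u : ℂ → ℂ} {a b : ℂ} (hu : ContinuousOn u (segment ℝ a b)) :
    ContinuousOn (fun t : ℝ => u (a + t • (b - a)) * (b - a)) (uIcc 0 1) := by
  rw [uIcc_of_le zero_le_one]
  refine ContinuousOn.mul ?_ continuousOn_const
  exact hu.comp (by fun_prop) fun t ht => add_smul_mem_segment ht

theorem segInt_congr {u v : ℂ → ℂ} {a b : ℂ} (h : EqOn u v (segment ℝ a b)) :
    segInt u a b = segInt v a b := by
  refine intervalIntegral.integral_congr fun t ht => ?_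
  rw [uIcc_of_le zero_le_one] at ht
  simp only [h (add_smul_mem_segment ht)]

theorem segInt_sub {u v : ℂ → ℂ} {a b : ℂ} (hu : ContinuousOn u (segment ℝ a b))
    (hv : ContinuousOn v (segment ℝ a b)) :
    segInt (fun w => u w - v w) a b = segInt u a b - segInt v a b := by
  rw [segInt, segInt, segInt, ← intervalIntegral.integral_sub
    (continuousOn_comp_segment hu).intervalIntegrable
    (continuousOn_comp_segment hv).intervalIntegrable]
  simp only [sub_mul]

theorem segInt_const_mul (c : ℂ) (u : ℂ → ℂ) (a b : ℂ) :
    segInt (fun w => c * u w) a b = c * segInt u a b := by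
  rw [segInt, segInt, ← intervalIntegral.integral_const_mul]
  simp only [mul_assoc]

theorem norm_segInt_le {u : ℂ → ℂ} {a b : ℂ} {C : ℝ} (h : ∀ w ∈ segment ℝ a b, ‖u w‖ ≤ C) :
    ‖segInt u a b‖ ≤ C * ‖b - a‖ := by
  have := intervalIntegral.norm_integral_le_of_norm_le_const (a := 0) (b := 1)
    (f := fun t : ℝ => u (a + t • (b - a)) * (b - a)) (C := C * ‖b - a‖) (by
      intro t ht
      rw [uIoc_of_le zero_le_one] at ht
      rw [norm_mul]
      exact mul_le_mul_of_nonneg_right (h _ (add_smul_mem_segment ⟨ht.1.le, ht.2⟩))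
        (norm_nonneg _))
  simpa [segInt] using this

theorem segInt_swap (u : ℂ → ℂ) (a b : ℂ) : segInt u b a = -segInt u a b := by
  have h := intervalIntegral.integral_comp_sub_left (a := 0) (b := 1)
    (fun t : ℝ => u (a + t • (b - a)) * (b - a)) 1
  simp only [sub_self, sub_zero] at h
  rw [segInt, segInt, ← h, ← intervalIntegral.integral_neg]
  refine intervalIntegral.integral_congr fun t _ => ?_
  have : b + t • (a - b) = a + (1 - t) • (b - a) := by
    simp only [Complex.real_smul]; push_cast; ring
  simp only [this]
  ring

theorem segInt_eq_sub {f f' : ℂ → ℂ} {a b : ℂ}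
    (h : ∀ w ∈ segment ℝ a b, HasDerivAt f (f' w) w) (hc : ContinuousOn f' (segment ℝ a b)) :
    segInt f' a b = f b - f a := by
  have := intervalIntegral.integral_eq_sub_of_hasDerivAt (a := 0) (b := 1)
    (f := fun t : ℝ => f (a + t • (b - a))) (f' := fun t : ℝ => f' (a + t • (b - a)) * (b - a))
    (by
      intro t ht
      rw [uIcc_of_le zero_le_one] at ht
      have h1 : HasDerivAt (fun t : ℝ => a + t • (b - a)) (b - a) t := by
        simpa using ((hasDerivAt_id t).smul_const (b - a)).const_add a
      exact (h _ (add_smul_mem_segment ht)).comp_of_eq t h1 rfl)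
    (continuousOn_comp_segment hc).intervalIntegrable
  simpa [segInt] using this

theorem differentiableOn_segInt {k : ℂ → ℂ → ℂ} {V : Set ℂ} (hV : IsOpen V) {a b : ℂ}
    (hk : ∀ w ∈ segment ℝ a b, DifferentiableOn ℂ (fun z => k z w) V)
    (hc : ∀ z ∈ V, ContinuousOn (k z) (segment ℝ a b))
    (hb : ∀ z ∈ V, ∃ r > 0, ∃ C, ∀ x ∈ ball z r, ∀ w ∈ segment ℝ a b, ‖k x w‖ ≤ C) :
    DifferentiableOn ℂ (fun z => segInt (k z) a b) V := by
  intro z hz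
  obtain ⟨r₁, hr₁, C, hC⟩ := hb z hz
  obtain ⟨r₂, hr₂, hball⟩ := Metric.isOpen_iff.1 hV z hz
  set r := min r₁ r₂ with hr
  have hrpos : 0 < r := lt_min hr₁ hr₂
  have hrV : ball z r ⊆ V := (ball_subset_ball (min_le_right _ _)).trans hball
  have hrC : ∀ x ∈ ball z r, ∀ w ∈ segment ℝ a b, ‖k x w‖ ≤ C := fun x hx =>
    hC x (ball_subset_ball (min_le_left _ _) hx)
  have hIoc : ∀ t ∈ uIoc (0 : ℝ) 1, a + t • (b - a) ∈ segment ℝ a b := fun t ht => by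
    rw [uIoc_of_le zero_le_one] at ht
    exact add_smul_mem_segment ⟨ht.1.le, ht.2⟩
  have hmeas : ∀ x ∈ V, MeasureTheory.AEStronglyMeasurable
      (fun t : ℝ => k x (a + t • (b - a)) * (b - a))
      (MeasureTheory.volume.restrict (uIoc 0 1)) := fun x hx =>
    ((continuousOn_comp_segment (hc x hx)).mono uIoc_subset_uIcc).aestronglyMeasurable
      measurableSet_uIoc
  have hder : ∀ w ∈ segment ℝ a b, ∀ x ∈ V,
      HasDerivAt (fun z => k z w) (deriv (fun z => k z w) x) x := fun w hw x hx =>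
    ((hk w hw).differentiableAt (hV.mem_nhds hx)).hasDerivAt
  have key := intervalIntegral.hasDerivAt_integral_of_dominated_loc_of_deriv_le
    (μ := MeasureTheory.volume) (a := 0) (b := 1) (x₀ := z)
    (F := fun x (t : ℝ) => k x (a + t • (b - a)) * (b - a))
    (F' := fun x (t : ℝ) => deriv (fun y => k y (a + t • (b - a))) x * (b - a))
    (bound := fun _ => C / (r / 2) * ‖b - a‖) (ball_mem_nhds z (half_pos hrpos))
    (by filter_upwards [hV.mem_nhds hz] with x hx using hmeas x hx)
    (continuousOn_comp_segment (hc z hz)).intervalIntegrable ?_ ?_ (by simp) ?_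
  · exact key.2.differentiableAt.differentiableWithinAt
  · obtain ⟨N, hN⟩ : ∃ N : ℕ, 1 / ((N : ℝ) + 1) < r := exists_nat_one_div_lt hrpos
    have hmem : ∀ n : ℕ, z + ((1 / (((n + N : ℕ) : ℝ) + 1) : ℝ) : ℂ) ∈ V := by
      intro n
      refine hrV ?_
      rw [mem_ball, dist_eq_norm, add_sub_cancel_left, Complex.norm_real,
        Real.norm_of_nonneg (by positivity)]
      refine lt_of_le_of_lt ?_ hN
      gcongr
      simp
    refine aestronglyMeasurable_of_tendsto_ae atTop
      (f := fun (n : ℕ) (t : ℝ) => (((1 / (((n + N : ℕ) : ℝ) + 1) : ℝ) : ℂ))⁻¹ *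
        (k (z + ((1 / (((n + N : ℕ) : ℝ) + 1) : ℝ) : ℂ)) (a + t • (b - a)) * (b - a) -
          k z (a + t • (b - a)) * (b - a))) ?_ ?_
    · intro n
      exact ((hmeas _ (hmem n)).sub (hmeas z hz)).const_mul _
    · refine (MeasureTheory.ae_restrict_iff' measurableSet_uIoc).2 (.of_forall fun t ht => ?_)
      have h1 := (hder _ (hIoc t ht) z hz).mul_const (b - a)
      have h2 := h1.tendsto_slope_zero
      have h3 : Tendsto (fun n : ℕ => ((1 / (((n + N : ℕ) : ℝ) + 1) : ℝ) : ℂ)) atTop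
          (𝓝[≠] 0) := by
        refine tendsto_nhdsWithin_iff.2 ⟨?_, .of_forall fun n => ?_⟩
        · have h4 : Tendsto (fun n : ℕ => (1 / (((n + N : ℕ) : ℝ) + 1) : ℝ)) atTop (𝓝 0) :=
            (tendsto_add_atTop_iff_nat N).2 tendsto_one_div_add_atTop_nhds_zero_nat
          exact_mod_cast (Complex.continuous_ofReal.tendsto 0).comp h4
        · have : (1 / (((n + N : ℕ) : ℝ) + 1) : ℝ) ≠ 0 := by positivity
          simpa only [mem_compl_iff, mem_singleton_iff, Complex.ofReal_eq_zero] using this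
      simpa only [smul_eq_mul, Function.comp_def] using h2.comp h3
  · refine .of_forall fun t ht x hx => ?_
    rw [norm_mul]
    refine mul_le_mul_of_nonneg_right ?_ (norm_nonneg _)
    have hsub : closedBall x (r / 2) ⊆ ball z r := by
      intro y hy
      have := dist_triangle y x z
      rw [mem_closedBall] at hy
      rw [mem_ball] at hx ⊢
      linarith
    refine Complex.norm_deriv_le_of_forall_mem_sphere_norm_le (half_pos hrpos) ?_ ?_
    · exact ((hk _ (hIoc t ht)).mono (hsub.trans hrV)).diffContOnCl_ball subset_rfl
    · exact fun y hy => hrC y (hsub (sphere_subset_closedBall hy)) _ (hIoc t ht)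
  · refine .of_forall fun t ht x hx => ?_
    exact (hder _ (hIoc t ht) x (hrV (ball_subset_ball (half_le_self hrpos.le) hx))).mul_const _

/-- The integral of `u` along a list of segments. -/
def chainInt (l : List (ℂ × ℂ)) (u : ℂ → ℂ) : ℂ := (l.map fun s => segInt u s.1 s.2).sum

/-- The union of the segments in a list. -/
def chainSet (l : List (ℂ × ℂ)) : Set ℂ := {w | ∃ s ∈ l, w ∈ segment ℝ s.1 s.2}

/-- The boundary of a chain of segments, tested against functions. -/
def chainBdry (l : List (ℂ × ℂ)) (f : ℂ → ℂ) : ℂ := (l.map fun s => f s.2 - f s.1).sum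

theorem segment_subset_chainSet {l : List (ℂ × ℂ)} {s : ℂ × ℂ} (hs : s ∈ l) :
    segment ℝ s.1 s.2 ⊆ chainSet l := fun _ hw => ⟨s, hs, hw⟩

theorem chainSet_eq (l : List (ℂ × ℂ)) :
    chainSet l = ⋃ s ∈ {s | s ∈ l}, segment ℝ s.1 s.2 := by
  ext w; simp [chainSet]

theorem isCompact_chainSet (l : List (ℂ × ℂ)) : IsCompact (chainSet l) := by
  rw [chainSet_eq]
  refine (List.finite_toSet l).isCompact_biUnion fun s _ => ?_
  rw [segment_eq_image']
  exact isCompact_Icc.image (by fun_prop)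

theorem chainInt_congr {l : List (ℂ × ℂ)} {u v : ℂ → ℂ} (h : EqOn u v (chainSet l)) :
    chainInt l u = chainInt l v := by
  unfold chainInt
  congr 1
  exact List.map_congr_left fun s hs => segInt_congr (h.mono (segment_subset_chainSet hs))

theorem chainInt_const_mul (l : List (ℂ × ℂ)) (c : ℂ) (u : ℂ → ℂ) :
    chainInt l (fun w => c * u w) = c * chainInt l u := by
  simp only [chainInt, segInt_const_mul, List.sum_map_mul_left]

theorem chainInt_cons (s : ℂ × ℂ) (l : List (ℂ × ℂ)) (u : ℂ → ℂ) :
    chainInt (s :: l) u = segInt u s.1 s.2 + chainInt l u := by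
  simp [chainInt]

theorem chainSet_cons_subset (s : ℂ × ℂ) (l : List (ℂ × ℂ)) : chainSet l ⊆ chainSet (s :: l) :=
  fun _ ⟨t, ht, hw⟩ => ⟨t, List.mem_cons_of_mem _ ht, hw⟩

theorem chainInt_sub {l : List (ℂ × ℂ)} {u v : ℂ → ℂ} (hu : ContinuousOn u (chainSet l))
    (hv : ContinuousOn v (chainSet l)) :
    chainInt l (fun w => u w - v w) = chainInt l u - chainInt l v := by
  induction l with
  | nil => simp [chainInt]
  | cons s l ih =>
    have hs := segment_subset_chainSet (List.mem_cons_self (a := s) (l := l))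
    rw [chainInt_cons, chainInt_cons, chainInt_cons, segInt_sub (hu.mono hs) (hv.mono hs),
      ih (hu.mono (chainSet_cons_subset s l)) (hv.mono (chainSet_cons_subset s l))]
    ring

theorem chainInt_eq_bdry {l : List (ℂ × ℂ)} {f f' : ℂ → ℂ}
    (h : ∀ w ∈ chainSet l, HasDerivAt f (f' w) w) (hc : ContinuousOn f' (chainSet l)) :
    chainInt l f' = chainBdry l f := by
  unfold chainInt chainBdry
  congr 1
  exact List.map_congr_left fun s hs => segInt_eq_sub
    (fun w hw => h w (segment_subset_chainSet hs hw)) (hc.mono (segment_subset_chainSet hs))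

theorem exists_norm_chainInt_le (l : List (ℂ × ℂ)) :
    ∃ B, 0 ≤ B ∧ ∀ (u : ℂ → ℂ) (C : ℝ), (∀ w ∈ chainSet l, ‖u w‖ ≤ C) →
      ‖chainInt l u‖ ≤ C * B := by
  induction l with
  | nil => exact ⟨0, le_rfl, fun u C _ => by simp [chainInt]⟩
  | cons s l ih =>
    obtain ⟨B, hB, h⟩ := ih
    refine ⟨‖s.2 - s.1‖ + B, by positivity, fun u C hC => ?_⟩
    rw [chainInt_cons, mul_add]
    exact norm_add_le_of_le
      (norm_segInt_le fun w hw => hC w (segment_subset_chainSet List.mem_cons_self hw))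
      (h u C fun w hw => hC w (chainSet_cons_subset s l hw))

theorem differentiableOn_chainInt {k : ℂ → ℂ → ℂ} {V : Set ℂ} (hV : IsOpen V)
    {l : List (ℂ × ℂ)}
    (hk : ∀ w ∈ chainSet l, DifferentiableOn ℂ (fun z => k z w) V)
    (hc : ∀ z ∈ V, ContinuousOn (k z) (chainSet l))
    (hb : ∀ z ∈ V, ∃ r > 0, ∃ C, ∀ x ∈ ball z r, ∀ w ∈ chainSet l, ‖k x w‖ ≤ C) :
    DifferentiableOn ℂ (fun z => chainInt l (k z)) V := by
  induction l with
  | nil => simp [chainInt]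
  | cons s l ih =>
    simp only [chainInt_cons]
    have hs := segment_subset_chainSet (List.mem_cons_self (a := s) (l := l))
    have hl := chainSet_cons_subset s l
    refine DifferentiableOn.add (differentiableOn_segInt hV (fun w hw => hk w (hs hw))
      (fun z hz => (hc z hz).mono hs) fun z hz => ?_) (ih (fun w hw => hk w (hl hw))
      (fun z hz => (hc z hz).mono hl) fun z hz => ?_)
    all_goals
      obtain ⟨r, hr, C, hC⟩ := hb z hz
    · exact ⟨r, hr, C, fun x hx w hw => hC x hx w (hs hw)⟩
    · exact ⟨r, hr, C, fun x hx w hw => hC x hx w (hl hw)⟩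

theorem continuousOn_inv_sub {K : Set ℂ} {z : ℂ} (hz : z ∉ K) :
    ContinuousOn (fun w => (w - z)⁻¹) K :=
  ContinuousOn.inv₀ (by fun_prop) fun w hw h => hz (sub_eq_zero.1 h ▸ hw)

/-- Up to a factor, the winding number of a chain around `z`. -/
def chainIndex (l : List (ℂ × ℂ)) (z : ℂ) : ℂ := chainInt l fun w => (w - z)⁻¹

theorem chainIndex_eventually_const {l : List (ℂ × ℂ)} (hl : chainBdry l = 0) {z : ℂ}
    (hz : z ∉ chainSet l) : ∀ᶠ x in 𝓝 z, chainIndex l x = chainIndex l z := by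
  obtain ⟨r, hr, hball⟩ := Metric.isOpen_iff.1 (isCompact_chainSet l).isClosed.isOpen_compl z hz
  filter_upwards [ball_mem_nhds z hr] with x hx
  have hxK : x ∉ chainSet l := hball hx
  rw [← sub_eq_zero, chainIndex, chainIndex, ← chainInt_sub (continuousOn_inv_sub hxK)
    (continuousOn_inv_sub hz)]
  rw [chainInt_eq_bdry (f := fun w => Complex.log ((w - x) / (w - z))), hl]
  · rfl
  · intro w hw
    have h1 : w - z ≠ 0 := fun h => hz (sub_eq_zero.1 h ▸ hw)
    have h2 : w - x ≠ 0 := fun h => hxK (sub_eq_zero.1 h ▸ hw)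
    have h3 : r ≤ ‖w - z‖ := by
      by_contra! h
      exact hball (by rwa [mem_ball, dist_eq_norm]) hw
    have hslit : (w - x) / (w - z) ∈ Complex.slitPlane := by
      have : (w - x) / (w - z) = 1 + (z - x) / (w - z) := by field_simp; ring
      rw [this]
      refine Complex.mem_slitPlane_of_norm_lt_one ?_
      rw [norm_div, div_lt_one (norm_pos_iff.2 h1), ← dist_eq_norm, dist_comm]
      exact (mem_ball.1 hx).trans_le h3
    refine ((((hasDerivAt_id w).sub_const x).div ((hasDerivAt_id w).sub_const z) h1).clog
      hslit).congr_deriv ?_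
    simp only [id, Pi.div_apply]
    field_simp
  · exact (continuousOn_inv_sub hxK).sub (continuousOn_inv_sub hz)

theorem chainIndex_eq_zero_of_large {l : List (ℂ × ℂ)} (hl : chainBdry l = 0) {z : ℂ}
    (hz : ∀ w ∈ chainSet l, ‖w‖ < ‖z‖) : chainIndex l z = 0 := by
  have hzK : z ∉ chainSet l := fun h => lt_irrefl _ (hz z h)
  rw [chainIndex, chainInt_eq_bdry (f := fun w => Complex.log (1 + -w / z)), hl]
  · rfl
  · intro w hw
    have hz0 : z ≠ 0 := norm_pos_iff.1 ((norm_nonneg w).trans_lt (hz w hw))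
    have h1 : w - z ≠ 0 := fun h => hzK (sub_eq_zero.1 h ▸ hw)
    have hslit : 1 + -w / z ∈ Complex.slitPlane := by
      refine Complex.mem_slitPlane_of_norm_lt_one ?_
      rw [norm_div, norm_neg, div_lt_one (norm_pos_iff.2 hz0)]
      exact hz w hw
    have h2 : 1 + -w / z ≠ 0 := Complex.slitPlane_ne_zero hslit
    refine ((((hasDerivAt_id w).neg.div_const z).const_add 1).clog hslit).congr_deriv ?_
    have h3 : z - w ≠ 0 := fun h => h1 (by linear_combination -h)
    have h4 : z + -w ≠ 0 := by rwa [← sub_eq_add_neg]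
    simp only [id, Pi.neg_apply]
    field_simp
    ring_nf
    try rw [← neg_sub, inv_neg]
  · exact continuousOn_inv_sub hzK

theorem chainIndex_const_on {l : List (ℂ × ℂ)} (hl : chainBdry l = 0) {C : Set ℂ}
    (hC : IsPreconnected C) (hCK : C ⊆ (chainSet l)ᶜ) {x y : ℂ} (hx : x ∈ C) (hy : y ∈ C) :
    chainIndex l x = chainIndex l y :=
  hC.induction₂ (fun x y => chainIndex l x = chainIndex l y)
    (fun _ hx => mem_nhdsWithin_of_mem_nhds
      ((chainIndex_eventually_const hl (hCK hx)).mono fun _ h => h.symm))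
    (fun _ _ _ _ _ _ h h' => h.trans h') (fun _ _ _ _ h => h.symm) hx hy

theorem chainIndex_eq_zero_of_unbounded {l : List (ℂ × ℂ)} (hl : chainBdry l = 0) {a : ℂ}
    (ha : a ∉ chainSet l)
    (hunb : ¬ Bornology.IsBounded (connectedComponentIn (chainSet l)ᶜ a)) :
    chainIndex l a = 0 := by
  obtain ⟨R, hR⟩ := (isCompact_chainSet l).isBounded.exists_norm_le
  obtain ⟨y, hy, hyR⟩ : ∃ y ∈ connectedComponentIn (chainSet l)ᶜ a, R < ‖y‖ := by
    by_contra! h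
    exact hunb (isBounded_iff_forall_norm_le.2 ⟨R, h⟩)
  rw [chainIndex_const_on hl isPreconnected_connectedComponentIn
    (connectedComponentIn_subset _ _) (mem_connectedComponentIn ha) hy]
  exact chainIndex_eq_zero_of_large hl fun w hw => (hR w hw).trans_lt hyR

theorem dslope_swap (u : ℂ → ℂ) (z w : ℂ) : dslope u z w = dslope u w z := by
  rcases eq_or_ne w z with rfl | h
  · rfl
  · rw [dslope_of_ne _ h, dslope_of_ne _ h.symm, slope_comm]

theorem continuousOn_dslope_of_isOpen {Ω : Set ℂ} (hΩ : IsOpen Ω) {u : ℂ → ℂ}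
    (hu : DifferentiableOn ℂ u Ω) {z : ℂ} (hz : z ∈ Ω) : ContinuousOn (dslope u z) Ω :=
  ((Complex.differentiableOn_dslope (hΩ.mem_nhds hz)).2 hu).continuousOn

theorem exists_norm_dslope_le {Ω K : Set ℂ} (hΩ : IsOpen Ω) (hK : IsCompact K) (hKΩ : K ⊆ Ω)
    {u : ℂ → ℂ} (hu : DifferentiableOn ℂ u Ω) {z : ℂ} (hz : z ∈ Ω) :
    ∃ r > 0, ∃ C, ∀ x ∈ ball z r, ∀ w ∈ K, ‖dslope u x w‖ ≤ C := by
  obtain ⟨r, hr, hball⟩ := Metric.nhds_basis_closedBall.mem_iff.1 (hΩ.mem_nhds hz)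
  obtain ⟨M, hM⟩ := (hK.union (isCompact_closedBall z r)).exists_bound_of_continuousOn
    (hu.continuousOn.mono (union_subset hKΩ hball))
  obtain ⟨D, hD⟩ := (isCompact_closedBall z r).exists_bound_of_continuousOn
    ((hu.deriv hΩ).continuousOn.mono hball)
  refine ⟨r / 2, half_pos hr, max D ((2 / r) * (2 * M)), fun x hx w hw => ?_⟩
  have hxr : x ∈ closedBall z r := by
    rw [mem_closedBall]; rw [mem_ball] at hx; linarith
  rcases eq_or_ne w x with rfl | hwx
  · rw [dslope_same]
    exact (hD w hxr).trans (le_max_left _ _)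
  rw [dslope_of_ne _ hwx, slope_def_field, norm_div]
  have hpos : 0 < ‖w - x‖ := norm_pos_iff.2 (sub_ne_zero.2 hwx)
  rw [div_le_iff₀ hpos]
  rcases lt_or_ge ‖w - x‖ (r / 2) with h | h
  · have hwr : w ∈ closedBall z r := by
      rw [mem_closedBall]; rw [mem_ball] at hx
      rw [← dist_eq_norm] at h
      linarith [dist_triangle w x z]
    have := (convex_closedBall z r).norm_image_sub_le_of_norm_deriv_le (f := u) (C := D)
      (fun y hy => hu.differentiableAt (hΩ.mem_nhds (hball hy))) hD hxr hwr
    exact this.trans (mul_le_mul_of_nonneg_right (le_max_left _ _) hpos.le)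
  · have h1 := hM w (Or.inl hw)
    have h2 := hM x (Or.inr hxr)
    have hM0 : 0 ≤ M := (norm_nonneg _).trans h1
    calc ‖u w - u x‖ ≤ 2 * M := by linarith [norm_sub_le (u w) (u x)]
      _ = (2 / r) * (2 * M) * (r / 2) := by field_simp
      _ ≤ (2 / r) * (2 * M) * ‖w - x‖ := by gcongr
      _ ≤ _ := mul_le_mul_of_nonneg_right (le_max_right _ _) hpos.le

theorem chainInt_dslope_eq_zero {Ω : Set ℂ} (hΩ : IsOpen Ω) {l : List (ℂ × ℂ)}
    (hl : chainBdry l = 0) (hlΩ : chainSet l ⊆ Ω) (hind : ∀ a ∉ Ω, chainIndex l a = 0)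
    {u : ℂ → ℂ} (hu : DifferentiableOn ℂ u Ω) {z : ℂ} (hz : z ∈ Ω) :
    chainInt l (dslope u z) = 0 := by
  classical
  set K := chainSet l with hKdef
  have hK : IsCompact K := isCompact_chainSet l
  have huK : ContinuousOn u K := hu.continuousOn.mono hlΩ
  set V : Set ℂ := {z | z ∉ K ∧ chainIndex l z = 0} with hV
  have hVo : IsOpen V := by
    rw [isOpen_iff_mem_nhds]
    rintro x ⟨hx, hx0⟩
    filter_upwards [chainIndex_eventually_const hl hx, hK.isClosed.isOpen_compl.mem_nhds hx]
      with y hy hyK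
    exact ⟨hyK, hy.trans hx0⟩
  have hΩV : ∀ x ∉ Ω, x ∈ V := fun x hx => ⟨fun h => hx (hlΩ h), hind x hx⟩
  set h : ℂ → ℂ := fun x => if x ∈ Ω then chainInt l (dslope u x) else
    chainInt l (fun w => u w * (w - x)⁻¹) with hh
  have hhV : ∀ x ∈ V, h x = chainInt l (fun w => u w * (w - x)⁻¹) := by
    intro x hx
    by_cases hxΩ : x ∈ Ω
    · have h1 : EqOn (dslope u x) (fun w => u w * (w - x)⁻¹ - u x * (w - x)⁻¹) K := by
        intro w hw
        have : w ≠ x := fun h => hx.1 (h ▸ hw)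
        rw [dslope_of_ne _ this, slope_def_field]
        ring
      have hc := continuousOn_inv_sub hx.1
      rw [hh]
      simp only [if_pos hxΩ]
      rw [chainInt_congr h1, chainInt_sub (u := fun w => u w * (w - x)⁻¹)
        (v := fun w => u x * (w - x)⁻¹) (huK.mul hc) (continuousOn_const.mul hc),
        chainInt_const_mul]
      change _ - u x * chainIndex l x = _
      rw [hx.2, mul_zero, sub_zero]
    · simp only [hh, if_neg hxΩ]
  have hd1 : DifferentiableOn ℂ (fun x => chainInt l (dslope u x)) Ω := by
    refine differentiableOn_chainInt hΩ (fun w hw => ?_) (fun x hx => ?_) fun x hx => ?_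
    · simp only [dslope_swap u _ w]
      exact (Complex.differentiableOn_dslope (hΩ.mem_nhds (hlΩ hw))).2 hu
    · exact (continuousOn_dslope_of_isOpen hΩ hu hx).mono hlΩ
    · exact exists_norm_dslope_le hΩ hK hlΩ hu hx
  obtain ⟨M, hM⟩ := hK.exists_bound_of_continuousOn huK
  have hd2 : DifferentiableOn ℂ (fun x => chainInt l (fun w => u w * (w - x)⁻¹)) V := by
    refine differentiableOn_chainInt (k := fun x w => u w * (w - x)⁻¹) hVo (fun w hw => ?_)
      (fun x hx => huK.mul (continuousOn_inv_sub hx.1)) fun x hx => ?_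
    · refine DifferentiableOn.const_mul (DifferentiableOn.inv (by fun_prop) fun x hx h => ?_) _
      exact hx.1 (sub_eq_zero.1 h ▸ hw)
    · obtain ⟨r, hr, hball⟩ := Metric.isOpen_iff.1 hVo x hx
      refine ⟨r / 2, half_pos hr, M * (r / 2)⁻¹, fun y hy w hw => ?_⟩
      rw [norm_mul, norm_inv]
      have h1 : r / 2 ≤ ‖w - y‖ := by
        by_contra! hlt
        rw [← dist_eq_norm] at hlt
        rw [mem_ball] at hy
        exact (hball (show w ∈ ball x r by
          rw [mem_ball]; linarith [dist_triangle w y x])).1 hw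
      have hM0 : 0 ≤ M := (norm_nonneg _).trans (hM w hw)
      gcongr
      exact hM w hw
  have hent : Differentiable ℂ h := by
    intro x
    by_cases hx : x ∈ Ω
    · refine (hd1.differentiableAt (hΩ.mem_nhds hx)).congr_of_eventuallyEq ?_
      filter_upwards [hΩ.mem_nhds hx] with y hy
      simp only [hh, if_pos hy]
    · have hxV := hΩV x hx
      refine (hd2.differentiableAt (hVo.mem_nhds hxV)).congr_of_eventuallyEq ?_
      filter_upwards [hVo.mem_nhds hxV] with y hy using hhV y hy
  have hlim : Tendsto h (cocompact ℂ) (𝓝 0) := by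
    obtain ⟨R, hR⟩ := hK.isBounded.exists_norm_le
    obtain ⟨B, hB, hBle⟩ := exists_norm_chainInt_le l
    have hnorm := tendsto_norm_cocompact_atTop (E := ℂ)
    have hz : Tendsto (fun x : ℂ => |M| * (‖x‖ - R)⁻¹ * B) (cocompact ℂ) (𝓝 0) := by
      have : Tendsto (fun x : ℂ => (‖x‖ - R)⁻¹) (cocompact ℂ) (𝓝 0) :=
        (tendsto_atTop_add_const_right _ (-R) hnorm).inv_tendsto_atTop
      simpa using (this.const_mul |M|).mul_const B
    refine squeeze_zero_norm' ?_ hz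
    filter_upwards [hnorm.eventually_gt_atTop R] with x hx
    have hxK : ∀ w ∈ K, ‖w‖ < ‖x‖ := fun w hw => (hR w hw).trans_lt hx
    rw [hhV x ⟨fun hxK' => lt_irrefl _ (hxK x hxK'), chainIndex_eq_zero_of_large hl hxK⟩]
    refine hBle _ _ fun w hw => ?_
    rw [norm_mul, norm_inv]
    have h1 : ‖x‖ - R ≤ ‖w - x‖ := by
      have := norm_sub_norm_le x w
      rw [norm_sub_rev] at this
      linarith [hR w hw]
    have : 0 < ‖x‖ - R := by linarith
    gcongr
    exact (hM w hw).trans (le_abs_self M)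
  have := hent.apply_eq_of_tendsto_cocompact z hlim
  simpa only [hh, if_pos hz] using this

/-- Cauchy's theorem (Dixon's proof) for chains of segments. -/
theorem chainInt_eq_zero {Ω : Set ℂ} (hΩ : IsOpen Ω) {l : List (ℂ × ℂ)}
    (hl : chainBdry l = 0) (hlΩ : chainSet l ⊆ Ω) (hind : ∀ a ∉ Ω, chainIndex l a = 0)
    {v : ℂ → ℂ} (hv : DifferentiableOn ℂ v Ω) : chainInt l v = 0 := by
  by_cases hsub : Ω ⊆ chainSet l
  · have heq : Ω = chainSet l := hsub.antisymm hlΩ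
    have hK := isCompact_chainSet l
    rcases isClopen_iff.1 (⟨heq ▸ hK.isClosed, hΩ⟩ : IsClopen Ω) with h | h
    · have : EqOn v (fun _ => 0 * 0) (chainSet l) := by rw [← heq, h]; exact eqOn_empty _ _
      rw [chainInt_congr this, chainInt_const_mul, zero_mul]
    · exact absurd (h ▸ heq ▸ hK) (noncompact_univ ℂ)
  · obtain ⟨z, hz, hzK⟩ := not_subset.1 hsub
    have h := chainInt_dslope_eq_zero hΩ hl hlΩ hind (u := fun w => (w - z) * v w)
      (by fun_prop) hz
    rw [← h]
    refine chainInt_congr fun w hw => ?_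
    have hwz : w ≠ z := fun h => hzK (h ▸ hw)
    rw [dslope_of_ne _ hwz, slope_def_field]
    have := sub_ne_zero.2 hwz
    field_simp
    simp

theorem chainBdry_append (l l' : List (ℂ × ℂ)) :
    chainBdry (l ++ l') = chainBdry l + chainBdry l' := by
  funext f; simp [chainBdry]

theorem chainInt_append (l l' : List (ℂ × ℂ)) (u : ℂ → ℂ) :
    chainInt (l ++ l') u = chainInt l u + chainInt l' u := by
  simp [chainInt]

theorem chainSet_append (l l' : List (ℂ × ℂ)) :
    chainSet (l ++ l') = chainSet l ∪ chainSet l' := by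
  ext w; simp [chainSet, or_and_right, exists_or]

theorem chainBdry_swap (l : List (ℂ × ℂ)) :
    chainBdry (l.map Prod.swap) = -chainBdry l := by
  funext f
  induction l with
  | nil => simp [chainBdry]
  | cons s l ih =>
    simp only [chainBdry, List.map_cons, List.sum_cons, Prod.fst_swap, Prod.snd_swap,
      Pi.neg_apply] at ih ⊢
    rw [ih]; ring

theorem chainInt_swap (l : List (ℂ × ℂ)) (u : ℂ → ℂ) :
    chainInt (l.map Prod.swap) u = -chainInt l u := by
  induction l with
  | nil => simp [chainInt]
  | cons s l ih =>
    rw [List.map_cons, chainInt_cons, chainInt_cons, ih, Prod.fst_swap, Prod.snd_swap,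
      segInt_swap]
    ring

theorem chainSet_swap (l : List (ℂ × ℂ)) : chainSet (l.map Prod.swap) = chainSet l := by
  ext w
  simp only [chainSet, List.mem_map, mem_ofPred_eq]
  constructor
  · rintro ⟨_, ⟨s, hs, rfl⟩, hw⟩
    exact ⟨s, hs, by rwa [Prod.fst_swap, Prod.snd_swap, segment_symm] at hw⟩
  · rintro ⟨s, hs, hw⟩
    exact ⟨_, ⟨s, hs, rfl⟩, by rwa [Prod.fst_swap, Prod.snd_swap, segment_symm]⟩

theorem exists_chain {Ω : Set ℂ} (hΩ : IsOpen Ω) (hc : IsPreconnected Ω) {x y : ℂ}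
    (hx : x ∈ Ω) (hy : y ∈ Ω) :
    ∃ l : List (ℂ × ℂ), chainSet l ⊆ Ω ∧ ∀ f, chainBdry l f = f y - f x := by
  refine hc.induction₂ (fun x y => ∃ l : List (ℂ × ℂ), chainSet l ⊆ Ω ∧
    ∀ f, chainBdry l f = f y - f x) (fun x hx => ?_) ?_ ?_ hx hy
  · obtain ⟨r, hr, hball⟩ := Metric.isOpen_iff.1 hΩ x hx
    filter_upwards [mem_nhdsWithin_of_mem_nhds (ball_mem_nhds x hr)] with y hy
    refine ⟨[(x, y)], ?_, fun f => by simp [chainBdry]⟩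
    rintro w ⟨s, hs, hw⟩
    rw [List.mem_singleton] at hs
    subst hs
    exact hball ((convex_ball x r).segment_subset (mem_ball_self hr) hy hw)
  · rintro x y z - - - ⟨l, hl, hlb⟩ ⟨l', hl', hlb'⟩
    refine ⟨l ++ l', by rw [chainSet_append]; exact union_subset hl hl', fun f => ?_⟩
    rw [chainBdry_append, Pi.add_apply, hlb, hlb']; ring
  · rintro x y - - ⟨l, hl, hlb⟩
    refine ⟨l.map Prod.swap, by rwa [chainSet_swap], fun f => ?_⟩
    rw [chainBdry_swap, Pi.neg_apply, hlb]; ring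

/-- A domain with no bounded complementary pieces relative to its compact subsets. -/
def HasUnboundedComplement (Ω : Set ℂ) : Prop :=
  ∀ K ⊆ Ω, IsCompact K → ∀ a ∉ Ω, ¬ Bornology.IsBounded (connectedComponentIn Kᶜ a)

theorem exists_primitive {Ω : Set ℂ} (hΩ : IsOpen Ω) (hc : IsPreconnected Ω)
    (hunb : HasUnboundedComplement Ω) {v : ℂ → ℂ} (hv : DifferentiableOn ℂ v Ω) :
    ∃ Φ : ℂ → ℂ, ∀ z ∈ Ω, HasDerivAt Φ (v z) z := by
  rcases Ω.eq_empty_or_nonempty with rfl | ⟨z₀, hz₀⟩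
  · exact ⟨0, fun z hz => absurd hz (notMem_empty z)⟩
  have hex : ∀ x, ∃ l : List (ℂ × ℂ), x ∈ Ω → chainSet l ⊆ Ω ∧
      ∀ f, chainBdry l f = f x - f z₀ := by
    intro x
    by_cases hx : x ∈ Ω
    · obtain ⟨l, hl⟩ := exists_chain hΩ hc hz₀ hx
      exact ⟨l, fun _ => hl⟩
    · exact ⟨[], fun h => absurd h hx⟩
  choose c hcΩ using hex
  refine ⟨fun x => chainInt (c x) v, fun x hx => ?_⟩
  obtain ⟨r, hr, hball⟩ := Metric.isOpen_iff.1 hΩ x hx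
  obtain ⟨g, hg⟩ := (hv.mono hball).isExactOn_ball
  have hloc : ∀ y ∈ ball x r, chainInt (c y) v = chainInt (c x) v + (g y - g x) := by
    intro y hy
    have hseg : segment ℝ x y ⊆ ball x r :=
      (convex_ball x r).segment_subset (mem_ball_self hr) hy
    have hyΩ := hball hy
    set l := (c y).map Prod.swap ++ (c x ++ [(x, y)]) with hldef
    have hb : chainBdry l = 0 := by
      funext f
      rw [hldef, chainBdry_append, chainBdry_append, chainBdry_swap]
      simp only [Pi.add_apply, Pi.neg_apply, (hcΩ y hyΩ).2, (hcΩ x hx).2]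
      simp [chainBdry]
    have hsub : chainSet l ⊆ Ω := by
      rw [hldef, chainSet_append, chainSet_append, chainSet_swap]
      refine union_subset (hcΩ y hyΩ).1 (union_subset (hcΩ x hx).1 ?_)
      rintro w ⟨s, hs, hw⟩
      rw [List.mem_singleton] at hs
      subst hs
      exact hball (hseg hw)
    have hz := chainInt_eq_zero hΩ hb hsub (fun a ha => chainIndex_eq_zero_of_unbounded hb
      (fun h => ha (hsub h)) (hunb _ hsub (isCompact_chainSet l) a ha)) hv
    rw [hldef, chainInt_append, chainInt_append, chainInt_swap] at hz
    have hs : chainInt [(x, y)] v = g y - g x := by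
      simp only [chainInt, List.map_cons, List.map_nil, List.sum_cons, List.sum_nil, add_zero]
      exact segInt_eq_sub (fun w hw => hg w (hseg hw))
        (hv.continuousOn.mono (hseg.trans hball))
    rw [hs] at hz
    linear_combination -hz
  have : HasDerivAt (fun y => chainInt (c x) v + (g y - g x)) (v x) x := by
    simpa using ((hg x (mem_ball_self hr)).sub_const (g x)).const_add (chainInt (c x) v)
  refine this.congr_of_eventuallyEq ?_
  filter_upwards [ball_mem_nhds x hr] with y hy using hloc y hy

theorem hasHolomorphicSqrt_of_hasUnboundedComplement {Ω : Set ℂ} (hΩ : IsOpen Ω)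
    (hc : IsPreconnected Ω) (hunb : HasUnboundedComplement Ω) : HasHolomorphicSqrt Ω := by
  intro f hf hf0
  rcases Ω.eq_empty_or_nonempty with rfl | ⟨z₀, hz₀⟩
  · exact ⟨0, differentiableOn_empty, fun z hz => absurd hz (notMem_empty z)⟩
  obtain ⟨Φ, hΦ⟩ := exists_primitive hΩ hc hunb (v := fun z => deriv f z / f z)
    ((hf.deriv hΩ).div hf hf0)
  have hder : ∀ z ∈ Ω, HasDerivAt (fun z => f z * Complex.exp (-Φ z)) 0 z := by
    intro z hz
    refine ((hf.differentiableAt (hΩ.mem_nhds hz)).hasDerivAt.mul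
      (hΦ z hz).neg.cexp).congr_deriv ?_
    have := hf0 z hz
    field_simp
    ring
  have hconst : ∀ z ∈ Ω, f z * Complex.exp (-Φ z) = f z₀ * Complex.exp (-Φ z₀) := fun z hz =>
    hΩ.is_const_of_deriv_eq_zero hc
      (fun z hz => (hder z hz).differentiableAt.differentiableWithinAt)
      (fun z hz => (hder z hz).deriv) hz hz₀
  set k := f z₀ * Complex.exp (-Φ z₀) with hk
  have hk0 : k ≠ 0 := mul_ne_zero (hf0 z₀ hz₀) (Complex.exp_ne_zero _)
  refine ⟨fun z => Complex.exp ((Φ z + Complex.log k) / 2), fun z hz => ?_, fun z hz => ?_⟩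
  · exact (((hΦ z hz).add_const _).div_const 2).cexp.differentiableAt.differentiableWithinAt
  · rw [← Complex.exp_nat_mul]
    push_cast
    rw [mul_div_cancel₀ _ two_ne_zero, Complex.exp_add, Complex.exp_log hk0, ← hconst z hz,
      Complex.exp_neg]
    field_simp [Complex.exp_ne_zero]

/-- The complex Euclidean plane. -/
abbrev E2 : Type := EuclideanSpace ℂ (Fin 2)

theorem E2.norm_sq (z : E2) : ‖z‖ ^ 2 = ‖z 0‖ ^ 2 + ‖z 1‖ ^ 2 := by
  rw [EuclideanSpace.norm_sq_eq, Fin.sum_univ_two]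

theorem E2.norm_apply_le (z : E2) (i : Fin 2) : ‖z i‖ ≤ ‖z‖ := PiLp.norm_apply_le z i

theorem E2.inner_eq (p z : E2) :
    inner ℂ p z = (starRingEnd ℂ) (p 0) * z 0 + (starRingEnd ℂ) (p 1) * z 1 := by
  rw [PiLp.inner_apply, Fin.sum_univ_two]
  simp [mul_comm]

/-- The quaternionic structure `(z₀, z₁) ↦ (-conj z₁, conj z₀)`. -/
def quatJ (z : E2) : E2 := !₂[-(starRingEnd ℂ) (z 1), (starRingEnd ℂ) (z 0)]

@[simp] theorem quatJ_zero (z : E2) : quatJ z 0 = -(starRingEnd ℂ) (z 1) := rfl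
@[simp] theorem quatJ_one (z : E2) : quatJ z 1 = (starRingEnd ℂ) (z 0) := rfl

theorem norm_quatJ (z : E2) : ‖quatJ z‖ = ‖z‖ := by
  rw [← sq_eq_sq₀ (norm_nonneg _) (norm_nonneg _), E2.norm_sq, E2.norm_sq]
  simp [add_comm]

theorem inner_quatJ_self (z : E2) : inner ℂ z (quatJ z) = 0 := by
  rw [E2.inner_eq]; simp; ring

/-- An algebraic curve `ℂ → ℂ²` with polynomial components. -/
def PolyCurve (F : ℂ → E2) : Prop :=
  ∃ P Q : Polynomial ℂ, ∀ ζ, F ζ 0 = P.eval ζ ∧ F ζ 1 = Q.eval ζ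

theorem PolyCurve.differentiable {F : ℂ → E2} (h : PolyCurve F) : Differentiable ℂ F := by
  obtain ⟨P, Q, hPQ⟩ := h
  rw [differentiable_euclidean]
  intro i
  fin_cases i
  · simp only [Fin.zero_eta, Fin.isValue, fun ζ => (hPQ ζ).1]
    exact P.differentiable
  · simp only [Fin.mk_one, Fin.isValue, fun ζ => (hPQ ζ).2]
    exact Q.differentiable

theorem PolyCurve.continuous {F : ℂ → E2} (h : PolyCurve F) : Continuous F :=
  h.differentiable.continuous

theorem PolyCurve.clm_comp {F : ℂ → E2} (h : PolyCurve F) (ℓ : E2 →L[ℂ] ℂ) :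
    ∃ R : Polynomial ℂ, ∀ ζ, ℓ (F ζ) = R.eval ζ := by
  obtain ⟨P, Q, hPQ⟩ := h
  refine ⟨Polynomial.C (ℓ (EuclideanSpace.single 0 1)) * P +
    Polynomial.C (ℓ (EuclideanSpace.single 1 1)) * Q, fun ζ => ?_⟩
  have : F ζ = (F ζ 0) • EuclideanSpace.single 0 1 + (F ζ 1) • EuclideanSpace.single 1 1 := by
    ext i; fin_cases i <;> simp
  rw [this, map_add, map_smul, map_smul, (hPQ ζ).1, (hPQ ζ).2]
  simp [mul_comm]

/-- Holomorphic automorphisms of `ℂ²` preserving polynomial curves. -/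
structure IsAut (ψ : E2 ≃ E2) : Prop where
  diff : Differentiable ℂ ψ
  diff_symm : Differentiable ℂ ψ.symm
  poly : ∀ F, PolyCurve F → PolyCurve (fun ζ => ψ (F ζ))

theorem IsAut.refl : IsAut (Equiv.refl E2) :=
  ⟨differentiable_id, differentiable_id, fun _ h => h⟩

theorem IsAut.trans {ψ ψ' : E2 ≃ E2} (h : IsAut ψ) (h' : IsAut ψ') : IsAut (ψ.trans ψ') :=
  ⟨h'.diff.comp h.diff, h.diff_symm.comp h'.diff_symm, fun F hF => h'.poly _ (h.poly F hF)⟩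

/-- `ψ` and its inverse move the points of `S` by at most `ε`. -/
def NearOn (ψ : E2 ≃ E2) (S : Set E2) (ε : ℝ) : Prop :=
  ∀ z ∈ S, dist (ψ z) z ≤ ε ∧ dist (ψ.symm z) z ≤ ε

theorem NearOn.mono {ψ : E2 ≃ E2} {S S' : Set E2} {ε ε' : ℝ} (h : NearOn ψ S ε) (hS : S' ⊆ S)
    (hε : ε ≤ ε') : NearOn ψ S' ε' :=
  fun z hz => ⟨(h z (hS hz)).1.trans hε, (h z (hS hz)).2.trans hε⟩

theorem NearOn.refl (S : Set E2) {ε : ℝ} (hε : 0 ≤ ε) : NearOn (Equiv.refl E2) S ε :=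
  fun z _ => by simpa using hε

theorem NearOn.trans {ψ ψ' : E2 ≃ E2} {S S' : Set E2} {ε ε' δ : ℝ} (h : NearOn ψ S' ε)
    (h' : NearOn ψ' S' ε') (hS : cthickening δ S ⊆ S') (hε : ε ≤ δ) (hε' : ε' ≤ δ) :
    NearOn (ψ.trans ψ') S (ε + ε') := by
  have hSS : S ⊆ S' := (self_subset_cthickening S).trans hS
  have hmem : ∀ z ∈ S, ∀ y, dist y z ≤ δ → y ∈ S' := fun z hz y hy =>
    hS (mem_cthickening_of_dist_le y z δ S hz hy)
  intro z hz
  have h1 := h z (hSS hz)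
  have h2 := h' z (hSS hz)
  constructor
  · have := (h' (ψ z) (hmem z hz _ (h1.1.trans hε))).1
    have := dist_triangle (ψ' (ψ z)) (ψ z) z
    simp only [Equiv.trans_apply]
    linarith
  · have := (h (ψ'.symm z) (hmem z hz _ (h2.2.trans hε'))).2
    have := dist_triangle (ψ.symm (ψ'.symm z)) (ψ'.symm z) z
    simp only [Equiv.symm_trans_apply]
    linarith

/-- The shear `z ↦ z + g (ℓ z) v` where `ℓ v = 0`. -/
def shear (ℓ : E2 →L[ℂ] ℂ) (v : E2) (hv : ℓ v = 0) (g : Polynomial ℂ) : E2 ≃ E2 where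
  toFun z := z + g.eval (ℓ z) • v
  invFun z := z - g.eval (ℓ z) • v
  left_inv z := by simp [hv]
  right_inv z := by simp [hv]

theorem shear_apply (ℓ : E2 →L[ℂ] ℂ) (v : E2) (hv : ℓ v = 0) (g : Polynomial ℂ) (z : E2) :
    shear ℓ v hv g z = z + g.eval (ℓ z) • v := rfl

theorem shear_symm_apply (ℓ : E2 →L[ℂ] ℂ) (v : E2) (hv : ℓ v = 0) (g : Polynomial ℂ) (z : E2) :
    (shear ℓ v hv g).symm z = z - g.eval (ℓ z) • v := rfl

theorem isAut_shear (ℓ : E2 →L[ℂ] ℂ) (v : E2) (hv : ℓ v = 0) (g : Polynomial ℂ) :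
    IsAut (shear ℓ v hv g) := by
  have hg : Differentiable ℂ fun z : E2 => g.eval (ℓ z) := g.differentiable.comp ℓ.differentiable
  refine ⟨differentiable_id.add (hg.smul_const v), differentiable_id.sub (hg.smul_const v), ?_⟩
  intro F hF
  obtain ⟨R, hR⟩ := hF.clm_comp ℓ
  obtain ⟨P, Q, hPQ⟩ := hF
  refine ⟨P + g.comp R * Polynomial.C (v 0), Q + g.comp R * Polynomial.C (v 1), fun ζ => ?_⟩
  simp [shear_apply, hPQ, hR]

theorem nearOn_shear {ℓ : E2 →L[ℂ] ℂ} {v : E2} (hv : ℓ v = 0) {g : Polynomial ℂ} {S : Set E2}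
    {ε : ℝ} (h : ∀ z ∈ S, ‖g.eval (ℓ z)‖ * ‖v‖ ≤ ε) : NearOn (shear ℓ v hv g) S ε := by
  intro z hz
  have := h z hz
  rw [shear_apply, shear_symm_apply, dist_eq_norm, dist_eq_norm]
  simpa [norm_smul] using this

/-- Injective immersed polynomial curves. -/
structure EmbCurve (F : ℂ → E2) : Prop where
  poly : PolyCurve F
  inj : Function.Injective F
  deriv_ne : ∀ ζ, deriv F ζ ≠ 0

theorem EmbCurve.comp {F : ℂ → E2} (hF : EmbCurve F) {ψ : E2 ≃ E2} (hψ : IsAut ψ) :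
    EmbCurve (fun ζ => ψ (F ζ)) := by
  refine ⟨hψ.poly F hF.poly, ψ.injective.comp hF.inj, fun ζ h => hF.deriv_ne ζ ?_⟩
  have h1 : F = fun ζ => ψ.symm (ψ (F ζ)) := by simp
  have h2 : HasDerivAt (fun ζ => ψ (F ζ)) 0 ζ := by
    rw [← h]; exact ((hψ.poly F hF.poly).differentiable ζ).hasDerivAt
  have h3 := (hψ.diff_symm (ψ (F ζ))).hasFDerivAt.comp_hasDerivAt ζ h2
  rw [map_zero] at h3
  rw [h1]
  exact h3.deriv

theorem Polynomial.isBounded_norm_le {P : Polynomial ℂ} (hP : 0 < P.degree) (R : ℝ) :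
    Bornology.IsBounded {ζ | ‖P.eval ζ‖ ≤ R} := by
  have h := (P.tendsto_norm_atTop hP (tendsto_norm_cobounded_atTop (E := ℂ))).eventually_gt_atTop R
  rw [← Bornology.isCobounded_compl_iff]
  filter_upwards [h] with z hz
  simpa using hz

theorem EmbCurve.isBounded_norm_le {F : ℂ → E2} (hF : EmbCurve F) (R : ℝ) :
    Bornology.IsBounded {ζ | ‖F ζ‖ ≤ R} := by
  obtain ⟨P, Q, hPQ⟩ := hF.poly
  by_cases hP : 0 < P.degree
  · refine (Polynomial.isBounded_norm_le hP R).subset fun ζ hζ => ?_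
    change ‖P.eval ζ‖ ≤ R
    rw [← (hPQ ζ).1]
    exact (E2.norm_apply_le _ _).trans hζ
  by_cases hQ : 0 < Q.degree
  · refine (Polynomial.isBounded_norm_le hQ R).subset fun ζ hζ => ?_
    change ‖Q.eval ζ‖ ≤ R
    rw [← (hPQ ζ).2]
    exact (E2.norm_apply_le _ _).trans hζ
  · rw [not_lt] at hP hQ
    rw [Polynomial.eq_C_of_degree_le_zero hP, Polynomial.eq_C_of_degree_le_zero hQ] at hPQ
    have : F 0 = F 1 := by
      ext i
      fin_cases i
      · simp [hPQ]
      · simp [hPQ]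
    exact absurd (hF.inj this) zero_ne_one

theorem EmbCurve.isClosed_range {F : ℂ → E2} (hF : EmbCurve F) : IsClosed (range F) := by
  have : IsProperMap F := by
    rw [isProperMap_iff_tendsto_cocompact]
    refine ⟨hF.poly.continuous, ?_⟩
    rw [← Metric.cobounded_eq_cocompact, ← Metric.cobounded_eq_cocompact,
      ← tendsto_norm_atTop_iff_cobounded, Filter.tendsto_atTop]
    intro R
    have := Bornology.isCobounded_compl_iff.2 (hF.isBounded_norm_le R)
    filter_upwards [this] with ζ hζ
    have h : ¬ ‖F ζ‖ ≤ R := hζ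
    exact (not_le.1 h).le
  exact this.isClosedMap.isClosed_range

theorem EmbCurve.exists_dist_ge {F : ℂ → E2} (hF : EmbCurve F) {T : Set E2} (hT : IsCompact T)
    (h : ∀ ζ, F ζ ∉ T) : ∃ d > 0, ∀ z ∈ T, ∀ ζ, d ≤ dist (F ζ) z := by
  have hdisj : Disjoint T (range F) := by
    rw [Set.disjoint_right]
    rintro _ ⟨ζ, rfl⟩
    exact h ζ
  obtain ⟨d, hd, hdd⟩ := hdisj.exists_thickenings hT hF.isClosed_range
  refine ⟨d, hd, fun z hz ζ => ?_⟩
  by_contra! hlt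
  exact Set.disjoint_left.1 hdd (mem_thickening_iff.2 ⟨z, hz, hlt⟩)
    (self_subset_thickening hd _ ⟨ζ, rfl⟩)

/-- Data of a wall: a unit direction and two radii. -/
structure Wall where
  p : E2
  r : ℝ
  s : ℝ
  hp : ‖p‖ = 1

/-- The part of the wall region inside a ball. -/
def Wall.set (w : Wall) : Set E2 := {z | w.r ≤ ‖(inner ℂ w.p z : ℂ)‖ ∧ ‖z‖ ≤ w.s}

/-- The open domain where the wall is not crossed. -/
def Wall.dom (w : Wall) : Set E2 := {z | ‖(inner ℂ w.p z : ℂ)‖ < w.r}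

theorem continuous_norm_inner (p : E2) : Continuous fun z : E2 => ‖(inner ℂ p z : ℂ)‖ := by
  fun_prop

theorem Wall.isOpen_dom (w : Wall) : IsOpen w.dom :=
  isOpen_lt (continuous_norm_inner w.p) continuous_const

theorem Wall.isCompact_set (w : Wall) : IsCompact w.set := by
  refine (isCompact_closedBall (0 : E2) w.s).of_isClosed_subset ?_ fun z hz => by
    simpa using hz.2
  exact (isClosed_le continuous_const (continuous_norm_inner w.p)).inter
    (isClosed_le continuous_norm continuous_const)

/-- The shear crossing a single wall. -/
theorem exists_avoid_wall (w : Wall) {ρ ε : ℝ} (hρ0 : 0 ≤ ρ) (hρ : ρ < w.r) (hε : 0 < ε)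
    {F : ℂ → E2} (hF : EmbCurve F) {ζ₀ : ℂ} (hζ₀ : F ζ₀ ∈ w.dom) :
    ∃ σ : E2 ≃ E2, IsAut σ ∧ NearOn σ {z | ‖(inner ℂ w.p z : ℂ)‖ ≤ ρ} ε ∧
      ∀ ζ, σ (F ζ) ∉ w.set := by
  obtain ⟨ρ', hρ', hρ'r⟩ := exists_between hρ
  have hρ'0 : 0 < ρ' := hρ0.trans_lt hρ'
  set ℓ : E2 →L[ℂ] ℂ := innerSL ℂ w.p with hℓ
  have hℓa : ∀ z, ℓ z = inner ℂ w.p z := fun z => rfl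
  have hv : ℓ (quatJ w.p) = 0 := inner_quatJ_self w.p
  have hvn : ‖quatJ w.p‖ = 1 := by rw [norm_quatJ, w.hp]
  obtain ⟨R, hR⟩ := hF.poly.clm_comp ℓ
  obtain ⟨M, hM⟩ : ∃ M, ∀ ζ, w.r ≤ ‖ℓ (F ζ)‖ → ‖ℓ (F ζ)‖ ≤ w.s → ‖F ζ‖ ≤ M := by
    by_cases hdeg : 0 < R.degree
    · have hb := Polynomial.isBounded_norm_le hdeg w.s
      have hc : IsCompact (closure {ζ | ‖R.eval ζ‖ ≤ w.s}) := hb.isCompact_closure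
      obtain ⟨M, hM⟩ := hc.exists_bound_of_continuousOn hF.poly.continuous.continuousOn
      exact ⟨M, fun ζ _ h => hM ζ (subset_closure (by rwa [hR] at h))⟩
    · refine ⟨0, fun ζ h _ => ?_⟩
      exfalso
      rw [Polynomial.eq_C_of_degree_le_zero (not_lt.1 hdeg)] at hR
      have h1 : ‖ℓ (F ζ₀)‖ < w.r := hζ₀
      rw [hR] at h h1
      simp only [Polynomial.eval_C] at h h1
      linarith
  have ht1 : Tendsto (fun N : ℕ => (ρ / ρ') ^ N) atTop (𝓝 0) :=
    tendsto_pow_atTop_nhds_zero_of_lt_one (by positivity) ((div_lt_one hρ'0).2 hρ')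
  have ht2 : Tendsto (fun N : ℕ => (w.r / ρ') ^ N) atTop atTop :=
    tendsto_pow_atTop_atTop_of_one_lt ((one_lt_div hρ'0).2 hρ'r)
  obtain ⟨N, hN1, hN2⟩ := ((ht1.eventually_lt_const hε).and
    (ht2.eventually_gt_atTop (M + w.s))).exists
  set g : Polynomial ℂ := Polynomial.C (((ρ' : ℂ)⁻¹) ^ N) * Polynomial.X ^ N with hg
  have hge : ∀ c : ℂ, ‖g.eval c‖ = (‖c‖ / ρ') ^ N := by
    intro c
    simp only [hg, Polynomial.eval_mul, Polynomial.eval_C, Polynomial.eval_pow,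
      Polynomial.eval_X, norm_mul, norm_pow, norm_inv, Complex.norm_real,
      Real.norm_of_nonneg hρ'0.le]
    rw [← mul_pow, div_eq_inv_mul]
  refine ⟨shear ℓ (quatJ w.p) hv g, isAut_shear _ _ _ _, nearOn_shear hv fun z hz => ?_, ?_⟩
  · rw [hvn, mul_one, hge]
    refine le_trans ?_ hN1.le
    have : ‖ℓ z‖ ≤ ρ := hz
    gcongr
  · rintro ζ ⟨h1, h2⟩
    have hinv : ℓ (shear ℓ (quatJ w.p) hv g (F ζ)) = ℓ (F ζ) := by
      rw [shear_apply, map_add, map_smul, hv, smul_zero, add_zero]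
    rw [← hℓa, hinv] at h1
    have h3 : ‖ℓ (F ζ)‖ ≤ w.s := by
      rw [← hinv, hℓa]
      exact (norm_inner_le_norm _ _).trans (by rw [w.hp, one_mul]; exact h2)
    have h4 := hM ζ h1 h3
    have h5 : (w.r / ρ') ^ N ≤ ‖g.eval (ℓ (F ζ))‖ := by
      rw [hge]
      have : 0 ≤ w.r := hρ0.trans hρ.le
      gcongr
    have h6 : ‖g.eval (ℓ (F ζ))‖ ≤ ‖shear ℓ (quatJ w.p) hv g (F ζ)‖ + ‖F ζ‖ := by
      have : g.eval (ℓ (F ζ)) • quatJ w.p = shear ℓ (quatJ w.p) hv g (F ζ) - F ζ := by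
        rw [shear_apply]; abel
      calc ‖g.eval (ℓ (F ζ))‖ = ‖g.eval (ℓ (F ζ)) • quatJ w.p‖ := by
            rw [norm_smul, hvn, mul_one]
        _ ≤ _ := by rw [this]; exact norm_sub_le _ _
    linarith

theorem exists_cthickening_subset_doms (l : List Wall) {S : Set E2} (hS : IsCompact S)
    (h : ∀ w ∈ l, S ⊆ w.dom) : ∃ δ > 0, ∀ w ∈ l, cthickening δ S ⊆ w.dom := by
  have ho : IsOpen (⋂ w ∈ {w | w ∈ l}, w.dom) :=
    (List.finite_toSet l).isOpen_biInter fun w _ => w.isOpen_dom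
  obtain ⟨δ, hδ, hsub⟩ := hS.exists_cthickening_subset_open ho (subset_iInter₂ h)
  exact ⟨δ, hδ, fun w hw => hsub.trans (iInter₂_subset w hw)⟩

/-- Avoiding a list of walls. -/
theorem exists_avoid_walls (l : List Wall) : l.Pairwise (fun v w => v.set ⊆ w.dom) →
    ∀ {S : Set E2}, IsCompact S → (∀ w ∈ l, S ⊆ w.dom) → ∀ {F : ℂ → E2}, EmbCurve F →
    ∀ {ζ₀ : ℂ}, F ζ₀ ∈ S → ∀ {ε : ℝ}, 0 < ε →
    ∃ ψ : E2 ≃ E2, IsAut ψ ∧ NearOn ψ S ε ∧ ∀ w ∈ l, ∀ ζ, ψ (F ζ) ∉ w.set := by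
  induction l with
  | nil =>
    intro _ S _ _ F _ ζ₀ _ ε hε
    exact ⟨Equiv.refl E2, IsAut.refl, NearOn.refl S hε.le, by simp⟩
  | cons w l ih =>
    intro hp S hS hdom F hF ζ₀ hζ₀ ε hε
    rw [List.pairwise_cons] at hp
    obtain ⟨δ, hδ, hsub⟩ := exists_cthickening_subset_doms _ hS hdom
    set S₁ := cthickening δ S with hS₁def
    have hS₁ : IsCompact S₁ := hS.cthickening
    have hSS : S ⊆ S₁ := self_subset_cthickening S
    obtain ⟨y, hy, hmax⟩ := hS₁.exists_isMaxOn ⟨_, hSS hζ₀⟩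
      (continuous_norm_inner w.p).continuousOn
    have hyr : ‖(inner ℂ w.p y : ℂ)‖ < w.r := hsub w List.mem_cons_self hy
    set ε₁ := min δ (ε / 2) with hε₁
    have hε₁pos : 0 < ε₁ := lt_min hδ (half_pos hε)
    obtain ⟨σ, hσ, hσn, hσa⟩ := exists_avoid_wall w (norm_nonneg _) hyr hε₁pos hF
      (hdom w List.mem_cons_self hζ₀)
    have hσS : NearOn σ S₁ ε₁ := hσn.mono (fun z hz => hmax hz) le_rfl
    have hF₁ := hF.comp hσ
    obtain ⟨d, hd, hdist⟩ := hF₁.exists_dist_ge w.isCompact_set hσa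
    set ε₂ := min ε₁ (d / 2) with hε₂
    obtain ⟨ψ, hψ, hψn, hψa⟩ := ih hp.2 (S := S₁ ∪ w.set) (hS₁.union w.isCompact_set)
      (fun v hv => union_subset (hsub v (List.mem_cons_of_mem _ hv)) (hp.1 v hv)) hF₁ (ζ₀ := ζ₀)
      (Or.inl (mem_cthickening_of_dist_le _ _ δ S hζ₀
        ((hσS _ (hSS hζ₀)).1.trans (min_le_left _ _)))) (ε := ε₂) (lt_min hε₁pos (half_pos hd))
    refine ⟨σ.trans ψ, hσ.trans hψ, ?_, ?_⟩
    · refine (NearOn.trans (δ := δ) hσS (hψn.mono subset_union_left le_rfl) subset_rfl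
        (min_le_left _ _) ((min_le_left _ _).trans (min_le_left _ _))).mono subset_rfl ?_
      have : ε₁ ≤ ε / 2 := min_le_right _ _
      have : ε₂ ≤ ε₁ := min_le_left _ _
      linarith
    · intro v hv ζ
      rcases List.mem_cons.1 hv with rfl | hv
      · intro hmem
        have h1 := (hψn _ (Or.inr hmem)).2
        rw [Equiv.trans_apply, Equiv.symm_apply_apply] at h1
        have h2 := hdist _ hmem ζ
        have h3 : ε₂ ≤ d / 2 := min_le_right _ _
        rw [Equiv.trans_apply] at h2
        linarith
      · exact hψa v hv ζ

/-- The determinant of two vectors of `ℂ²`. -/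
def det2 (p x : E2) : ℂ := p 0 * x 1 - p 1 * x 0

theorem norm_inner_sq_add_norm_det2_sq (p x : E2) :
    ‖(inner ℂ p x : ℂ)‖ ^ 2 + ‖det2 p x‖ ^ 2 = ‖p‖ ^ 2 * ‖x‖ ^ 2 := by
  rw [E2.inner_eq, E2.norm_sq, E2.norm_sq, det2]
  simp only [← Complex.normSq_eq_norm_sq, Complex.normSq_apply]
  simp
  ring

theorem det2_sub_right (p x y : E2) : det2 p (x - y) = det2 p x - det2 p y := by
  simp [det2]; ring

theorem norm_det2_le (p x : E2) (hp : ‖p‖ = 1) : ‖det2 p x‖ ≤ ‖x‖ := by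
  have := norm_inner_sq_add_norm_det2_sq p x
  rw [hp, one_pow, one_mul] at this
  exact le_of_sq_le_sq (by nlinarith [sq_nonneg ‖(inner ℂ p x : ℂ)‖]) (norm_nonneg _)

theorem norm_mul_norm_det2_le {p q : E2} (hp : ‖p‖ = 1) (hq : ‖q‖ = 1) (z : E2) :
    ‖z‖ * ‖det2 p q‖ ≤ ‖det2 p z‖ + ‖det2 q z‖ := by
  have h : det2 p q • z = (-det2 q z) • p + det2 p z • q := by
    ext i
    fin_cases i <;> simp [det2] <;> ring
  have := congrArg norm h
  rw [norm_smul] at this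
  rw [mul_comm, this]
  refine (norm_add_le _ _).trans ?_
  rw [norm_smul, norm_smul, hp, hq, norm_neg]
  linarith

/-- The unit vector in direction `(1, u)` or `(u, 1)`. -/
def netVec (b : Bool) (u : ℂ) : E2 :=
  ((√(1 + ‖u‖ ^ 2) : ℝ) : ℂ)⁻¹ • (if b then !₂[1, u] else !₂[u, 1])

theorem sqrt_pos_aux (u : ℂ) : 0 < √(1 + ‖u‖ ^ 2) := by positivity

theorem norm_netVec (b : Bool) (u : ℂ) : ‖netVec b u‖ = 1 := by
  have h : ‖(if b then !₂[1, u] else !₂[u, 1] : E2)‖ = √(1 + ‖u‖ ^ 2) := by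
    rw [← sq_eq_sq₀ (norm_nonneg _) (Real.sqrt_nonneg _), E2.norm_sq,
      Real.sq_sqrt (by positivity)]
    cases b <;> simp [add_comm]
  rw [netVec, norm_smul, h, norm_inv, Complex.norm_real, Real.norm_of_nonneg (Real.sqrt_nonneg _),
    inv_mul_cancel₀ (sqrt_pos_aux u).ne']

theorem norm_det2_netVec (b : Bool) (u v : ℂ) :
    ‖det2 (netVec b u) (netVec b v)‖ = ‖u - v‖ / (√(1 + ‖u‖ ^ 2) * √(1 + ‖v‖ ^ 2)) := by
  have h : det2 (netVec b u) (netVec b v) =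
      (if b then 1 else -1) * (v - u) /
        (((√(1 + ‖u‖ ^ 2) : ℝ) : ℂ) * ((√(1 + ‖v‖ ^ 2) : ℝ) : ℂ)) := by
    have h1 : ((√(1 + ‖u‖ ^ 2) : ℝ) : ℂ) ≠ 0 := by exact_mod_cast (sqrt_pos_aux u).ne'
    have h2 : ((√(1 + ‖v‖ ^ 2) : ℝ) : ℂ) ≠ 0 := by exact_mod_cast (sqrt_pos_aux v).ne'
    cases b <;> simp [det2, netVec] <;> field_simp
  rw [h, norm_div, norm_mul, norm_mul, Complex.norm_real, Complex.norm_real,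
    Real.norm_of_nonneg (Real.sqrt_nonneg _), Real.norm_of_nonneg (Real.sqrt_nonneg _),
    norm_sub_rev]
  cases b <;> simp

theorem norm_det2_netVec_left_le (b : Bool) (u : ℂ) (x : E2) :
    ‖det2 (netVec b u) x‖ ≤ if b then ‖x 1 - u * x 0‖ else ‖x 0 - u * x 1‖ := by
  have h1 : 1 ≤ √(1 + ‖u‖ ^ 2) := by
    rw [Real.one_le_sqrt]; nlinarith [sq_nonneg ‖u‖]
  have h : det2 (netVec b u) x = ((√(1 + ‖u‖ ^ 2) : ℝ) : ℂ)⁻¹ *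
      (if b then x 1 - u * x 0 else u * x 1 - x 0) := by
    cases b <;> simp [det2, netVec] <;> ring
  rw [h, norm_mul, norm_inv, Complex.norm_real, Real.norm_of_nonneg (Real.sqrt_nonneg _)]
  have h2 : (√(1 + ‖u‖ ^ 2))⁻¹ ≤ 1 := inv_le_one_of_one_le₀ h1
  cases b
  · simp only [Bool.false_eq_true, if_false]
    rw [norm_sub_rev (x 0)]
    exact mul_le_of_le_one_left (norm_nonneg _) h2
  · simp only [if_true]
    exact mul_le_of_le_one_left (norm_nonneg _) h2

/-- Rounding to a Gaussian integer multiple of `κ`. -/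
theorem exists_gaussian_near {κ : ℝ} (hκ : 0 < κ) (hκ1 : κ ≤ 1) {t : ℂ} (ht : ‖t‖ ≤ 1) :
    ∃ α β : ℤ, ‖t - κ * (α + β * Complex.I)‖ ≤ κ ∧ |κ * (α : ℝ)| ≤ 2 ∧ |κ * (β : ℝ)| ≤ 2 := by
  have hr : ∀ x : ℝ, |x - κ * (round (x / κ) : ℝ)| ≤ κ / 2 := by
    intro x
    have := abs_sub_round (x / κ)
    have h : x - κ * (round (x / κ) : ℝ) = κ * (x / κ - (round (x / κ) : ℝ)) := by
      field_simp
    rw [h, abs_mul, abs_of_pos hκ]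
    nlinarith
  have h1 := hr t.re
  have h2 := hr t.im
  have h3 := Complex.abs_re_le_norm t
  have h4 := Complex.abs_im_le_norm t
  refine ⟨round (t.re / κ), round (t.im / κ), ?_, ?_, ?_⟩
  · refine (Complex.norm_le_abs_re_add_abs_im _).trans ?_
    simp only [Complex.sub_re, Complex.sub_im, Complex.mul_re, Complex.mul_im, Complex.add_re,
      Complex.add_im, Complex.ofReal_re, Complex.ofReal_im, Complex.intCast_re,
      Complex.intCast_im, Complex.I_re, Complex.I_im, mul_zero, mul_one, zero_mul, sub_zero,
      add_zero, zero_add]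
    linarith
  · rw [abs_le] at *
    constructor <;> linarith [h1.1, h1.2]
  · rw [abs_le] at *
    constructor <;> linarith [h2.1, h2.2]

/-- The grid point with index `q`. -/
def gridPt (κ : ℝ) (q : ℤ × ℤ) : ℂ := κ * (q.1 + q.2 * Complex.I)

theorem norm_gridPt_sub (κ : ℝ) (hκ : 0 < κ) {m : ℕ} {q q' : ℤ × ℤ} (hne : q ≠ q')
    (h1 : (q.1 : ZMod m) = q'.1) (h2 : (q.2 : ZMod m) = q'.2) :
    m * κ ≤ ‖gridPt κ q - gridPt κ q'‖ := by
  have hlattice : ∀ a b : ℤ, a ≠ b → (a : ZMod m) = b → (m : ℝ) ≤ |(a : ℝ) - b| := by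
    intro a b hab h
    rw [ZMod.intCast_eq_intCast_iff_dvd_sub] at h
    have := Int.le_of_dvd (abs_pos.2 (sub_ne_zero.2 hab.symm)) ((dvd_abs _ _).2 h)
    rw [abs_sub_comm] at this
    exact_mod_cast this
  have hre : (gridPt κ q - gridPt κ q').re = κ * ((q.1 : ℝ) - q'.1) := by
    simp [gridPt]; ring
  have him : (gridPt κ q - gridPt κ q').im = κ * ((q.2 : ℝ) - q'.2) := by
    simp [gridPt]; ring
  by_cases h : q.1 = q'.1
  · have h' : q.2 ≠ q'.2 := fun h' => hne (Prod.ext h h')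
    refine le_trans ?_ (Complex.abs_im_le_norm _)
    rw [him, abs_mul, abs_of_pos hκ, mul_comm]
    exact mul_le_mul_of_nonneg_left (hlattice _ _ h' h2) hκ.le
  · refine le_trans ?_ (Complex.abs_re_le_norm _)
    rw [hre, abs_mul, abs_of_pos hκ, mul_comm]
    exact mul_le_mul_of_nonneg_left (hlattice _ _ h h1) hκ.le

/-- A finite set of grid indices in a residue class. -/
def gridClass (κ : ℝ) (m : ℕ) (c : ZMod m × ZMod m) : Set (ℤ × ℤ) :=
  {q | |κ * (q.1 : ℝ)| ≤ 2 ∧ |κ * (q.2 : ℝ)| ≤ 2 ∧ ((q.1 : ZMod m), (q.2 : ZMod m)) = c}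

theorem finite_gridClass {κ : ℝ} (hκ : 0 < κ) (m : ℕ) (c : ZMod m × ZMod m) :
    (gridClass κ m c).Finite := by
  obtain ⟨n, hn⟩ := exists_nat_gt (2 / κ)
  refine ((finite_Icc (-(n : ℤ)) n).prod (finite_Icc (-(n : ℤ)) n)).subset ?_
  have hb : ∀ a : ℤ, |κ * (a : ℝ)| ≤ 2 → a ∈ Icc (-(n : ℤ)) n := by
    intro a ha
    rw [abs_mul, abs_of_pos hκ, ← le_div_iff₀' hκ] at ha
    have := ha.trans hn.le
    rw [abs_le] at this
    constructor
    · exact_mod_cast this.1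
    · exact_mod_cast this.2
  rintro q ⟨h1, h2, -⟩
  exact ⟨hb _ h1, hb _ h2⟩

theorem norm_gridPt_sq_le {κ : ℝ} {q : ℤ × ℤ} (h1 : |κ * (q.1 : ℝ)| ≤ 2)
    (h2 : |κ * (q.2 : ℝ)| ≤ 2) : √(1 + ‖gridPt κ q‖ ^ 2) ≤ 3 := by
  have : ‖gridPt κ q‖ ^ 2 = (κ * q.1) ^ 2 + (κ * q.2) ^ 2 := by
    rw [← Complex.normSq_eq_norm_sq, Complex.normSq_apply]
    simp [gridPt]; ring
  rw [this, Real.sqrt_le_left (by norm_num)]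
  rw [abs_le] at h1 h2
  nlinarith [h1.1, h1.2, h2.1, h2.2]

theorem ten_mul_le_norm_det2_netVec {κ : ℝ} (hκ : 0 < κ) (b : Bool) {c : ZMod 90 × ZMod 90}
    {q q' : ℤ × ℤ} (hq : q ∈ gridClass κ 90 c) (hq' : q' ∈ gridClass κ 90 c) (hne : q ≠ q') :
    10 * κ ≤ ‖det2 (netVec b (gridPt κ q)) (netVec b (gridPt κ q'))‖ := by
  rw [norm_det2_netVec]
  have heq := hq.2.2.trans hq'.2.2.symm
  have h1 := norm_gridPt_sub κ hκ hne (Prod.ext_iff.1 heq).1 (Prod.ext_iff.1 heq).2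
  have h2 := norm_gridPt_sq_le hq.1 hq.2.1
  have h3 := norm_gridPt_sq_le hq'.1 hq'.2.1
  have h4 := sqrt_pos_aux (gridPt κ q)
  have h5 := sqrt_pos_aux (gridPt κ q')
  rw [le_div_iff₀ (by positivity)]
  push_cast at h1
  have h6 : √(1 + ‖gridPt κ q‖ ^ 2) * √(1 + ‖gridPt κ q'‖ ^ 2) ≤ 3 * 3 :=
    mul_le_mul h2 h3 h5.le (by norm_num)
  have h7 := mul_le_mul_of_nonneg_left h6 (by positivity : 0 ≤ 10 * κ)
  linarith

/-- Nets of directions at scale `κ`, divided into a number of separated classes which does not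
depend on `κ`. -/
theorem exists_net : ∃ M : ℕ, 0 < M ∧ ∀ κ : ℝ, 0 < κ → κ ≤ 1 → ∃ cls : ℕ → List E2,
    (∀ c, ∀ p ∈ cls c, ‖p‖ = 1) ∧ (∀ c, (cls c).Pairwise fun p q => 10 * κ ≤ ‖det2 p q‖) ∧
    ∀ x : E2, ∃ c < M, ∃ p ∈ cls c, ‖det2 p x‖ ≤ κ * ‖x‖ := by
  classical
  set e := Fintype.equivFin (Bool × (ZMod 90 × ZMod 90)) with he
  refine ⟨Fintype.card (Bool × (ZMod 90 × ZMod 90)), Fintype.card_pos, fun κ hκ hκ1 => ?_⟩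
  set col : Bool × (ZMod 90 × ZMod 90) → List E2 := fun c =>
    (finite_gridClass hκ 90 c.2).toFinset.toList.map fun q => netVec c.1 (gridPt κ q) with hcol
  refine ⟨fun c => if h : c < Fintype.card (Bool × (ZMod 90 × ZMod 90)) then
    col (e.symm ⟨c, h⟩) else [], ?_, ?_, ?_⟩
  · intro c p hp
    beta_reduce at hp
    split_ifs at hp with h
    · rw [hcol, List.mem_map] at hp
      obtain ⟨q, -, rfl⟩ := hp
      exact norm_netVec _ _
    · simp at hp
  · intro c
    beta_reduce
    split_ifs with h
    · rw [hcol, List.pairwise_map]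
      refine List.Pairwise.imp_of_mem ?_ (Finset.nodup_toList _)
      intro q q' hq hq' hne
      rw [Finset.mem_toList, Set.Finite.mem_toFinset] at hq hq'
      exact ten_mul_le_norm_det2_netVec hκ _ hq hq' hne
    · exact List.Pairwise.nil
  · intro x
    have key : ∀ (b : Bool) (t : ℂ), ‖t‖ ≤ 1 → (∀ u, ‖det2 (netVec b u) x‖ ≤ ‖t - u‖ * ‖x‖) →
        ∃ c < Fintype.card (Bool × (ZMod 90 × ZMod 90)),
          ∃ p ∈ (if h : c < Fintype.card (Bool × (ZMod 90 × ZMod 90)) then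
            col (e.symm ⟨c, h⟩) else []), ‖det2 p x‖ ≤ κ * ‖x‖ := by
      intro b t ht hb
      obtain ⟨α, β, h1, h2, h3⟩ := exists_gaussian_near hκ hκ1 ht
      set k : Bool × (ZMod 90 × ZMod 90) := (b, ((α : ZMod 90), (β : ZMod 90))) with hk
      refine ⟨e k, (e k).2, netVec b (gridPt κ (α, β)), ?_, ?_⟩
      · rw [dif_pos (e k).2, Fin.eta, Equiv.symm_apply_apply, hcol, List.mem_map]
        refine ⟨(α, β), ?_, rfl⟩
        rw [Finset.mem_toList, Set.Finite.mem_toFinset]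
        exact ⟨h2, h3, rfl⟩
      · exact (hb _).trans (mul_le_mul_of_nonneg_right h1 (norm_nonneg _))
    rcases le_total ‖x 1‖ ‖x 0‖ with h | h
    · refine key true (x 1 / x 0) ?_ fun u => ?_
      · rw [norm_div]; exact div_le_one_of_le₀ h (norm_nonneg _)
      · refine (norm_det2_netVec_left_le true u x).trans ?_
        simp only [if_true]
        by_cases h0 : x 0 = 0
        · have : x 1 = 0 := by rw [h0, norm_zero] at h; simpa using h
          rw [h0, this]; simp; positivity
        · have : x 1 - u * x 0 = (x 1 / x 0 - u) * x 0 := by field_simp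
          rw [this, norm_mul]
          exact mul_le_mul_of_nonneg_left (E2.norm_apply_le x 0) (norm_nonneg _)
    · refine key false (x 0 / x 1) ?_ fun u => ?_
      · rw [norm_div]; exact div_le_one_of_le₀ h (norm_nonneg _)
      · refine (norm_det2_netVec_left_le false u x).trans ?_
        simp only [Bool.false_eq_true, if_false]
        by_cases h0 : x 1 = 0
        · have : x 0 = 0 := by rw [h0, norm_zero] at h; simpa using h
          rw [h0, this]; simp; positivity
        · have : x 0 - u * x 1 = (x 0 / x 1 - u) * x 1 := by field_simp
          rw [this, norm_mul]
          exact mul_le_mul_of_nonneg_left (E2.norm_apply_le x 1) (norm_nonneg _)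

/-- Paths outside `W` from the closed ball of radius `a` to radius `b` have length at least one. -/
def LongPath (W : Set E2) (a b : ℝ) : Prop :=
  ∀ (c : ℝ → E2) (s t : ℝ), s ≤ t → ContinuousOn c (Icc s t) → ‖c s‖ ≤ a → b ≤ ‖c t‖ →
    (∀ x ∈ Icc s t, c x ∉ W) → 1 ≤ eVariationOn c (Icc s t)

/-- A slightly smaller wall. -/
def Wall.shrink (w : Wall) (τ : ℝ) : Wall := ⟨w.p, w.r + τ, w.s - τ, w.hp⟩

theorem eVariationOn_Icc_add_edist_le (c : ℝ → E2) {s u v w : ℝ} (hsu : s ≤ u) (huv : u ≤ v)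
    (hvw : v ≤ w) : eVariationOn c (Icc s u) + edist (c v) (c w) ≤ eVariationOn c (Icc s w) := by
  have h1 := eVariationOn.Icc_add_Icc c (s := univ) (hsu.trans huv) hvw (mem_univ _)
  simp only [univ_inter] at h1
  rw [← h1]
  gcongr
  · exact eVariationOn.mono c (Icc_subset_Icc_right huv)
  · exact eVariationOn.edist_le c (left_mem_Icc.2 hvw) (right_mem_Icc.2 hvw)

theorem Wall.le_dist_of_notMem_shrink (w : Wall) {κ : ℝ}
    (hrs : w.r ≤ w.s) (hs1 : w.s ≤ 1) (hsr : w.s ^ 2 = w.r ^ 2 + 5 * κ ^ 2) {z₀ z₁ : E2}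
    (h₀ : ‖det2 w.p z₀‖ ≤ κ) (h₁ : ‖z₁‖ = w.s - κ ^ 2 / 4)
    (hz₁ : z₁ ∉ (w.shrink (κ ^ 2 / 4)).set) : κ ≤ dist z₀ z₁ := by
  have h2 : ‖(inner ℂ w.p z₁ : ℂ)‖ < w.r + κ ^ 2 / 4 := by
    by_contra! h
    exact hz₁ ⟨h, h₁.le⟩
  have h3 := norm_inner_sq_add_norm_det2_sq w.p z₁
  rw [w.hp, h₁] at h3
  have h4 : ‖(inner ℂ w.p z₁ : ℂ)‖ ^ 2 ≤ (w.r + κ ^ 2 / 4) ^ 2 := by gcongr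
  have h5 : (2 * κ) ^ 2 ≤ ‖det2 w.p z₁‖ ^ 2 := by nlinarith [sq_nonneg κ]
  have h6 : 2 * κ ≤ ‖det2 w.p z₁‖ := le_of_sq_le_sq h5 (norm_nonneg _)
  have h7 := norm_det2_le w.p (z₁ - z₀) w.hp
  rw [det2_sub_right] at h7
  have h8 := norm_sub_norm_le (det2 w.p z₁) (det2 w.p z₀)
  rw [dist_comm, dist_eq_norm]
  linarith

theorem norm_inner_lt_of_det2 {p q z : E2} (hp : ‖p‖ = 1) (hq : ‖q‖ = 1) {κ r s : ℝ}
    (hκ : 0 < κ) (hr : 1 / 2 ≤ r) (hsr : s ^ 2 = r ^ 2 + 5 * κ ^ 2)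
    (hpq : 10 * κ ≤ ‖det2 p q‖) (hz : r ≤ ‖(inner ℂ p z : ℂ)‖) (hzs : ‖z‖ ≤ s) :
    ‖(inner ℂ q z : ℂ)‖ < r := by
  by_contra! hcon
  have hpz := norm_inner_sq_add_norm_det2_sq p z
  have hqz := norm_inner_sq_add_norm_det2_sq q z
  rw [hp, one_pow, one_mul] at hpz
  rw [hq, one_pow, one_mul] at hqz
  have e1 := pow_le_pow_left₀ (by linarith) hz 2
  have e2 := pow_le_pow_left₀ (by linarith) hcon 2
  have e3 := pow_le_pow_left₀ (norm_nonneg z) hzs 2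
  have hκ2 : 0 < κ ^ 2 := by positivity
  have f1 : ‖det2 p z‖ ≤ 9 / 4 * κ := le_of_sq_le_sq (by rw [mul_pow]; linarith) (by positivity)
  have f2 : ‖det2 q z‖ ≤ 9 / 4 * κ := le_of_sq_le_sq (by rw [mul_pow]; linarith) (by positivity)
  have f3 := norm_mul_norm_det2_le hp hq z
  have f4 : 1 / 2 ≤ ‖z‖ := by
    have := norm_inner_le_norm (𝕜 := ℂ) p z
    rw [hp, one_mul] at this
    linarith
  have f5 := mul_le_mul f4 hpq (by positivity) (norm_nonneg z)
  linarith

theorem exists_levels {a b κ : ℝ} (ha : 0 < a) (hb : 0 ≤ b) (hκ : 0 < κ) {n : ℕ}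
    (hn : n * (6 * κ ^ 2) ≤ b ^ 2 - a ^ 2) : ∃ s r : ℕ → ℝ, (∀ j, a < r j) ∧ (∀ j, r j ≤ s j) ∧
      (∀ j, s j ^ 2 = r j ^ 2 + 5 * κ ^ 2) ∧ (∀ i j, i < j → s i < r j) ∧
      ∀ j, j < n → s j ≤ b := by
  have hκ2 : 0 < κ ^ 2 := by positivity
  have hs2 : ∀ j : ℕ, √(a ^ 2 + (j + 1) * (6 * κ ^ 2)) ^ 2 = a ^ 2 + (j + 1) * (6 * κ ^ 2) :=
    fun j => Real.sq_sqrt (by positivity)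
  have hr2 : ∀ j : ℕ, √(a ^ 2 + (j + 1) * (6 * κ ^ 2) - 5 * κ ^ 2) ^ 2 =
      a ^ 2 + (j + 1) * (6 * κ ^ 2) - 5 * κ ^ 2 := fun j =>
    Real.sq_sqrt (by nlinarith [mul_nonneg (Nat.cast_nonneg j : (0 : ℝ) ≤ j) hκ2.le])
  refine ⟨fun j => √(a ^ 2 + (j + 1) * (6 * κ ^ 2)),
    fun j => √(a ^ 2 + (j + 1) * (6 * κ ^ 2) - 5 * κ ^ 2), fun j => ?_, fun j => ?_, fun j => ?_,
    fun i j hij => ?_, fun j hj => ?_⟩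
  · refine lt_of_pow_lt_pow_left₀ 2 (Real.sqrt_nonneg _) ?_
    rw [hr2]; nlinarith [mul_nonneg (Nat.cast_nonneg j : (0 : ℝ) ≤ j) hκ2.le]
  · exact Real.sqrt_le_sqrt (by linarith)
  · simp only [hs2, hr2]; ring
  · refine lt_of_pow_lt_pow_left₀ 2 (Real.sqrt_nonneg _) ?_
    rw [hr2, hs2]
    have : ((i : ℝ) + 1) ≤ j := by exact_mod_cast hij
    nlinarith [mul_le_mul_of_nonneg_right this hκ2.le]
  · refine le_of_sq_le_sq ?_ hb
    rw [hs2]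
    have h1 : ((j : ℝ) + 1) ≤ n := by exact_mod_cast hj
    have h2 := mul_le_mul_of_nonneg_right h1 (by positivity : 0 ≤ 6 * κ ^ 2)
    linarith

theorem exists_scale {a b : ℝ} (hab : 0 < b ^ 2 - a ^ 2) {M : ℕ} (hM : 0 < M) :
    ∃ κ : ℝ, 0 < κ ∧ κ ≤ 1 ∧ ∃ N : ℕ, 1 ≤ N * κ ∧
      ((N * M : ℕ) : ℝ) * (6 * κ ^ 2) ≤ b ^ 2 - a ^ 2 := by
  have hM' : (0 : ℝ) < M := by exact_mod_cast hM
  obtain ⟨κ, hκ, hκ1, hκ2⟩ : ∃ κ : ℝ, 0 < κ ∧ κ ≤ 1 ∧ κ ≤ (b ^ 2 - a ^ 2) / (12 * M) :=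
    ⟨min 1 ((b ^ 2 - a ^ 2) / (12 * M)), lt_min one_pos (by positivity), min_le_left _ _,
      min_le_right _ _⟩
  rw [le_div_iff₀' (by positivity)] at hκ2
  refine ⟨κ, hκ, hκ1, ⌈1 / κ⌉₊, (div_le_iff₀ hκ).1 (Nat.le_ceil _), ?_⟩
  have h1 := (Nat.ceil_lt_add_one (by positivity : 0 ≤ 1 / κ)).le
  have h2 := mul_le_mul_of_nonneg_right h1 hκ.le
  rw [add_mul, div_mul_cancel₀ _ hκ.ne'] at h2
  have h3 : (⌈1 / κ⌉₊ * κ) * (M * κ) ≤ 2 * (M * κ) :=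
    mul_le_mul_of_nonneg_right (by linarith) (by positivity)
  push_cast
  linarith

/-- A family of walls, finely spaced, that forces paths crossing all of them to be long. -/
theorem exists_long_walls {a b : ℝ} (ha : 1 / 2 ≤ a) (hab : a < b) (hb : b ≤ 1) :
    ∃ l : List Wall, l.Pairwise (fun v w => v.set ⊆ w.dom) ∧
      (∀ w ∈ l, closedBall (0 : E2) a ⊆ w.dom) ∧ (∀ w ∈ l, w.s ≤ b) ∧
      ∃ τ > 0, LongPath (⋃ w ∈ l, (w.shrink τ).set) a b := by
  obtain ⟨M, hM, hnet⟩ := exists_net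
  obtain ⟨κ, hκ, hκ1, N, hN1, hN2⟩ := exists_scale (a := a) (b := b) (by nlinarith) hM
  obtain ⟨cls, hcls1, hcls2, hcls3⟩ := hnet κ hκ hκ1
  obtain ⟨s, r, har, hrs, hs2, hsr, hsb⟩ := exists_levels (by linarith) (by linarith) hκ hN2
  have hκ2 : 0 < κ ^ 2 := by positivity
  have hsmono : ∀ i j, i ≤ j → s i ≤ s j := fun i j hij => by
    rcases hij.eq_or_lt with rfl | h
    · exact le_rfl
    · exact (hsr i j h).le.trans (hrs j)
  obtain ⟨lev, hlev⟩ : ∃ lev : ℕ → List Wall, ∀ j, lev j =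
      (cls (j % M)).attach.map fun p => ⟨p.1, r j, s j, hcls1 _ p.1 p.2⟩ := ⟨_, fun _ => rfl⟩
  have hlevmem : ∀ j w, w ∈ lev j → w.p ∈ cls (j % M) ∧ w.r = r j ∧ w.s = s j := by
    intro j w hw
    rw [hlev, List.mem_map] at hw
    obtain ⟨p, -, rfl⟩ := hw
    exact ⟨p.2, rfl, rfl⟩
  refine ⟨(List.range (N * M)).flatMap lev, ?_, ?_, ?_, κ ^ 2 / 4, by positivity, ?_⟩
  · rw [List.pairwise_flatMap]
    constructor
    · intro j _
      rw [hlev, List.pairwise_map]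
      have h := hcls2 (j % M)
      rw [← List.attach_map_subtype_val (cls (j % M)), List.pairwise_map] at h
      refine h.imp ?_
      rintro ⟨p, hp⟩ ⟨q, hq⟩ hpq z ⟨hz1, hz2⟩
      simp only at hpq hz1 hz2
      change ‖(inner ℂ q z : ℂ)‖ < r j
      exact norm_inner_lt_of_det2 (hcls1 _ p hp) (hcls1 _ q hq) hκ
        (by linarith [har j]) (hs2 j) hpq hz1 hz2
    · refine List.Pairwise.imp ?_ (List.pairwise_lt_range (n := N * M))
      intro i j hij v hv w hw z hz
      obtain ⟨-, hvr, hvs⟩ := hlevmem i v hv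
      obtain ⟨-, hwr, hws⟩ := hlevmem j w hw
      change ‖(inner ℂ w.p z : ℂ)‖ < w.r
      have := norm_inner_le_norm (𝕜 := ℂ) w.p z
      rw [w.hp, one_mul] at this
      have h2 := hz.2
      rw [hwr]
      linarith [hsr i j hij]
  · intro w hw z hz
    obtain ⟨j, -, hj⟩ := List.mem_flatMap.1 hw
    obtain ⟨-, hwr, hws⟩ := hlevmem j w hj
    change ‖(inner ℂ w.p z : ℂ)‖ < w.r
    have := norm_inner_le_norm (𝕜 := ℂ) w.p z
    rw [w.hp, one_mul] at this
    rw [mem_closedBall_zero_iff] at hz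
    linarith [har j]
  · intro w hw
    obtain ⟨j, hj, hj'⟩ := List.mem_flatMap.1 hw
    rw [(hlevmem j w hj').2.2]
    exact hsb j (List.mem_range.1 hj)
  · intro c x₀ x₁ hx hc hc0 hc1 hW
    have key : ∀ k : ℕ, k ≤ N → ∃ u ∈ Icc x₀ x₁, (∀ i, k * M ≤ i → ‖c u‖ ≤ s i - κ ^ 2 / 4) ∧
        ENNReal.ofReal (k * κ) ≤ eVariationOn c (Icc x₀ u) := by
      intro k
      induction k with
      | zero =>
        refine fun _ => ⟨x₀, left_mem_Icc.2 hx, fun i _ => hc0.trans ?_, by simp⟩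
        have h1 := har i
        have h2 := hs2 i
        have h3 := hrs i
        by_contra! h
        have h4 : s i ^ 2 < (a + κ ^ 2 / 4) ^ 2 :=
          pow_lt_pow_left₀ (by linarith) (by linarith) two_ne_zero
        have h5 : κ ^ 2 ≤ 1 := pow_le_one₀ hκ.le hκ1
        have h6 : a ^ 2 < r i ^ 2 := pow_lt_pow_left₀ h1 (by linarith) two_ne_zero
        nlinarith
      | succ k ih =>
        intro hk
        obtain ⟨u, hu, hu1, hu2⟩ := ih (by omega)
        have hivt : ∀ v ∈ Icc x₀ x₁, ∀ j < N * M, ‖c v‖ ≤ s j - κ ^ 2 / 4 →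
            ∃ v' ∈ Icc v x₁, ‖c v'‖ = s j - κ ^ 2 / 4 := by
          intro v hv j hj hvj
          exact intermediate_value_Icc hv.2
            (hc.norm.mono (Icc_subset_Icc_left hv.1)) ⟨hvj, by linarith [hsb j hj]⟩
        have hkM : (k + 1) * M ≤ N * M := Nat.mul_le_mul_right _ hk
        have hkM1 : (k + 1) * M = k * M + M := by ring
        obtain ⟨v, hv, hv1⟩ := hivt u hu (k * M) (by omega) (hu1 _ le_rfl)
        have hvI : v ∈ Icc x₀ x₁ := ⟨hu.1.trans hv.1, hv.2⟩
        obtain ⟨i, hi, p, hp, hpv⟩ := hcls3 (c v)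
        have hj : k * M + i < N * M := by omega
        have hjm : s (k * M) ≤ s (k * M + i) := hsmono _ _ (by omega)
        obtain ⟨w, hw, hw1⟩ := hivt v hvI (k * M + i) hj (by linarith)
        refine ⟨w, ⟨hvI.1.trans hw.1, hw.2⟩, fun i' hi' => ?_, ?_⟩
        · have := hsmono (k * M + i) i' (by omega)
          linarith
        · have hmod : (k * M + i) % M = i := by
            rw [mul_comm, Nat.mul_add_mod, Nat.mod_eq_of_lt hi]
          have hp' : p ∈ cls ((k * M + i) % M) := by rwa [hmod]
          have hmem : (⟨p, r (k * M + i), s (k * M + i), hcls1 _ p hp'⟩ : Wall) ∈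
              lev (k * M + i) := by
            rw [hlev, List.mem_map]
            exact ⟨⟨p, hp'⟩, List.mem_attach _ _, rfl⟩
          have hd := Wall.le_dist_of_notMem_shrink
            (⟨p, r (k * M + i), s (k * M + i), hcls1 _ p hp'⟩ : Wall) (hrs _)
            ((hsb _ hj).trans hb) (hs2 _) (z₀ := c v) (z₁ := c w)
            (hpv.trans (mul_le_of_le_one_right hκ.le (by
              have := hsb _ (show k * M < N * M by omega); nlinarith))) hw1
            (fun h => hW w ⟨hvI.1.trans hw.1, hw.2⟩ (mem_iUnion₂.2
              ⟨_, List.mem_flatMap.2 ⟨_, List.mem_range.2 hj, hmem⟩, h⟩))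
          refine le_trans ?_ (eVariationOn_Icc_add_edist_le c hu.1 hv.1 hw.1)
          rw [edist_dist]
          push_cast
          rw [add_mul, one_mul, ENNReal.ofReal_add (by positivity) hκ.le]
          gcongr
    obtain ⟨u, hu, -, hu2⟩ := key N le_rfl
    refine le_trans ?_ (eVariationOn.mono c (Icc_subset_Icc_right hu.2))
    refine le_trans ?_ hu2
    rw [← ENNReal.ofReal_one]
    exact ENNReal.ofReal_le_ofReal hN1

theorem quatJ_smul (c : ℂ) (x : E2) : quatJ (c • x) = (starRingEnd ℂ) c • quatJ x := by
  ext i; fin_cases i <;> simp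

theorem quatJ_add (x y : E2) : quatJ (x + y) = quatJ x + quatJ y := by
  ext i; fin_cases i <;> simp; ring

theorem quatJ_quatJ (x : E2) : quatJ (quatJ x) = -x := by
  ext i; fin_cases i <;> simp

theorem det2_quatJ (x : E2) : det2 x (quatJ x) = (‖x‖ ^ 2 : ℝ) := by
  rw [E2.norm_sq, det2]
  simp [Complex.mul_conj, Complex.normSq_eq_norm_sq]

theorem norm_add_smul_quatJ_sq (x : E2) (a b : ℂ) :
    ‖a • x + b • quatJ x‖ ^ 2 = (‖a‖ ^ 2 + ‖b‖ ^ 2) * ‖x‖ ^ 2 := by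
  rw [E2.norm_sq, E2.norm_sq]
  simp only [← Complex.normSq_eq_norm_sq, Complex.normSq_apply]
  simp
  ring

/-- There are automorphisms close to the identity on balls of radius less than `‖x‖`, that map
`x` to `y` and the ball of radius `‖x‖` into a ball of radius slightly larger than `‖y‖`. -/
structure CanMove (x y : E2) : Prop where
  pos : 0 < ‖x‖
  lt : ‖x‖ < ‖y‖
  exists_aut : ∀ a < ‖x‖, ∀ ε > 0, ∀ η > 0, ∃ ψ : E2 ≃ E2, IsAut ψ ∧
    NearOn ψ (closedBall 0 a) ε ∧ ψ x = y ∧ ∀ z, ‖z‖ ≤ ‖x‖ → ‖ψ z‖ < ‖y‖ + η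

theorem pow_mul_one_sub_le {t : ℝ} (h0 : 0 ≤ t) (h1 : t ≤ 1) (n : ℕ) :
    t ^ n * (1 - t) ≤ 1 / (n + 1) := by
  have hsum : (n + 1) * t ^ n ≤ ∑ i ∈ Finset.range (n + 1), t ^ i := by
    have := Finset.card_nsmul_le_sum (Finset.range (n + 1)) (fun i => t ^ i) (t ^ n)
      fun i hi => pow_le_pow_of_le_one h0 h1 (by rw [Finset.mem_range] at hi; omega)
    simpa using this
  have h2 := mul_neg_geom_sum t (n + 1)
  have h3 := mul_le_mul_of_nonneg_left hsum (sub_nonneg.2 h1)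
  have h4 : 0 ≤ t ^ (n + 1) := by positivity
  rw [le_div_iff₀ (by positivity)]
  linarith

theorem canMove_add_smul_quatJ {x : E2} (hx : x ≠ 0) {μ : ℂ} (hμ : μ ≠ 0) :
    CanMove x (x + μ • quatJ x) := by
  have hx0 : 0 < ‖x‖ := norm_pos_iff.2 hx
  have hμ0 : 0 < ‖μ‖ := norm_pos_iff.2 hμ
  have hy : ‖x + μ • quatJ x‖ ^ 2 = (1 + ‖μ‖ ^ 2) * ‖x‖ ^ 2 := by
    have := norm_add_smul_quatJ_sq x 1 μ
    simpa using this
  refine ⟨hx0, ?_, ?_⟩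
  · refine lt_of_pow_lt_pow_left₀ 2 (norm_nonneg _) ?_
    rw [hy]
    have : 0 < ‖μ‖ ^ 2 * ‖x‖ ^ 2 := by positivity
    linarith
  intro a ha ε hε η hη
  set y := x + μ • quatJ x with hydef
  have ht1 : Tendsto (fun N : ℕ => ‖μ‖ * (max a 0 / ‖x‖) ^ N * ‖x‖) atTop (𝓝 0) := by
    have := tendsto_pow_atTop_nhds_zero_of_lt_one (r := max a 0 / ‖x‖) (by positivity)
      ((div_lt_one hx0).2 (max_lt ha hx0))
    simpa using (this.const_mul ‖μ‖).mul_const ‖x‖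
  have ht2 : Tendsto (fun N : ℕ => 2 * ‖μ‖ * √(1 / ((N : ℝ) + 1)) * ‖x‖ ^ 2) atTop (𝓝 0) := by
    have := (Real.continuous_sqrt.tendsto 0).comp (tendsto_one_div_add_atTop_nhds_zero_nat (𝕜 := ℝ))
    rw [Real.sqrt_zero] at this
    simpa using (this.const_mul (2 * ‖μ‖)).mul_const (‖x‖ ^ 2)
  obtain ⟨N, hN1, hN2⟩ := ((ht1.eventually_lt_const hε).and
    (ht2.eventually_lt_const (by positivity : 0 < η ^ 2))).exists
  set ℓ : E2 →L[ℂ] ℂ := innerSL ℂ x with hℓ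
  have hℓa : ∀ z, ℓ z = inner ℂ x z := fun z => rfl
  have hv : ℓ (quatJ x) = 0 := inner_quatJ_self x
  set g : Polynomial ℂ := Polynomial.C (μ * (((‖x‖ ^ 2 : ℝ) : ℂ)⁻¹) ^ N) * Polynomial.X ^ N with hg
  have hge : ∀ c : ℂ, g.eval c = μ * (c / (‖x‖ ^ 2 : ℝ)) ^ N := by
    intro c
    simp only [hg, Polynomial.eval_mul, Polynomial.eval_C, Polynomial.eval_pow, Polynomial.eval_X]
    rw [mul_assoc, ← mul_pow, div_eq_inv_mul]
  have hgn : ∀ c : ℂ, ‖g.eval c‖ = ‖μ‖ * (‖c‖ / ‖x‖ ^ 2) ^ N := by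
    intro c
    rw [hge, norm_mul, norm_pow, norm_div, Complex.norm_real, Real.norm_of_nonneg (by positivity)]
  refine ⟨shear ℓ (quatJ x) hv g, isAut_shear _ _ _ _, nearOn_shear hv fun z hz => ?_, ?_, ?_⟩
  · rw [hgn, norm_quatJ]
    refine le_trans ?_ hN1.le
    have hz' : ‖z‖ ≤ max a 0 := (mem_closedBall_zero_iff.1 hz).trans (le_max_left _ _)
    have h2 : ‖ℓ z‖ / ‖x‖ ^ 2 ≤ max a 0 / ‖x‖ := by
      rw [div_le_div_iff₀ (by positivity) hx0]
      have := norm_inner_le_norm (𝕜 := ℂ) x z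
      rw [hℓa]
      calc ‖(inner ℂ x z : ℂ)‖ * ‖x‖ ≤ (‖x‖ * max a 0) * ‖x‖ := by
            gcongr; exact this.trans (by gcongr)
        _ = _ := by ring
    gcongr
  · rw [shear_apply, hge, hℓa, inner_self_eq_norm_sq_to_K]
    have : (‖x‖ : ℂ) ^ 2 ≠ 0 := by exact_mod_cast (pow_pos hx0 2).ne'
    simp [div_self this, hydef]
  · intro z hz
    set C := ‖ℓ z‖ / ‖x‖ ^ 2 with hC
    set D := ‖det2 x z‖ / ‖x‖ ^ 2 with hD
    have hC' : ‖ℓ z‖ = C * ‖x‖ ^ 2 := by rw [hC]; field_simp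
    have hD' : ‖det2 x z‖ = D * ‖x‖ ^ 2 := by rw [hD]; field_simp
    have hC0 : 0 ≤ C := by positivity
    have hD0 : 0 ≤ D := by positivity
    have hCD : C ^ 2 + D ^ 2 ≤ 1 := by
      have h := norm_inner_sq_add_norm_det2_sq x z
      rw [← hℓa, hC', hD'] at h
      have h2 : ‖z‖ ^ 2 ≤ ‖x‖ ^ 2 := by gcongr
      have h3 : (C ^ 2 + D ^ 2) * ‖x‖ ^ 4 ≤ 1 * ‖x‖ ^ 4 := by
        nlinarith [mul_le_mul_of_nonneg_left h2 (sq_nonneg ‖x‖)]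
      exact le_of_mul_le_mul_right h3 (by positivity)
    have hC1 : C ^ 2 ≤ 1 := by nlinarith
    have hCN : D * C ^ N ≤ √(1 / ((N : ℝ) + 1)) := by
      refine Real.le_sqrt_of_sq_le ?_
      refine le_trans ?_ (pow_mul_one_sub_le (sq_nonneg C) hC1 N)
      rw [mul_pow, ← pow_mul, ← pow_mul, mul_comm N 2, mul_comm]
      gcongr
      linarith
    have hCN1 : (C ^ N) ^ 2 ≤ 1 := by
      rw [← pow_mul, mul_comm, pow_mul]; exact pow_le_one₀ (sq_nonneg C) hC1
    have h := norm_inner_sq_add_norm_det2_sq x (shear ℓ (quatJ x) hv g z)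
    rw [← hℓa] at h
    have hinv : ℓ (shear ℓ (quatJ x) hv g z) = ℓ z := by
      rw [shear_apply, map_add, map_smul, hv, smul_zero, add_zero]
    have hdet : ‖det2 x (shear ℓ (quatJ x) hv g z)‖ ≤ (D + ‖μ‖ * C ^ N) * ‖x‖ ^ 2 := by
      have : det2 x (shear ℓ (quatJ x) hv g z) = det2 x z + g.eval (ℓ z) * (‖x‖ ^ 2 : ℝ) := by
        rw [shear_apply, ← det2_quatJ]; simp [det2]; ring
      rw [this]
      refine (norm_add_le _ _).trans ?_
      rw [norm_mul, Complex.norm_real, Real.norm_of_nonneg (by positivity), hgn, hD', ← hC]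
      linarith
    rw [hinv, hC'] at h
    have h2 := pow_le_pow_left₀ (norm_nonneg _) hdet 2
    have hX : 0 < ‖x‖ ^ 2 := by positivity
    have h3 : ‖shear ℓ (quatJ x) hv g z‖ ^ 2 ≤ (C ^ 2 + (D + ‖μ‖ * C ^ N) ^ 2) * ‖x‖ ^ 2 := by
      refine le_of_mul_le_mul_left ?_ hX
      rw [← h]
      nlinarith
    have h4 : C ^ 2 + (D + ‖μ‖ * C ^ N) ^ 2 ≤ 1 + ‖μ‖ ^ 2 + 2 * ‖μ‖ * √(1 / ((N : ℝ) + 1)) := by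
      have e1 := mul_le_mul_of_nonneg_left hCN hμ0.le
      have e2 := mul_le_mul_of_nonneg_left hCN1 (sq_nonneg ‖μ‖)
      nlinarith
    have h5 := mul_le_mul_of_nonneg_right h4 hX.le
    refine lt_of_pow_lt_pow_left₀ 2 (by positivity) ?_
    have h6 : 0 ≤ ‖y‖ * η := by positivity
    rw [add_sq, hy]
    linarith

theorem CanMove.trans {x y w : E2} (h : CanMove x y) (h' : CanMove y w) : CanMove x w := by
  refine ⟨h.pos, h.lt.trans h'.lt, fun a ha ε hε η hη => ?_⟩
  obtain ⟨a', ha', ha'x⟩ := exists_between (max_lt ha h.pos)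
  have ha0 : 0 ≤ max a 0 := le_max_right _ _
  set δ := a' - max a 0 with hδ
  have hδ0 : 0 < δ := sub_pos.2 ha'
  set ε' := min (ε / 2) δ with hε'
  have hε'0 : 0 < ε' := lt_min (half_pos hε) hδ0
  obtain ⟨ψ', hψ', hn', he', hb'⟩ := h'.exists_aut a' (ha'x.trans h.lt) ε' hε'0 η hη
  obtain ⟨η', hη', hsub⟩ := (isCompact_closedBall (0 : E2) ‖y‖).exists_cthickening_subset_open
    (t := {z | ‖ψ' z‖ < ‖w‖ + η})
    (isOpen_lt hψ'.diff.continuous.norm continuous_const)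
    (fun z hz => hb' z (mem_closedBall_zero_iff.1 hz))
  rw [cthickening_closedBall hη'.le (norm_nonneg _)] at hsub
  obtain ⟨ψ, hψ, hn, he, hb⟩ := h.exists_aut a' ha'x ε' hε'0 η' hη'
  refine ⟨ψ.trans ψ', hψ.trans hψ', ?_, by simp [he, he'], fun z hz => ?_⟩
  · have := NearOn.trans (S := closedBall 0 (max a 0)) (δ := δ) hn hn' ?_ (min_le_right _ _)
      (min_le_right _ _)
    · refine this.mono (closedBall_subset_closedBall (le_max_left _ _)) ?_
      have : ε' ≤ ε / 2 := min_le_left _ _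
      linarith
    · rw [cthickening_closedBall hδ0.le ha0]
      exact closedBall_subset_closedBall (by rw [hδ]; linarith)
  · have := hsub (mem_closedBall_zero_iff.2 ((hb z hz).le.trans (by linarith)))
    simpa using this

theorem canMove_smul {x : E2} (hx : x ≠ 0) {t : ℝ} (ht : 1 < t) : CanMove x ((t : ℂ) • x) := by
  have hs : 0 < √(t - 1) := Real.sqrt_pos.2 (by linarith)
  have hμ : ((√(t - 1) : ℝ) : ℂ) ≠ 0 := by exact_mod_cast hs.ne'
  have h1 := canMove_add_smul_quatJ hx hμ
  have hne : x + ((√(t - 1) : ℝ) : ℂ) • quatJ x ≠ 0 := by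
    rw [← norm_pos_iff]; exact h1.pos.trans h1.lt
  have h2 := canMove_add_smul_quatJ hne (neg_ne_zero.2 hμ)
  convert h1.trans h2 using 1
  have h3 : ((√(t - 1) : ℝ) : ℂ) * ((√(t - 1) : ℝ) : ℂ) = (t : ℂ) - 1 := by
    rw [← Complex.ofReal_mul, Real.mul_self_sqrt (by linarith)]; simp
  rw [quatJ_add, quatJ_smul, quatJ_quatJ, Complex.conj_ofReal, smul_add, smul_smul, smul_neg,
    neg_mul, h3]
  module

/-- Rotation by the angle `θ` in the real plane spanned by `x` and `μ • quatJ x`. -/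
def rotJ (θ : ℝ) (μ : ℂ) (x : E2) : E2 :=
  (Real.cos θ : ℂ) • x + ((Real.sin θ : ℂ) * μ) • quatJ x

theorem rotJ_add_smul (θ α : ℝ) {μ : ℂ} (hμ : ‖μ‖ = 1) (x : E2) :
    (Real.cos α : ℂ) • rotJ θ μ x + ((Real.sin α : ℂ) * μ) • quatJ (rotJ θ μ x) =
      rotJ (θ + α) μ x := by
  have h1 : (starRingEnd ℂ) μ * μ = 1 := by
    rw [← Complex.normSq_eq_conj_mul_self, Complex.normSq_eq_norm_sq, hμ]; simp
  simp only [rotJ, quatJ_add, quatJ_smul, quatJ_quatJ, map_mul, Complex.conj_ofReal,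
    Real.cos_add, Real.sin_add, Complex.ofReal_sub, Complex.ofReal_add, Complex.ofReal_mul]
  simp only [smul_add, smul_smul, smul_neg]
  have h2 : (Real.sin α : ℂ) * μ * ((Real.sin θ : ℂ) * (starRingEnd ℂ) μ) =
      (Real.sin α : ℂ) * (Real.sin θ : ℂ) := by linear_combination (Real.sin α : ℂ) * Real.sin θ * h1
  rw [h2]
  module

theorem canMove_rotJ_nat {x : E2} (hx : x ≠ 0) {μ : ℂ} (hμ : ‖μ‖ = 1) {α : ℝ} (hα : 0 < α)
    (hα2 : α < Real.pi / 2) (n : ℕ) :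
    CanMove x ((((Real.cos α)⁻¹ ^ (n + 1) : ℝ) : ℂ) • rotJ ((n + 1) * α) μ x) := by
  have hc : 0 < Real.cos α := Real.cos_pos_of_mem_Ioo ⟨by linarith, hα2⟩
  have hs : 0 < Real.sin α := Real.sin_pos_of_pos_of_lt_pi hα (by linarith)
  have hμ0 : μ ≠ 0 := by rw [← norm_pos_iff, hμ]; exact one_pos
  have hcC : (Real.cos α : ℂ) ≠ 0 := by exact_mod_cast hc.ne'
  have hsC : (Real.sin α : ℂ) ≠ 0 := by exact_mod_cast hs.ne'
  have hstep : ∀ z : E2, z ≠ 0 → CanMove z ((((Real.cos α)⁻¹ : ℝ) : ℂ) •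
      ((Real.cos α : ℂ) • z + ((Real.sin α : ℂ) * μ) • quatJ z)) := by
    intro z hz
    have := canMove_add_smul_quatJ hz (μ := (Real.cos α : ℂ)⁻¹ * ((Real.sin α : ℂ) * μ))
      (by positivity)
    convert this using 1
    rw [smul_add, smul_smul, smul_smul, Complex.ofReal_inv, inv_mul_cancel₀ hcC, one_smul]
  induction n with
  | zero =>
    have := hstep x hx
    simpa [rotJ] using this
  | succ n ih =>
    have hne : (((Real.cos α)⁻¹ ^ (n + 1) : ℝ) : ℂ) • rotJ ((n + 1) * α) μ x ≠ 0 := by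
      rw [← norm_pos_iff]; exact ih.pos.trans ih.lt
    convert ih.trans (hstep _ hne) using 1
    rw [quatJ_smul, Complex.conj_ofReal]
    have h := rotJ_add_smul ((n + 1) * α) α hμ x
    have h2 : ((n + 1 : ℕ) + 1 : ℝ) * α = (n + 1) * α + α := by push_cast; ring
    rw [h2, ← h, pow_succ _ (n + 1), Complex.ofReal_mul]
    module

theorem exists_one_sub_lt_cos_pow (θ : ℝ) {s : ℝ} (hs : 1 < s) :
    ∃ n : ℕ, 1 ≤ n ∧ 1 < s * Real.cos (θ / (n + 1)) ^ (n + 1) := by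
  have h1 : Tendsto (fun n : ℕ => s * (1 - θ ^ 2 / 2 * (1 / ((n : ℝ) + 1)))) atTop (𝓝 s) := by
    have := ((tendsto_one_div_add_atTop_nhds_zero_nat (𝕜 := ℝ)).const_mul (θ ^ 2 / 2))
    simpa using (this.const_sub 1).const_mul s
  have h2 : Tendsto (fun n : ℕ => (θ ^ 2 / 2) * (1 / ((n : ℝ) + 1))) atTop (𝓝 0) := by
    simpa using ((tendsto_one_div_add_atTop_nhds_zero_nat (𝕜 := ℝ)).const_mul (θ ^ 2 / 2))
  obtain ⟨n, ⟨hn, hn'⟩, hn1⟩ := (((h1.eventually_const_lt hs).and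
    (h2.eventually_lt_const one_pos)).and (eventually_ge_atTop 1)).exists
  refine ⟨n, hn1, hn.trans_le (mul_le_mul_of_nonneg_left ?_ (by linarith))⟩
  have h3 := Real.one_sub_sq_div_two_le_cos (x := θ / (n + 1))
  have hn0 : (1 : ℝ) ≤ n + 1 := by have := Nat.cast_nonneg (α := ℝ) n; linarith
  have h4 : (θ / (n + 1)) ^ 2 / 2 ≤ 1 := by
    refine le_trans ?_ hn'.le
    have e : (θ / (n + 1)) ^ 2 / 2 = θ ^ 2 / 2 * (1 / ((n : ℝ) + 1)) * (1 / ((n : ℝ) + 1)) := by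
      field_simp
    rw [e]
    exact mul_le_of_le_one_right (by positivity) ((div_le_one (by linarith)).2 hn0)
  have h5 := one_add_mul_le_pow (a := -((θ / (n + 1)) ^ 2 / 2)) (by linarith) (n + 1)
  calc 1 - θ ^ 2 / 2 * (1 / ((n : ℝ) + 1))
      = 1 + ((n + 1 : ℕ) : ℝ) * -((θ / (n + 1)) ^ 2 / 2) := by
        push_cast; field_simp; ring
    _ ≤ _ := h5
    _ ≤ _ := by
      apply pow_le_pow_left₀ (by linarith)
      linarith

theorem canMove_rotJ {x : E2} (hx : x ≠ 0) {μ : ℂ} (hμ : ‖μ‖ = 1) {θ s : ℝ} (hθ : 0 ≤ θ)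
    (hθ2 : θ ≤ Real.pi / 2) (hs : 1 < s) : CanMove x ((s : ℂ) • rotJ θ μ x) := by
  rcases hθ.eq_or_lt with rfl | hθ
  · simpa [rotJ] using canMove_smul hx hs
  obtain ⟨n, hn1, hn⟩ := exists_one_sub_lt_cos_pow θ hs
  have hn0 : (0 : ℝ) < n + 1 := by positivity
  have hn2 : (1 : ℝ) < n + 1 := by
    have : (1 : ℝ) ≤ n := by exact_mod_cast hn1
    linarith
  have hα2 : θ / (n + 1) < Real.pi / 2 := (div_lt_self hθ hn2).trans_le hθ2
  have h1 := canMove_rotJ_nat hx hμ (div_pos hθ hn0) hα2 n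
  rw [mul_div_cancel₀ _ hn0.ne'] at h1
  set k := Real.cos (θ / (n + 1)) with hk
  have hk0 : 0 < k := Real.cos_pos_of_mem_Ioo ⟨by have := div_pos hθ hn0; linarith, hα2⟩
  have hne : ((k⁻¹ ^ (n + 1) : ℝ) : ℂ) • rotJ θ μ x ≠ 0 := by
    rw [← norm_pos_iff]; exact h1.pos.trans h1.lt
  convert h1.trans (canMove_smul hne hn) using 1
  rw [smul_smul, ← Complex.ofReal_mul, mul_assoc, ← mul_pow, mul_inv_cancel₀ hk0.ne', one_pow,
    mul_one]

theorem exists_unit_mul (α : ℂ) : ∃ ω : ℂ, ‖ω‖ = 1 ∧ α = ‖α‖ * ω := by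
  refine ⟨Complex.exp (α.arg * Complex.I), Complex.norm_exp_ofReal_mul_I _, ?_⟩
  rw [Complex.norm_mul_exp_arg_mul_I]

theorem canMove_of_lt {x y : E2} (hx : x ≠ 0) (hxy : ‖x‖ < ‖y‖) : CanMove x y := by
  have hx0 : 0 < ‖x‖ := norm_pos_iff.2 hx
  set S := ‖y‖ / ‖x‖ with hS
  have hS1 : 1 < S := (one_lt_div hx0).2 hxy
  obtain ⟨s, hs1, hs3⟩ : ∃ s : ℝ, 1 < s ∧ s ^ 3 = S :=
    ⟨S ^ (1 / 3 : ℝ), Real.one_lt_rpow hS1 (by norm_num), by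
      rw [← Real.rpow_natCast, ← Real.rpow_mul (by positivity)]; norm_num⟩
  have hs0 : 0 < s := by linarith
  have hsC : (s : ℂ) ≠ 0 := by exact_mod_cast hs0.ne'
  have hXC : ((‖x‖ ^ 2 : ℝ) : ℂ) ≠ 0 := by exact_mod_cast (pow_pos hx0 2).ne'
  set w : E2 := ((s : ℂ) ^ 3)⁻¹ • y with hw
  have hwn : ‖w‖ = ‖x‖ := by
    rw [hw, norm_smul, norm_inv, norm_pow, Complex.norm_real, Real.norm_of_nonneg hs0.le, hs3, hS]
    have := hx0.trans hxy
    field_simp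
  set α : ℂ := inner ℂ x w / (‖x‖ ^ 2 : ℝ) with hα
  set β : ℂ := det2 x w / (‖x‖ ^ 2 : ℝ) with hβ
  have hwdec : w = α • x + β • quatJ x := by
    have h1 : ((‖x‖ ^ 2 : ℝ) : ℂ) • w = (inner ℂ x w : ℂ) • x + det2 x w • quatJ x := by
      rw [← det2_quatJ, E2.inner_eq]
      ext i
      fin_cases i <;> simp [det2] <;> ring
    rw [hα, hβ, div_eq_inv_mul, div_eq_inv_mul, mul_smul, mul_smul, ← smul_add, ← h1, smul_smul,
      inv_mul_cancel₀ hXC, one_smul]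
  have hαβ : ‖α‖ ^ 2 + ‖β‖ ^ 2 = 1 := by
    have h := norm_add_smul_quatJ_sq x α β
    rw [← hwdec, hwn] at h
    have : 0 < ‖x‖ ^ 2 := by positivity
    exact mul_right_cancel₀ this.ne' (by rw [← h, one_mul])
  obtain ⟨ω, hω, hαω⟩ := exists_unit_mul α
  obtain ⟨ν, hν, hβν⟩ := exists_unit_mul β
  have hωc : ω * (starRingEnd ℂ) ω = 1 := by
    rw [Complex.mul_conj, Complex.normSq_eq_norm_sq, hω]; simp
  have hpi := Real.pi_pos
  have h1 := canMove_rotJ hx (μ := 1) (by simp) (θ := Real.pi / 2) (by linarith) le_rfl hs1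
  have hne1 := norm_pos_iff.1 (h1.pos.trans h1.lt)
  have h2 := canMove_rotJ hne1 (μ := -ω) (by rw [norm_neg, hω]) (θ := Real.pi / 2) (by linarith)
    le_rfl hs1
  have hne2 := norm_pos_iff.1 (h2.pos.trans h2.lt)
  have hα1 : ‖α‖ ≤ 1 := by nlinarith [sq_nonneg ‖β‖, norm_nonneg α]
  have h3 := canMove_rotJ hne2 (μ := ν * ω) (by rw [norm_mul, hω, hν, one_mul])
    (θ := Real.arccos ‖α‖) (Real.arccos_nonneg _)
    (Real.arccos_le_pi_div_two.2 (norm_nonneg _)) hs1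
  convert (h1.trans h2).trans h3 using 1
  have hy : y = (s : ℂ) ^ 3 • w := by
    rw [hw, smul_smul, mul_inv_cancel₀ (pow_ne_zero _ hsC), one_smul]
  have hcos : Real.cos (Real.arccos ‖α‖) = ‖α‖ :=
    Real.cos_arccos (by linarith [norm_nonneg α]) hα1
  have hsin : Real.sin (Real.arccos ‖α‖) = ‖β‖ := by
    rw [Real.sin_arccos, ← Real.sqrt_sq (norm_nonneg β)]
    congr 1; linarith
  have hmid : (s : ℂ) • rotJ (Real.pi / 2) (-ω) ((s : ℂ) • rotJ (Real.pi / 2) 1 x) =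
      ((s : ℂ) ^ 2 * ω) • x := by
    simp only [rotJ, Real.cos_pi_div_two, Real.sin_pi_div_two, Complex.ofReal_zero, zero_smul,
      zero_add, Complex.ofReal_one, one_mul, one_smul, quatJ_smul, quatJ_quatJ,
      Complex.conj_ofReal]
    module
  rw [hmid, hy, hwdec, rotJ, hcos, hsin, quatJ_smul]
  nth_rewrite 1 [hαω]
  nth_rewrite 1 [hβν]
  have e : ‖β‖ * (ν * ω) * (starRingEnd ℂ) ((s : ℂ) ^ 2 * ω) = (s : ℂ) ^ 2 * (‖β‖ * ν) := by
    rw [map_mul, map_pow, Complex.conj_ofReal]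
    linear_combination (s : ℂ) ^ 2 * (‖β‖ * ν) * hωc
  rw [smul_smul (‖β‖ * (ν * ω)), e]
  module

theorem EmbCurve.exists_frontier_point {F : ℂ → E2} (hF : EmbCurve F) {t : ℝ} {Z : Set ℂ}
    (hZ : IsPreconnected Z) {ζ₀ : ℂ} (h₀ : ζ₀ ∈ Z) (hZt : ∀ ζ ∈ Z, ‖F ζ‖ < t) :
    ∃ ζ₁, ‖F ζ₁‖ = t ∧ ∃ Z₁, Z ⊆ Z₁ ∧ ζ₁ ∈ Z₁ ∧ IsPreconnected Z₁ ∧ ∀ ζ ∈ Z₁, ‖F ζ‖ ≤ t := by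
  set V : Set ℂ := {ζ | ‖F ζ‖ < t} with hV
  have hVo : IsOpen V := isOpen_lt hF.poly.continuous.norm continuous_const
  set U := connectedComponentIn V ζ₀ with hU
  have hUo : IsOpen U := hVo.connectedComponentIn
  have hUV : U ⊆ V := connectedComponentIn_subset V ζ₀
  have hZU : Z ⊆ U := hZ.subset_connectedComponentIn h₀ hZt
  have hUc : IsPreconnected U := isPreconnected_connectedComponentIn
  have hUb : Bornology.IsBounded U := (hF.isBounded_norm_le t).subset fun ζ hζ =>
    le_of_lt (show ‖F ζ‖ < t from hUV hζ)
  have hUne : U ≠ univ := fun h => by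
    rw [h] at hUb
    exact NormedSpace.unbounded_univ ℂ ℂ hUb
  obtain ⟨ζ₁, hζ₁⟩ := nonempty_frontier_iff.2 ⟨⟨ζ₀, hZU h₀⟩, hUne⟩
  have hcl : ∀ ζ ∈ closure U, ‖F ζ‖ ≤ t := fun ζ hζ =>
    closure_minimal (fun z hz => (hUV hz).le)
      (isClosed_le hF.poly.continuous.norm continuous_const) hζ
  have hZ₁ : IsPreconnected (insert ζ₁ U) := hUc.subset_closure (subset_insert _ _)
    (insert_subset (frontier_subset_closure hζ₁) subset_closure)
  refine ⟨ζ₁, ?_, insert ζ₁ U, hZU.trans (subset_insert _ _), mem_insert _ _, hZ₁, ?_⟩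
  · refine (hcl _ (frontier_subset_closure hζ₁)).antisymm ?_
    by_contra! hlt
    have : insert ζ₁ U ⊆ U := hZ₁.subset_connectedComponentIn (mem_insert_of_mem _ (hZU h₀))
      (insert_subset hlt hUV)
    have h2 := this (mem_insert _ _)
    rw [hUo.frontier_eq] at hζ₁
    exact hζ₁.2 h2
  · rintro ζ (rfl | hζ)
    · exact hcl _ (frontier_subset_closure hζ₁)
    · exact (hUV hζ).le

/-- Approximately hitting a list of points, ordered by their norm. -/
theorem exists_hit_approx (l : List E2) : l.Pairwise (fun v w => ‖v‖ ≤ ‖w‖) →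
    ∀ {F : ℂ → E2}, EmbCurve F → ∀ {Z : Set ℂ}, IsPreconnected Z → ∀ {ζ₀ : ℂ}, ζ₀ ∈ Z →
    ∀ {a t t' ε ε' : ℝ}, 0 ≤ a → a < t → t ≤ t' → (∀ ζ ∈ Z, ‖F ζ‖ < t) → 0 < ε → 0 < ε' →
    (∀ v ∈ l, v ≠ 0 ∧ t < ‖v‖ + ε ∧ ‖v‖ + ε ≤ t') →
    ∃ (ψ : E2 ≃ E2) (Z' : Set ℂ), IsAut ψ ∧ Z ⊆ Z' ∧ IsPreconnected Z' ∧
      (∀ ζ ∈ Z', ‖ψ (F ζ)‖ < t') ∧ NearOn ψ (closedBall 0 a) ε' ∧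
      ∀ v ∈ l, ∃ ζ ∈ Z', dist (ψ (F ζ)) v < ε := by
  induction l with
  | nil =>
    intro _ F hF Z hZ ζ₀ hζ₀ a t t' ε ε' ha hat htt hZt hε hε' _
    exact ⟨Equiv.refl E2, Z, IsAut.refl, subset_rfl, hZ, fun ζ hζ => (hZt ζ hζ).trans_le htt,
      NearOn.refl _ hε'.le, by simp⟩
  | cons v l ih =>
    intro hp F hF Z hZ ζ₀ hζ₀ a t t' ε ε' ha hat htt hZt hε hε' hl
    rw [List.pairwise_cons] at hp
    obtain ⟨ζ₁, hζ₁, Z₁, hZZ₁, hζ₁Z, hZ₁, hZ₁t⟩ := hF.exists_frontier_point hZ hζ₀ hZt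
    obtain ⟨hv0, htv, hvt'⟩ := hl v List.mem_cons_self
    have hvn : 0 < ‖v‖ := norm_pos_iff.2 hv0
    obtain ⟨d, hd1, hd2⟩ := exists_between (max_lt htv (lt_add_of_pos_right ‖v‖ hε))
    obtain ⟨htd, hvd⟩ := max_lt_iff.1 hd1
    set y : E2 := ((d / ‖v‖ : ℝ) : ℂ) • v with hy
    have hyn : ‖y‖ = d := by
      rw [hy, norm_smul, Complex.norm_real, Real.norm_of_nonneg
        (div_nonneg (hvn.trans hvd).le hvn.le), div_mul_cancel₀ _ hvn.ne']
    have hyv : dist y v = d - ‖v‖ := by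
      have : y - v = ((d / ‖v‖ - 1 : ℝ) : ℂ) • v := by rw [hy]; push_cast; module
      have h1 : 0 ≤ d / ‖v‖ - 1 := sub_nonneg.2 ((one_le_div hvn).2 hvd.le)
      rw [dist_eq_norm, this, norm_smul, Complex.norm_real, Real.norm_of_nonneg h1, sub_mul,
        div_mul_cancel₀ _ hvn.ne', one_mul]
    obtain ⟨t₁, hdt₁, ht₁⟩ := exists_between hd2
    obtain ⟨a₀, haa₀, ha₀t⟩ := exists_between hat
    have hx0 : F ζ₁ ≠ 0 := by rw [← norm_pos_iff, hζ₁]; linarith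
    set δ := min (ε' / 2) (a₀ - a) with hδ
    have hδ0 : 0 < δ := lt_min (half_pos hε') (sub_pos.2 haa₀)
    obtain ⟨ψ₁, hψ₁, hn₁, he₁, hb₁⟩ := (canMove_of_lt hx0 (y := y) (by
      rw [hζ₁, hyn]; exact htd)).exists_aut a₀ (by rwa [hζ₁]) δ hδ0 (t₁ - d) (sub_pos.2 hdt₁)
    rw [hyn, hζ₁, add_sub_cancel] at hb₁
    set δ₂ := min δ ((‖v‖ + ε - d) / 2) with hδ₂
    have hδ₂0 : 0 < δ₂ := lt_min hδ0 (by linarith)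
    obtain ⟨ψ₂, Z', hψ₂, hZ₁Z', hZ', hZ't, hn₂, hhit⟩ := ih hp.2 (hF.comp hψ₁) hZ₁ hζ₁Z
      (a := d) (t := t₁) (t' := t') (ε := ε) (ε' := δ₂) (hvn.trans hvd).le hdt₁ (by linarith)
      (fun ζ hζ => hb₁ _ (hZ₁t ζ hζ)) hε hδ₂0 (fun w hw => by
        have h1 := hl w (List.mem_cons_of_mem _ hw)
        have h2 := hp.1 w hw
        exact ⟨h1.1, by linarith, h1.2.2⟩)
    have hδa : δ ≤ a₀ - a := min_le_right _ _
    have hδε : δ ≤ ε' / 2 := min_le_left _ _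
    have hδδ : δ₂ ≤ δ := min_le_left _ _
    refine ⟨ψ₁.trans ψ₂, Z', hψ₁.trans hψ₂, hZZ₁.trans hZ₁Z', hZ', hZ't, ?_, ?_⟩
    · refine (NearOn.trans (δ := a₀ - a) hn₁ (hn₂.mono (closedBall_subset_closedBall ?_) le_rfl)
        ?_ hδa (hδδ.trans hδa)).mono subset_rfl (by linarith)
      · linarith
      · rw [cthickening_closedBall (by linarith) ha]
        exact closedBall_subset_closedBall (by linarith)
    · intro w hw
      rcases List.mem_cons.1 hw with rfl | hw
      · refine ⟨ζ₁, hZ₁Z' hζ₁Z, ?_⟩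
        rw [Equiv.trans_apply, he₁]
        have h1 := (hn₂ y (by rw [mem_closedBall_zero_iff, hyn])).1
        have h2 := dist_triangle (ψ₂ y) y w
        have h3 : δ₂ ≤ (‖w‖ + ε - d) / 2 := min_le_right _ _
        linarith
      · exact hhit w hw

theorem exists_shear_fixing (Λ₀ : Finset E2) {ℓ : E2 →L[ℂ] ℂ} {u v : E2} (hu : ℓ u = 0)
    (hv : ∀ w ∈ Λ₀, ℓ v ≠ ℓ w) (R : ℝ) {ε : ℝ} (hε : 0 < ε) :
    ∃ δ > 0, ∀ y : E2, dist y v < δ → ∀ α : ℂ, ‖α‖ ≤ δ → ∃ ψ : E2 ≃ E2, IsAut ψ ∧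
      (∀ w ∈ Λ₀, ψ w = w) ∧ ψ y = y + α • u ∧ NearOn ψ (closedBall 0 R) ε := by
  set Q : Polynomial ℂ := ∏ w ∈ Λ₀, (Polynomial.X - Polynomial.C (ℓ w)) with hQ
  have hQv : Q.eval (ℓ v) ≠ 0 := by
    rw [hQ, Polynomial.eval_prod, Finset.prod_ne_zero_iff]
    intro w hw
    simpa [sub_eq_zero] using hv w hw
  have hQw : ∀ w ∈ Λ₀, Q.eval (ℓ w) = 0 := fun w hw => by
    rw [hQ, Polynomial.eval_prod]
    exact Finset.prod_eq_zero hw (by simp)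
  have hcont : Continuous fun z : E2 => Q.eval (ℓ z) := Q.continuous.comp ℓ.continuous
  set c := ‖Q.eval (ℓ v)‖ with hc
  have hc0 : 0 < c := norm_pos_iff.2 hQv
  obtain ⟨δ₀, hδ₀, hδ⟩ := Metric.eventually_nhds_iff.1
    ((hcont.norm.tendsto v).eventually_const_lt (half_lt_self hc0))
  obtain ⟨M, hM⟩ := (isCompact_closedBall (0 : E2) R).exists_bound_of_continuousOn
    (f := fun z : E2 => Q.eval (ℓ z) • u) (hcont.smul continuous_const).continuousOn
  set M' := max M 1 with hM'
  have hM0 : 0 < M' := one_pos.trans_le (le_max_right _ _)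
  refine ⟨min δ₀ (ε * (c / 2) / M'), lt_min hδ₀ (by positivity), fun y hy α hα => ?_⟩
  have hy1 : c / 2 < ‖Q.eval (ℓ y)‖ := hδ (hy.trans_le (min_le_left _ _))
  have hy0 : Q.eval (ℓ y) ≠ 0 := norm_pos_iff.1 ((half_pos hc0).trans hy1)
  have hα1 : ‖α‖ ≤ ε * (c / 2) / M' := hα.trans (min_le_right _ _)
  rw [le_div_iff₀ hM0] at hα1
  set g : Polynomial ℂ := Polynomial.C (α / Q.eval (ℓ y)) * Q with hg
  refine ⟨shear ℓ u hu g, isAut_shear _ _ _ _, fun w hw => ?_, ?_, nearOn_shear hu fun z hz => ?_⟩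
  · rw [shear_apply, hg, Polynomial.eval_mul, hQw w hw, mul_zero, zero_smul, add_zero]
  · rw [shear_apply, hg, Polynomial.eval_mul, Polynomial.eval_C, div_mul_cancel₀ _ hy0]
  · have h1 := hM z hz
    rw [norm_smul] at h1
    rw [hg, Polynomial.eval_mul, Polynomial.eval_C, norm_mul, norm_div, mul_assoc, div_mul_eq_mul_div,
      div_le_iff₀ (norm_pos_iff.2 hy0)]
    calc ‖α‖ * (‖Q.eval (ℓ z)‖ * ‖u‖) ≤ ‖α‖ * M' := by gcongr; exact h1.trans (le_max_left _ _)
      _ ≤ ε * (c / 2) := hα1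
      _ ≤ _ := by gcongr

/-- The functional `z ↦ z₀ + s z₁`. -/
def slopeFun (s : ℂ) : E2 →L[ℂ] ℂ :=
  EuclideanSpace.proj 0 + s • EuclideanSpace.proj 1

theorem slopeFun_apply (s : ℂ) (z : E2) : slopeFun s z = z 0 + s * z 1 := rfl

theorem slopeFun_vec (s : ℂ) : slopeFun s !₂[-s, 1] = 0 := by simp [slopeFun_apply]

theorem finite_setOf_slopeFun_eq (Λ₀ : Finset E2) {v : E2} (hv : v ∉ Λ₀) :
    {s : ℂ | ∃ w ∈ Λ₀, slopeFun s v = slopeFun s w}.Finite := by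
  have : {s : ℂ | ∃ w ∈ Λ₀, slopeFun s v = slopeFun s w} =
      ⋃ w ∈ Λ₀, {s : ℂ | slopeFun s v = slopeFun s w} := by ext; simp
  rw [this]
  refine Λ₀.finite_toSet.biUnion fun w hw => Set.Subsingleton.finite ?_
  intro s hs s' hs'
  have h1 : v 0 + s * v 1 = w 0 + s * w 1 := hs
  have h2 : v 0 + s' * v 1 = w 0 + s' * w 1 := hs'
  by_contra hne
  have h3 : (s - s') * (v 1 - w 1) = 0 := by linear_combination h1 - h2
  have h4 : v 1 = w 1 := by
    rcases mul_eq_zero.1 h3 with h | h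
    · exact absurd (sub_eq_zero.1 h) hne
    · exact sub_eq_zero.1 h
  have h5 : v 0 = w 0 := by rw [h4] at h1; exact add_right_cancel h1
  have : v = w := by ext i; fin_cases i <;> assumption
  exact hv (this ▸ hw)

theorem exists_move_point (Λ₀ : Finset E2) {v : E2} (hv : v ∉ Λ₀) {R : ℝ} (hR : 0 ≤ R) {ε : ℝ}
    (hε : 0 < ε) : ∃ δ > 0, ∀ y : E2, dist y v < δ → ∃ ψ : E2 ≃ E2, IsAut ψ ∧
      (∀ w ∈ Λ₀, ψ w = w) ∧ ψ y = v ∧ NearOn ψ (closedBall 0 R) ε := by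
  have hfin := finite_setOf_slopeFun_eq Λ₀ hv
  obtain ⟨s, hs⟩ := hfin.infinite_compl.nonempty
  obtain ⟨s', hs'⟩ := (hfin.union (finite_singleton s)).infinite_compl.nonempty
  have hss : s - s' ≠ 0 := fun h => hs' (Or.inr (sub_eq_zero.1 h).symm)
  have hs1 : ∀ w ∈ Λ₀, slopeFun s v ≠ slopeFun s w := fun w hw h => hs ⟨w, hw, h⟩
  have hs2 : ∀ w ∈ Λ₀, slopeFun s' v ≠ slopeFun s' w := fun w hw h => hs' (Or.inl ⟨w, hw, h⟩)
  set ε₁ := min (ε / 2) 1 with hε₁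
  have hε₁0 : 0 < ε₁ := lt_min (half_pos hε) one_pos
  obtain ⟨δ₁, hδ₁, h1⟩ := exists_shear_fixing Λ₀ (slopeFun_vec s) hs1 (R + 1) hε₁0
  obtain ⟨δ₂, hδ₂, h2⟩ := exists_shear_fixing Λ₀ (slopeFun_vec s') hs2 (R + 1) hε₁0
  set β : E2 → ℂ := fun y => ((v 0 - y 0) + s * (v 1 - y 1)) / (s - s') with hβ
  set α : E2 → ℂ := fun y => (v 1 - y 1) - β y with hα
  have hβc : Continuous β := by fun_prop
  have hαc : Continuous α := by fun_prop
  have hβv : β v = 0 := by simp [hβ]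
  have hαv : α v = 0 := by simp [hα, hβv]
  have hyc : Continuous fun y => y + α y • (!₂[-s, 1] : E2) := by fun_prop
  have e1 : ∀ᶠ y in 𝓝 v, ‖α y‖ < δ₁ := by
    refine (hαc.norm.tendsto v).eventually_lt_const ?_
    rwa [hαv, norm_zero]
  have e2 : ∀ᶠ y in 𝓝 v, ‖β y‖ < δ₂ := by
    refine (hβc.norm.tendsto v).eventually_lt_const ?_
    rwa [hβv, norm_zero]
  have e3 : ∀ᶠ y in 𝓝 v, dist (y + α y • (!₂[-s, 1] : E2)) v < δ₂ := by
    refine ((hyc.dist continuous_const).tendsto v).eventually_lt_const ?_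
    rwa [hαv, zero_smul, add_zero, dist_self]
  have e4 : ∀ᶠ y in 𝓝 v, dist y v < δ₁ := Metric.ball_mem_nhds v hδ₁
  obtain ⟨δ, hδ, h⟩ := Metric.eventually_nhds_iff.1 (e1.and (e2.and (e3.and e4)))
  refine ⟨δ, hδ, fun y hy => ?_⟩
  obtain ⟨f1, f2, f3, f4⟩ := h hy
  obtain ⟨ψ, hψ, hfix, hy1, hn⟩ := h1 y f4 (α y) f1.le
  obtain ⟨ψ', hψ', hfix', hy1', hn'⟩ := h2 _ f3 (β y) f2.le
  refine ⟨ψ.trans ψ', hψ.trans hψ', fun w hw => ?_, ?_, ?_⟩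
  · rw [Equiv.trans_apply, hfix w hw, hfix' w hw]
  · rw [Equiv.trans_apply, hy1, hy1']
    have hb : β y * (s - s') = (v 0 - y 0) + s * (v 1 - y 1) := by
      rw [hβ]; simp only; field_simp
    ext i
    fin_cases i
    · simp [hα]; linear_combination hb
    · simp [hα]; ring
  · refine (NearOn.trans (S := closedBall 0 R) hn hn' ?_ (min_le_right _ _)
      (min_le_right _ _)).mono subset_rfl ?_
    · rw [cthickening_closedBall zero_le_one hR, add_comm]
    · have : ε₁ ≤ ε / 2 := min_le_left _ _
      linarith

/-- Finitely many points can be moved to prescribed nearby points by automorphisms close to the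
identity. -/
theorem exists_correction (Λ₀ : Finset E2) : ∀ R : ℝ, 0 ≤ R → (∀ w ∈ Λ₀, ‖w‖ < R) →
    ∀ {ε : ℝ}, 0 < ε → ∃ δ > 0, ∀ f : E2 → E2, (∀ w ∈ Λ₀, dist (f w) w < δ) →
      ∃ ψ : E2 ≃ E2, IsAut ψ ∧ (∀ w ∈ Λ₀, ψ (f w) = w) ∧ NearOn ψ (closedBall 0 R) ε := by
  classical
  induction Λ₀ using Finset.induction_on with
  | empty => exact fun R _ _ ε hε => ⟨1, one_pos, fun f _ =>
      ⟨Equiv.refl E2, IsAut.refl, by simp, NearOn.refl _ hε.le⟩⟩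
  | insert v Λ₀ hv ih =>
    intro R hR hΛR ε hε
    have hvR : ‖v‖ < R := hΛR v (Finset.mem_insert_self _ _)
    have hε₁0 : 0 < min (ε / 2) 1 := lt_min (half_pos hε) one_pos
    obtain ⟨δ₁, hδ₁, h1⟩ := exists_move_point Λ₀ hv (R := R + 1) (by linarith) hε₁0
    set ε₂ := min (min (ε / 2) 1) (δ₁ / 2) with hε₂
    obtain ⟨δ₂, hδ₂, h2⟩ := ih (R + 1) (by linarith)
      (fun w hw => (hΛR w (Finset.mem_insert_of_mem hw)).trans (by linarith)) (ε := ε₂)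
      (lt_min hε₁0 (half_pos hδ₁))
    refine ⟨min (min δ₂ (δ₁ / 2)) 1, lt_min (lt_min hδ₂ (half_pos hδ₁)) one_pos, fun f hf => ?_⟩
    obtain ⟨ψ, hψ, hfix, hn⟩ := h2 f fun w hw =>
      (hf w (Finset.mem_insert_of_mem hw)).trans_le ((min_le_left _ _).trans (min_le_left _ _))
    have hfv := hf v (Finset.mem_insert_self _ _)
    have hfvR : ‖f v‖ ≤ R + 1 := by
      have h3 : dist (f v) v < 1 := hfv.trans_le (min_le_right _ _)
      have h4 := dist_triangle (f v) v 0
      rw [dist_zero_right, dist_zero_right] at h4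
      linarith
    have hε₂1 : ε₂ ≤ δ₁ / 2 := min_le_right _ _
    obtain ⟨ψ', hψ', hfix', hv', hn'⟩ := h1 (ψ (f v)) (by
      have h3 : dist (f v) v < δ₁ / 2 :=
        hfv.trans_le ((min_le_left _ _).trans (min_le_right _ _))
      have h4 := (hn (f v) (mem_closedBall_zero_iff.2 hfvR)).1
      have h5 := dist_triangle (ψ (f v)) (f v) v
      linarith)
    have hε₂2 : ε₂ ≤ 1 := (min_le_left _ _).trans (min_le_right _ _)
    have hε₂3 : ε₂ ≤ ε / 2 := (min_le_left _ _).trans (min_le_left _ _)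
    refine ⟨ψ.trans ψ', hψ.trans hψ', fun w hw => ?_, ?_⟩
    · rw [Equiv.trans_apply]
      rcases Finset.mem_insert.1 hw with rfl | hw
      · exact hv'
      · rw [hfix w hw, hfix' w hw]
    · refine (NearOn.trans (S := closedBall 0 R) hn hn' ?_ hε₂2
        (min_le_right _ _)).mono subset_rfl ?_
      · rw [cthickening_closedBall zero_le_one hR, add_comm]
      · have : min (ε / 2) 1 ≤ ε / 2 := min_le_left _ _
        linarith

/-- The component containing `0` of the part of a curve in the ball of radius `b`. -/
def sublevelComp (F : ℂ → E2) (b : ℝ) : Set ℂ := connectedComponentIn {ζ | ‖F ζ‖ < b} 0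

theorem norm_lt_of_mem_sublevelComp {F : ℂ → E2} {b : ℝ} {ζ : ℂ} (h : ζ ∈ sublevelComp F b) :
    ‖F ζ‖ < b :=
  connectedComponentIn_subset {ζ | ‖F ζ‖ < b} 0 h

theorem exists_gap {Λ : Set E2} (hΛ : ∀ R < 1, (Λ ∩ closedBall 0 R).Finite) {c : ℝ} (hc : c < 1) :
    ∃ c' > c, c' < 1 ∧ ∀ v ∈ Λ, c < ‖v‖ → c' < ‖v‖ := by
  obtain ⟨R, hcR, hR⟩ := exists_between hc
  have hfin : ((fun v : E2 => ‖v‖) '' (Λ ∩ closedBall 0 R)).Finite := (hΛ R hR).image _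
  have hev : ∀ᶠ x in 𝓝[>] c, ∀ y ∈ (fun v : E2 => ‖v‖) '' (Λ ∩ closedBall 0 R), c < y → x < y := by
    rw [eventually_all_finite hfin]
    intro y _
    by_cases hy : c < y
    · filter_upwards [nhdsWithin_le_nhds (eventually_lt_nhds hy)] with x hx _ using hx
    · exact Eventually.of_forall fun x h => absurd h hy
  obtain ⟨x, hx, hxc, hxR⟩ := (hev.and (Ioo_mem_nhdsGT hcR)).exists
  refine ⟨x, hxc, hxR.trans hR, fun v hv hcv => ?_⟩
  by_cases hvR : ‖v‖ ≤ R
  · exact hx _ ⟨v, ⟨hv, mem_closedBall_zero_iff.2 hvR⟩, rfl⟩ hcv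
  · linarith

theorem exists_sorted_list (s : Finset E2) :
    ∃ l : List E2, l.Pairwise (fun v w => ‖v‖ ≤ ‖w‖) ∧ ∀ v, v ∈ l ↔ v ∈ s := by
  classical
  refine ⟨s.toList.mergeSort fun v w => decide (‖v‖ ≤ ‖w‖), ?_, fun v => by simp⟩
  refine (List.pairwise_mergeSort ?_ ?_ s.toList).imp ?_
  · intro a b c; simp only [decide_eq_true_eq]; exact le_trans
  · intro a b; simpa using le_total ‖a‖ ‖b‖
  · intro a b h; simpa using h

theorem Wall.shrink_set_thickening (w : Wall) {τ : ℝ} {z z' : E2}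
    (hz : z ∈ (w.shrink τ).set) (hd : dist z' z ≤ τ) : z' ∈ w.set := by
  obtain ⟨h1, h2⟩ := hz
  rw [dist_eq_norm] at hd
  simp only [Wall.shrink] at h1 h2
  have h3 : ‖(inner ℂ w.p z : ℂ)‖ ≤ ‖(inner ℂ w.p z' : ℂ)‖ + ‖z' - z‖ := by
    have e : (inner ℂ w.p z : ℂ) = inner ℂ w.p z' - inner ℂ w.p (z' - z) := by
      rw [inner_sub_right]; ring
    rw [e]
    refine (norm_sub_le _ _).trans (add_le_add le_rfl ?_)
    have := norm_inner_le_norm (𝕜 := ℂ) w.p (z' - z)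
    rwa [w.hp, one_mul] at this
  have h4 : ‖z'‖ ≤ ‖z‖ + ‖z' - z‖ := by
    have := norm_add_le z (z' - z); simpa using this
  exact ⟨by linarith, by linarith⟩

theorem exists_stage {Λ : Set E2} (hΛ : ∀ R < 1, (Λ ∩ closedBall 0 R).Finite)
    {F : ℂ → E2} (hF : EmbCurve F) (hF0 : F 0 = 0) {b : ℝ} (hb0 : 0 < b) (hb : b < 1)
    (hits : ∀ v ∈ Λ, ‖v‖ ≤ b → ∃ ζ ∈ sublevelComp F b, F ζ = v)
    {ε : ℝ} (hε : 0 < ε) {r : ℝ} (hr2 : 1 / 2 ≤ r) (hr : r < 1) :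
    ∃ (ψ : E2 ≃ E2) (a' b' e' : ℝ) (W : Set E2), IsAut ψ ∧ NearOn ψ (closedBall 0 b) ε ∧
      (∀ v ∈ Λ, ‖v‖ ≤ b → ψ v = v) ∧ r < b' ∧ b < b' ∧ b ≤ a' ∧ LongPath W a' b' ∧ 0 < e' ∧
      b' + 3 * e' < 1 ∧ W ⊆ closedBall 0 (b' - 3 * e') ∧
      (∀ ζ, ∀ z ∈ W, 3 * e' < dist (ψ (F ζ)) z) ∧
      (∀ v ∈ Λ, ‖v‖ ≤ b' → ∃ ζ ∈ sublevelComp (fun ζ => ψ (F ζ)) b', ψ (F ζ) = v) ∧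
      sublevelComp F b ⊆ sublevelComp (fun ζ => ψ (F ζ)) b' := by
  classical
  obtain ⟨c, hc, hc1⟩ := exists_between (max_lt hb hr)
  obtain ⟨hbc, hrc⟩ := max_lt_iff.1 hc
  obtain ⟨b', hcb', hb'1, hgap⟩ := exists_gap hΛ hc1
  obtain ⟨c1, hcc1, hc1b'⟩ := exists_between hcb'
  obtain ⟨t', hct', ht'c1⟩ := exists_between hcc1
  obtain ⟨t, hbt, htc, hgapt⟩ : ∃ t > b, t < c ∧ ∀ v ∈ Λ, b < ‖v‖ → t < ‖v‖ := by
    obtain ⟨t, hbt, _, h⟩ := exists_gap hΛ hb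
    obtain ⟨s, hs, hs'⟩ := exists_between (lt_min hbt hbc)
    exact ⟨s, hs, hs'.trans_le (min_le_right _ _),
      fun v hv h1 => (hs'.trans_le (min_le_left _ _)).trans (h v hv h1)⟩
  obtain ⟨a0, hba0, ha0t⟩ := exists_between hbt
  obtain ⟨l, hl1, hl2, hl3, τ, hτ, hlong⟩ :=
    exists_long_walls (a := c1) (b := b') (by linarith) hc1b' hb'1.le
  obtain ⟨κ, hκ, hκε, hκb, hκc, hκτ⟩ : ∃ κ > 0, 3 * κ ≤ ε ∧ 2 * κ ≤ a0 - b ∧ 3 * κ ≤ c1 - t' ∧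
      κ ≤ τ := by
    refine ⟨min (min (ε / 3) ((a0 - b) / 2)) (min ((c1 - t') / 3) τ), ?_, ?_, ?_, ?_, ?_⟩
    · refine lt_min (lt_min ?_ ?_) (lt_min ?_ hτ) <;> linarith
    · linarith [(min_le_left (min (ε / 3) ((a0 - b) / 2)) (min ((c1 - t') / 3) τ)),
        min_le_left (ε / 3) ((a0 - b) / 2)]
    · linarith [(min_le_left (min (ε / 3) ((a0 - b) / 2)) (min ((c1 - t') / 3) τ)),
        min_le_right (ε / 3) ((a0 - b) / 2)]
    · linarith [(min_le_right (min (ε / 3) ((a0 - b) / 2)) (min ((c1 - t') / 3) τ)),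
        min_le_left ((c1 - t') / 3) τ]
    · exact (min_le_right _ _).trans (min_le_right _ _)
  set Λ₁ : Finset E2 := (hΛ c hc1).toFinset with hΛ₁
  have hmem : ∀ w, w ∈ Λ₁ ↔ w ∈ Λ ∧ ‖w‖ ≤ c := fun w => by
    rw [hΛ₁, Set.Finite.mem_toFinset, mem_inter_iff, mem_closedBall_zero_iff]
  obtain ⟨δ, hδ, hcorr⟩ := exists_correction Λ₁ 2 (by norm_num)
    (fun w hw => by linarith [((hmem w).1 hw).2]) hκ
  obtain ⟨ε₁, hε₁, hε₁κ, hε₁δ⟩ : ∃ ε₁ > 0, ε₁ ≤ κ ∧ 3 * ε₁ ≤ δ :=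
    ⟨min κ (δ / 3), lt_min hκ (by linarith), min_le_left _ _,
      by linarith [min_le_right κ (δ / 3)]⟩
  obtain ⟨l', hl'1, hl'2⟩ := exists_sorted_list (Λ₁.filter fun v => b < ‖v‖)
  have hl'3 : ∀ v ∈ l', v ∈ Λ ∧ ‖v‖ ≤ c ∧ b < ‖v‖ := fun v hv => by
    rw [hl'2, Finset.mem_filter, hmem] at hv
    exact ⟨hv.1.1, hv.1.2, hv.2⟩
  obtain ⟨ε₀, hε₀, hε₀δ, hε₀t⟩ : ∃ ε₀ > 0, 2 * ε₀ ≤ δ ∧ ε₀ ≤ t' - c :=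
    ⟨min (δ / 2) (t' - c), lt_min (by linarith) (by linarith),
      by linarith [min_le_left (δ / 2) (t' - c)], min_le_right _ _⟩
  have h0Z : (0 : ℂ) ∈ sublevelComp F b :=
    mem_connectedComponentIn (show ‖F 0‖ < b by rw [hF0]; simpa using hb0)
  obtain ⟨ψ₁, Z', hψ₁, hZZ', hZ', hZ't, hnear₁, hhit⟩ :=
    exists_hit_approx l' hl'1 hF (Z := sublevelComp F b) isPreconnected_connectedComponentIn h0Z
      (a := a0) (t := t) (t' := t') (by linarith) ha0t (by linarith)
      (fun ζ hζ => (norm_lt_of_mem_sublevelComp hζ).trans hbt) hε₀ hε₁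
      (fun v hv => by
        obtain ⟨h1, h2, h3⟩ := hl'3 v hv
        have := hgapt v h1 h3
        exact ⟨norm_pos_iff.1 (by linarith), by linarith, by linarith⟩)
  have hF₁ : EmbCurve fun ζ => ψ₁ (F ζ) := hF.comp hψ₁
  obtain ⟨ψ₂, hψ₂, hnear₂, havoid⟩ := exists_avoid_walls l hl1 (isCompact_closedBall (0 : E2) c1)
    hl2 hF₁ (ζ₀ := 0)
    (mem_closedBall_zero_iff.2 ((hZ't 0 (hZZ' h0Z)).le.trans ht'c1.le)) hε₁
  have hpt : ∀ w ∈ Λ₁, ∃ ζ ∈ Z', dist (ψ₂ (ψ₁ (F ζ))) w < δ ∧ (‖w‖ ≤ b → F ζ = w) := by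
    intro w hw
    obtain ⟨hwΛ, hwc⟩ := (hmem w).1 hw
    have key : ∀ ζ ∈ Z', dist (ψ₂ (ψ₁ (F ζ))) (ψ₁ (F ζ)) ≤ ε₁ := fun ζ hζ =>
      (hnear₂ _ (mem_closedBall_zero_iff.2 ((hZ't ζ hζ).le.trans ht'c1.le))).1
    rcases le_or_gt ‖w‖ b with hwb | hwb
    · obtain ⟨ζ, hζ, hζw⟩ := hits w hwΛ hwb
      refine ⟨ζ, hZZ' hζ, ?_, fun _ => hζw⟩
      have h1 := key ζ (hZZ' hζ)
      have h2 := (hnear₁ (F ζ) (mem_closedBall_zero_iff.2 (by rw [hζw]; linarith))).1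
      have h3 := dist_triangle (ψ₂ (ψ₁ (F ζ))) (ψ₁ (F ζ)) (F ζ)
      rw [hζw] at h1 h2 h3 ⊢
      linarith
    · obtain ⟨ζ, hζ, hζw⟩ := hhit w ((hl'2 w).2 (Finset.mem_filter.2 ⟨hw, hwb⟩))
      refine ⟨ζ, hζ, ?_, fun h => absurd h hwb.not_ge⟩
      have h1 := key ζ hζ
      have h3 := dist_triangle (ψ₂ (ψ₁ (F ζ))) (ψ₁ (F ζ)) w
      linarith
  choose! pt hptZ hptd hptb using hpt
  obtain ⟨ψ₃, hψ₃, hψ₃f, hnear₃⟩ := hcorr (fun w => ψ₂ (ψ₁ (F (pt w)))) hptd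
  have hnear₂₃ : NearOn (ψ₂.trans ψ₃) (closedBall 0 t') (2 * κ) := by
    refine (NearOn.trans (S := closedBall 0 t') (δ := c1 - t') (hnear₂.mono subset_rfl hε₁κ)
      (hnear₃.mono (closedBall_subset_closedBall (by linarith)) le_rfl) ?_
      (by linarith) (by linarith)).mono subset_rfl (by linarith)
    rw [cthickening_closedBall (by linarith) (by linarith)]
    exact closedBall_subset_closedBall (by linarith)
  have hnear : NearOn (ψ₁.trans (ψ₂.trans ψ₃)) (closedBall 0 b) ε := by
    refine (NearOn.trans (S := closedBall 0 b) (δ := a0 - b) (hnear₁.mono subset_rfl hε₁κ)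
      (hnear₂₃.mono (closedBall_subset_closedBall (by linarith)) le_rfl) ?_
      (by linarith) (by linarith)).mono subset_rfl (by linarith)
    rw [cthickening_closedBall (by linarith) (by linarith)]
    exact closedBall_subset_closedBall (by linarith)
  have hψ : IsAut (ψ₁.trans (ψ₂.trans ψ₃)) := hψ₁.trans (hψ₂.trans hψ₃)
  have hF' := hF.comp hψ
  set W : Set E2 := ⋃ w ∈ l, (w.shrink τ).set with hW
  have hWc : IsCompact W := by
    have : W = ⋃ w ∈ {w | w ∈ l}, (w.shrink τ).set := rfl
    rw [this]
    exact l.finite_toSet.isCompact_biUnion fun w _ => (w.shrink τ).isCompact_set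
  have hWb : ∀ z ∈ W, ‖z‖ ≤ b' - τ := by
    intro z hz
    obtain ⟨w, hw, hz⟩ := mem_iUnion₂.1 hz
    have : ‖z‖ ≤ w.s - τ := hz.2
    linarith [hl3 w hw]
  have hWF : ∀ ζ, (ψ₁.trans (ψ₂.trans ψ₃)) (F ζ) ∉ W := by
    intro ζ hz
    have hn := hWb _ hz
    obtain ⟨w, hw, hz⟩ := mem_iUnion₂.1 hz
    refine havoid w hw ζ (w.shrink_set_thickening hz ?_)
    have := (hnear₃ ((ψ₁.trans (ψ₂.trans ψ₃)) (F ζ))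
      (mem_closedBall_zero_iff.2 (by linarith))).2
    simp only [Equiv.trans_apply, Equiv.symm_apply_apply] at this ⊢
    exact this.trans hκτ
  obtain ⟨d, hd, hdist⟩ := hF'.exists_dist_ge hWc hWF
  have hZ'b : ∀ ζ ∈ Z', ‖(ψ₁.trans (ψ₂.trans ψ₃)) (F ζ)‖ < b' := by
    intro ζ hζ
    have h1 := (hnear₂₃ (ψ₁ (F ζ)) (mem_closedBall_zero_iff.2 (hZ't ζ hζ).le)).1
    have h2 := hZ't ζ hζ
    have h3 := norm_le_norm_add_norm_sub' ((ψ₂.trans ψ₃) (ψ₁ (F ζ))) (ψ₁ (F ζ))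
    rw [dist_eq_norm] at h1
    simp only [Equiv.trans_apply] at *
    linarith
  have hZ'V : Z' ⊆ sublevelComp (fun ζ => (ψ₁.trans (ψ₂.trans ψ₃)) (F ζ)) b' :=
    hZ'.subset_connectedComponentIn (hZZ' h0Z) hZ'b
  have hfix : ∀ w ∈ Λ₁, (ψ₁.trans (ψ₂.trans ψ₃)) (F (pt w)) = w := hψ₃f
  obtain ⟨e', he', he'1, he'2, he'3⟩ : ∃ e' > 0, 4 * e' ≤ d ∧ 3 * e' ≤ τ ∧ 4 * e' ≤ 1 - b' := by
    refine ⟨min (d / 4) (min (τ / 3) ((1 - b') / 4)), lt_min (by linarith)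
      (lt_min (by linarith) (by linarith)), ?_, ?_, ?_⟩
    · linarith [min_le_left (d / 4) (min (τ / 3) ((1 - b') / 4))]
    · linarith [min_le_right (d / 4) (min (τ / 3) ((1 - b') / 4)),
        min_le_left (τ / 3) ((1 - b') / 4)]
    · linarith [min_le_right (d / 4) (min (τ / 3) ((1 - b') / 4)),
        min_le_right (τ / 3) ((1 - b') / 4)]
  refine ⟨ψ₁.trans (ψ₂.trans ψ₃), c1, b', e', W, hψ, hnear, ?_, by linarith, by linarith,
    by linarith, hlong, he', by linarith, ?_, ?_, ?_, hZZ'.trans hZ'V⟩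
  · intro v hv hvb
    have h1 : v ∈ Λ₁ := (hmem v).2 ⟨hv, by linarith⟩
    have h2 := hfix v h1
    rwa [hptb v h1 hvb] at h2
  · intro z hz
    exact mem_closedBall_zero_iff.2 (by linarith [hWb z hz])
  · intro ζ z hz
    have := hdist z hz ζ
    linarith
  · intro v hv hvb
    have hvc : ‖v‖ ≤ c := by
      by_contra h
      exact absurd (hgap v hv (not_le.1 h)) hvb.not_gt
    have h1 : v ∈ Λ₁ := (hmem v).2 ⟨hv, hvc⟩
    exact ⟨pt v, hZ'V (hptZ v h1), hfix v h1⟩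

/-- A sequence of polynomial curves, each obtained from the previous one by an automorphism close
to the identity on a large ball, avoiding more and more walls and hitting more and more of `Λ`. -/
structure ApproxSeq (Λ : Set E2) where
  F : ℕ → ℂ → E2
  ψ : ℕ → E2 ≃ E2
  a : ℕ → ℝ
  b : ℕ → ℝ
  e : ℕ → ℝ
  W : ℕ → Set E2
  emb : ∀ k, EmbCurve (F k)
  F_zero : ∀ k, F k 0 = 0
  aut : ∀ k, IsAut (ψ k)
  F_succ : ∀ k ζ, F (k + 1) ζ = ψ k (F k ζ)
  near : ∀ k, NearOn (ψ k) (closedBall 0 (b k)) (e k)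
  fix : ∀ k, ∀ v ∈ Λ, ‖v‖ ≤ b k → ψ k v = v
  b_pos : ∀ k, 0 < b k
  e_pos : ∀ k, 0 < e k
  lt_one : ∀ k, b k + 3 * e k < 1
  b_succ : ∀ k, b k + 2 * e k < b (k + 1)
  e_succ : ∀ k, e (k + 1) ≤ e k / 2
  tendsto_b : Tendsto b atTop (𝓝 1)
  hits : ∀ k, ∀ v ∈ Λ, ‖v‖ ≤ b k → ∃ ζ ∈ sublevelComp (F k) (b k), F k ζ = v
  sub : ∀ k, sublevelComp (F k) (b k) ⊆ sublevelComp (F (k + 1)) (b (k + 1))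
  le_a : ∀ k, b k ≤ a k
  long : ∀ k, LongPath (W k) (a k) (b (k + 1))
  W_sub : ∀ k, W k ⊆ closedBall 0 (b (k + 1) - 3 * e (k + 1))
  W_dist : ∀ k ζ, ∀ z ∈ W k, 3 * e (k + 1) < dist (F (k + 1) ζ) z

/-- One term of an `ApproxSeq`. -/
structure ApproxTerm (Λ : Set E2) where
  F : ℂ → E2
  b : ℝ
  e : ℝ
  emb : EmbCurve F
  F_zero : F 0 = 0
  b_pos : 0 < b
  e_pos : 0 < e
  lt_one : b + 3 * e < 1
  hits : ∀ v ∈ Λ, ‖v‖ ≤ b → ∃ ζ ∈ sublevelComp F b, F ζ = v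

theorem ApproxTerm.exists_next {Λ : Set E2} (hΛ : ∀ R < 1, (Λ ∩ closedBall 0 R).Finite)
    (h0 : (0 : E2) ∈ Λ) (r : ℝ)    (s : ApproxTerm Λ) : ∃ (s' : ApproxTerm Λ) (ψ : E2 ≃ E2) (a : ℝ) (W : Set E2), r < 1 →
      IsAut ψ ∧ (∀ ζ, s'.F ζ = ψ (s.F ζ)) ∧ NearOn ψ (closedBall 0 s.b) s.e ∧
      (∀ v ∈ Λ, ‖v‖ ≤ s.b → ψ v = v) ∧ s.b + 2 * s.e < s'.b ∧ s'.e ≤ s.e / 2 ∧ r < s'.b ∧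
      sublevelComp s.F s.b ⊆ sublevelComp s'.F s'.b ∧ s.b ≤ a ∧ LongPath W a s'.b ∧
      W ⊆ closedBall 0 (s'.b - 3 * s'.e) ∧ ∀ ζ, ∀ z ∈ W, 3 * s'.e < dist (s'.F ζ) z := by
  by_cases hr : r < 1
  swap
  · exact ⟨s, Equiv.refl _, 0, ∅, fun h => absurd h hr⟩
  have hs := s.lt_one
  have he := s.e_pos
  obtain ⟨ψ, a', b', e', W, hψ, hnear, hfix, hrb, hbb, hba, hlong, he', hbe, hW, hWd, hhit, hsub⟩ :=
    exists_stage hΛ s.emb s.F_zero s.b_pos (by linarith) s.hits s.e_pos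
      (r := max (1 / 2) (max r (s.b + 2 * s.e))) (le_max_left _ _)
      (max_lt (by norm_num) (max_lt hr (by linarith)))
  obtain ⟨-, hrb⟩ := max_lt_iff.1 hrb
  obtain ⟨hrb, hbe2⟩ := max_lt_iff.1 hrb
  have hm1 := min_le_left e' (s.e / 2)
  have hm2 := min_le_right e' (s.e / 2)
  have hF0 : ψ (s.F 0) = 0 := by rw [s.F_zero, hfix 0 h0 (by simpa using s.b_pos.le)]
  refine ⟨⟨fun ζ => ψ (s.F ζ), b', min e' (s.e / 2), s.emb.comp hψ, hF0,
    s.b_pos.trans hbb, lt_min he' (by linarith), by linarith, hhit⟩, ψ, a', W, fun _ =>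
    ⟨hψ, fun _ => rfl, hnear, hfix, hbe2, hm2, hrb, hsub, hba, hlong,
      hW.trans (closedBall_subset_closedBall (by dsimp only; linarith)),
      fun ζ z hz => lt_of_le_of_lt ?_ (hWd ζ z hz)⟩⟩
  dsimp only
  linarith

theorem exists_approxTerm {Λ : Set E2} (hΛ : ∀ R < 1, (Λ ∩ closedBall 0 R).Finite) :
    Nonempty (ApproxTerm Λ) := by
  obtain ⟨b, hb, hb1, hgap⟩ := exists_gap hΛ zero_lt_one
  have hd : ∀ ζ : ℂ, HasDerivAt (fun ζ : ℂ => (!₂[ζ, 0] : E2)) !₂[1, 0] ζ := by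
    intro ζ
    have h : (fun ζ : ℂ => (!₂[ζ, 0] : E2)) = fun ζ => ζ • (!₂[1, 0] : E2) := by
      funext ζ
      ext i
      fin_cases i <;> simp
    rw [h]
    simpa using (hasDerivAt_id ζ).smul_const (!₂[1, 0] : E2)
  have h00 : (!₂[0, 0] : E2) = 0 := by ext i; fin_cases i <;> rfl
  refine ⟨⟨fun ζ => !₂[ζ, 0], b, (1 - b) / 4, ⟨⟨Polynomial.X, 0, fun ζ => by simp⟩, ?_, ?_⟩, h00,
    hb, by linarith, by linarith, ?_⟩⟩
  · intro x y h
    exact congrArg (fun z : E2 => z 0) h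
  · intro ζ
    rw [(hd ζ).deriv]
    intro h
    simpa using congrArg (fun z : E2 => z 0) h
  · intro v hv hvb
    have hv0 : v = 0 := by
      by_contra h
      exact absurd (hgap v hv (norm_pos_iff.2 h)) hvb.not_gt
    exact ⟨0, mem_connectedComponentIn (by simpa [h00] using hb), by rw [hv0, h00]⟩

theorem exists_approxSeq {Λ : Set E2} (hΛ : ∀ R < 1, (Λ ∩ closedBall 0 R).Finite)
    (h0 : (0 : E2) ∈ Λ) : Nonempty (ApproxSeq Λ) := by
  obtain ⟨s₀⟩ := exists_approxTerm hΛ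
  choose next ψ a W hnext using ApproxTerm.exists_next hΛ h0
  obtain ⟨s, hs⟩ : ∃ s : ℕ → ApproxTerm Λ, ∀ k, s (k + 1) = next (1 - 1 / ((k : ℝ) + 1)) (s k) :=
    ⟨fun k => Nat.rec s₀ (fun k s => next (1 - 1 / ((k : ℝ) + 1)) s) k, fun k => rfl⟩
  have hr : ∀ k : ℕ, 1 - 1 / ((k : ℝ) + 1) < 1 := fun k => by
    have : 0 < 1 / ((k : ℝ) + 1) := by positivity
    linarith
  have key := fun k : ℕ => hnext (1 - 1 / ((k : ℝ) + 1)) (s k) (hr k)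
  simp only [← hs] at key
  refine ⟨⟨fun k => (s k).F, fun k => ψ (1 - 1 / ((k : ℝ) + 1)) (s k),
    fun k => a (1 - 1 / ((k : ℝ) + 1)) (s k), fun k => (s k).b, fun k => (s k).e,
    fun k => W (1 - 1 / ((k : ℝ) + 1)) (s k), fun k => (s k).emb, fun k => (s k).F_zero,
    fun k => (key k).1, fun k => (key k).2.1, fun k => (key k).2.2.1, fun k => (key k).2.2.2.1,
    fun k => (s k).b_pos, fun k => (s k).e_pos, fun k => (s k).lt_one,
    fun k => (key k).2.2.2.2.1, fun k => (key k).2.2.2.2.2.1, ?_, fun k => (s k).hits,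
    fun k => (key k).2.2.2.2.2.2.2.1, fun k => (key k).2.2.2.2.2.2.2.2.1,
    fun k => (key k).2.2.2.2.2.2.2.2.2.1, fun k => (key k).2.2.2.2.2.2.2.2.2.2.1,
    fun k => (key k).2.2.2.2.2.2.2.2.2.2.2⟩⟩
  rw [← tendsto_add_atTop_iff_nat 1]
  have ht : Tendsto (fun k : ℕ => 1 - 1 / ((k : ℝ) + 1)) atTop (𝓝 1) := by
    simpa using (tendsto_one_div_add_atTop_nhds_zero_nat (𝕜 := ℝ)).const_sub 1
  refine tendsto_of_tendsto_of_tendsto_of_le_of_le ht tendsto_const_nhds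
    (fun k => (key k).2.2.2.2.2.2.1.le) (fun k => ?_)
  have h1 := (s (k + 1)).lt_one
  have h2 := (s (k + 1)).e_pos
  dsimp only
  linarith

namespace ApproxSeq

variable {Λ : Set E2} (A : ApproxSeq Λ)

/-- The composition of `j` consecutive automorphisms starting with the `k`-th one. -/
def Φ (A : ApproxSeq Λ) : ℕ → ℕ → E2 ≃ E2
  | _, 0 => Equiv.refl E2
  | k, j + 1 => (A.ψ k).trans (A.Φ (k + 1) j)

theorem isAut_Φ (k j : ℕ) : IsAut (A.Φ k j) := by
  induction j generalizing k with
  | zero => exact IsAut.refl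
  | succ j ih => exact (A.aut k).trans (ih (k + 1))

theorem F_add (k j : ℕ) (ζ : ℂ) : A.F (k + j) ζ = A.Φ k j (A.F k ζ) := by
  induction j generalizing k with
  | zero => rfl
  | succ j ih =>
    rw [show k + (j + 1) = k + 1 + j by ring, ih, A.F_succ]
    rfl

theorem strictMono_b : StrictMono A.b :=
  strictMono_nat_of_lt_succ fun k => by linarith [A.b_succ k, A.e_pos k]

theorem b_lt_one (k : ℕ) : A.b k < 1 := by linarith [A.lt_one k, A.e_pos k]

theorem tendsto_e : Tendsto A.e atTop (𝓝 0) := by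
  have h : ∀ k, A.e k ≤ A.e 0 * (1 / 2) ^ k := by
    intro k
    induction k with
    | zero => simp
    | succ k ih =>
      have := A.e_succ k
      rw [pow_succ]
      linarith
  have ht : Tendsto (fun k : ℕ => A.e 0 * (1 / 2) ^ k) atTop (𝓝 0) := by
    simpa using (tendsto_pow_atTop_nhds_zero_of_lt_one (r := (1 / 2 : ℝ)) (by norm_num)
      (by norm_num)).const_mul (A.e 0)
  exact squeeze_zero (fun k => (A.e_pos k).le) h ht

theorem dist_Φ_le (k j : ℕ) {z : E2} (hz : ‖z‖ ≤ A.b k) : dist (A.Φ k j z) z ≤ 2 * A.e k := by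
  induction j generalizing k z with
  | zero => simpa [Φ] using (A.e_pos k).le
  | succ j ih =>
    have h1 := (A.near k z (mem_closedBall_zero_iff.2 hz)).1
    have hk := A.b_succ k
    have he := A.e_succ k
    have hp := A.e_pos k
    have h2 : ‖A.ψ k z‖ ≤ A.b (k + 1) := by
      have h3 := norm_le_norm_add_norm_sub' (A.ψ k z) z
      rw [dist_eq_norm] at h1
      linarith
    have h4 := ih (k + 1) h2
    have h5 := dist_triangle (A.Φ (k + 1) j (A.ψ k z)) (A.ψ k z) z
    change dist (A.Φ (k + 1) j (A.ψ k z)) z ≤ _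
    linarith

theorem dist_Φ_symm_le (k j : ℕ) {z : E2} (hz : ‖z‖ ≤ A.b k - 2 * A.e k) :
    dist ((A.Φ k j).symm z) z ≤ 2 * A.e k := by
  induction j generalizing k with
  | zero => simpa [Φ] using (A.e_pos k).le
  | succ j ih =>
    have hk := A.b_succ k
    have he := A.e_succ k
    have hp := A.e_pos k
    have h4 := ih (k + 1) (by linarith)
    have h2 : ‖(A.Φ (k + 1) j).symm z‖ ≤ A.b k := by
      have h3 := norm_le_norm_add_norm_sub' ((A.Φ (k + 1) j).symm z) z
      rw [dist_eq_norm] at h4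
      linarith
    have h1 := (A.near k _ (mem_closedBall_zero_iff.2 h2)).2
    have h5 := dist_triangle ((A.ψ k).symm ((A.Φ (k + 1) j).symm z)) ((A.Φ (k + 1) j).symm z) z
    change dist ((A.ψ k).symm ((A.Φ (k + 1) j).symm z)) z ≤ _
    linarith

theorem dist_F_le {k m : ℕ} (hkm : k ≤ m) {ζ : ℂ} (h : ‖A.F k ζ‖ ≤ A.b k) :
    dist (A.F m ζ) (A.F k ζ) ≤ 2 * A.e k := by
  obtain ⟨j, rfl⟩ := Nat.exists_eq_add_of_le hkm
  rw [A.F_add]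
  exact A.dist_Φ_le k j h

theorem dist_F_le' {k m : ℕ} (hkm : k ≤ m) {ζ : ℂ} (h : ‖A.F m ζ‖ ≤ A.b k - 2 * A.e k) :
    dist (A.F m ζ) (A.F k ζ) ≤ 2 * A.e k := by
  obtain ⟨j, rfl⟩ := Nat.exists_eq_add_of_le hkm
  have := A.dist_Φ_symm_le k j h
  rw [A.F_add, Equiv.symm_apply_apply, dist_comm] at this
  rwa [A.F_add]

/-- The increasing domains exhausting the limit domain. -/
def V (k : ℕ) : Set ℂ := sublevelComp (A.F k) (A.b k)

/-- The limit domain. -/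
def dom : Set ℂ := ⋃ k, A.V k

theorem monotone_V : Monotone A.V := monotone_nat_of_le_succ A.sub

theorem continuous_F (k : ℕ) : Continuous (A.F k) := (A.emb k).poly.continuous

theorem isOpen_V (k : ℕ) : IsOpen (A.V k) :=
  (isOpen_lt (A.continuous_F k).norm continuous_const).connectedComponentIn

theorem zero_mem_V (k : ℕ) : (0 : ℂ) ∈ A.V k :=
  mem_connectedComponentIn (show ‖A.F k 0‖ < A.b k by rw [A.F_zero]; simpa using A.b_pos k)

theorem isPreconnected_V (k : ℕ) : IsPreconnected (A.V k) := isPreconnected_connectedComponentIn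

theorem norm_lt_of_mem_V {k : ℕ} {ζ : ℂ} (h : ζ ∈ A.V k) : ‖A.F k ζ‖ < A.b k :=
  norm_lt_of_mem_sublevelComp h

theorem V_subset_dom (k : ℕ) : A.V k ⊆ A.dom := subset_iUnion A.V k

theorem mem_V_of_le {k m : ℕ} (hkm : k ≤ m) {ζ : ℂ} (h : ζ ∈ A.V k) : ζ ∈ A.V m :=
  A.monotone_V hkm h

theorem exists_mem_V {ζ : ℂ} (h : ζ ∈ A.dom) : ∃ k, ζ ∈ A.V k := mem_iUnion.1 h

theorem isOpen_dom : IsOpen A.dom := isOpen_iUnion A.isOpen_V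

theorem isPreconnected_dom : IsPreconnected A.dom :=
  isPreconnected_iUnion ⟨0, mem_iInter.2 A.zero_mem_V⟩ A.isPreconnected_V

theorem subset_V {k : ℕ} {D : Set ℂ} (hD : IsPreconnected D) (hne : (D ∩ A.V k).Nonempty)
    (hsub : ∀ ζ ∈ D, ‖A.F k ζ‖ < A.b k) : D ⊆ A.V k := by
  obtain ⟨x, hxD, hxV⟩ := hne
  have h : A.V k = connectedComponentIn {ζ | ‖A.F k ζ‖ < A.b k} x := connectedComponentIn_eq hxV
  rw [h]
  exact hD.subset_connectedComponentIn hxD hsub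

theorem exists_limit : ∃ f : ℂ → E2, ∀ ζ ∈ A.dom, Tendsto (fun m => A.F m ζ) atTop (𝓝 (f ζ)) := by
  have : ∀ ζ, ∃ y, ζ ∈ A.dom → Tendsto (fun m => A.F m ζ) atTop (𝓝 y) := by
    intro ζ
    by_cases h : ζ ∈ A.dom
    swap
    · exact ⟨0, fun h' => absurd h' h⟩
    obtain ⟨k, hk⟩ := A.exists_mem_V h
    have hc : CauchySeq fun m => A.F m ζ := by
      rw [Metric.cauchySeq_iff']
      intro ε hε
      obtain ⟨N, hN, hkN⟩ := ((A.tendsto_e.eventually_lt_const (half_pos hε)).and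
        (eventually_ge_atTop k)).exists
      refine ⟨N, fun m hm => (A.dist_F_le hm
        (A.norm_lt_of_mem_V (A.mem_V_of_le hkN hk)).le).trans_lt (by linarith)⟩
    obtain ⟨y, hy⟩ := cauchySeq_tendsto_of_complete hc
    exact ⟨y, fun _ => hy⟩
  choose f hf using this
  exact ⟨f, hf⟩

/-- The limit map. -/
def lim : ℂ → E2 := A.exists_limit.choose

theorem tendsto_lim {ζ : ℂ} (h : ζ ∈ A.dom) : Tendsto (fun m => A.F m ζ) atTop (𝓝 (A.lim ζ)) :=
  A.exists_limit.choose_spec ζ h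

theorem dist_lim_le {k : ℕ} {ζ : ℂ} (h : ζ ∈ A.V k) : dist (A.lim ζ) (A.F k ζ) ≤ 2 * A.e k :=
  le_of_tendsto ((A.tendsto_lim (A.V_subset_dom k h)).dist tendsto_const_nhds)
    ((eventually_ge_atTop k).mono fun _ hm => A.dist_F_le hm (A.norm_lt_of_mem_V h).le)

theorem dist_lim_le' {k : ℕ} {ζ : ℂ} (h : ζ ∈ A.dom) (hk : ‖A.lim ζ‖ < A.b k - 2 * A.e k) :
    dist (A.lim ζ) (A.F k ζ) ≤ 2 * A.e k := by
  have hl := A.tendsto_lim h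
  refine le_of_tendsto (hl.dist tendsto_const_nhds) ?_
  filter_upwards [hl.norm.eventually_lt_const hk, eventually_ge_atTop k] with m h1 h2
  exact A.dist_F_le' h2 h1.le

theorem tendstoLocallyUniformlyOn : TendstoLocallyUniformlyOn A.F A.lim atTop A.dom := by
  rw [Metric.tendstoLocallyUniformlyOn_iff]
  intro ε hε ζ hζ
  obtain ⟨k, hk⟩ := A.exists_mem_V hζ
  refine ⟨A.V k, mem_nhdsWithin_of_mem_nhds ((A.isOpen_V k).mem_nhds hk), ?_⟩
  filter_upwards [A.tendsto_e.eventually_lt_const (half_pos hε), eventually_ge_atTop k]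
    with m h1 h2 y hy
  have := A.dist_lim_le (A.mem_V_of_le h2 hy)
  linarith

theorem differentiableOn_lim : DifferentiableOn ℂ A.lim A.dom :=
  A.tendstoLocallyUniformlyOn.differentiableOn
    (Eventually.of_forall fun k => (A.emb k).poly.differentiable.differentiableOn) A.isOpen_dom

theorem norm_lim_lt_one {ζ : ℂ} (h : ζ ∈ A.dom) : ‖A.lim ζ‖ < 1 := by
  obtain ⟨k, hk⟩ := A.exists_mem_V h
  have h1 := A.dist_lim_le hk
  have h2 := A.norm_lt_of_mem_V hk
  have h3 := norm_le_norm_add_norm_sub' (A.lim ζ) (A.F k ζ)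
  have h4 := A.lt_one k
  have h5 := A.e_pos k
  rw [dist_eq_norm] at h1
  linarith

theorem lim_notMem_W {ζ : ℂ} (h : ζ ∈ A.dom) (k : ℕ) : A.lim ζ ∉ A.W k := by
  intro hW
  have h1 := A.W_dist k ζ _ hW
  have h2 := mem_closedBall_zero_iff.1 (A.W_sub k hW)
  have h3 := A.e_pos (k + 1)
  have h4 := A.dist_lim_le' (k := k + 1) h (by linarith)
  rw [dist_comm] at h4
  linarith

theorem subset_image_lim (hΛ : Λ ⊆ ball 0 1) : Λ ⊆ A.lim '' A.dom := by
  intro v hv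
  have hv1 : ‖v‖ < 1 := mem_ball_zero_iff.1 (hΛ hv)
  obtain ⟨k, hk⟩ := (A.tendsto_b.eventually_const_lt hv1).exists
  obtain ⟨ζ, hζ, hζv⟩ := A.hits k v hv hk.le
  have hζd := A.V_subset_dom k hζ
  refine ⟨ζ, hζd, tendsto_nhds_unique (A.tendsto_lim hζd) ?_⟩
  refine tendsto_const_nhds.congr' ?_
  filter_upwards [eventually_ge_atTop k] with m hm
  induction m, hm using Nat.le_induction with
  | base => exact hζv.symm
  | succ m hm ih =>
    rw [A.F_succ, ← ih, A.fix m v hv (hk.le.trans (A.strictMono_b.monotone hm))]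

theorem isCompact_lim_le {ρ : ℝ} (hρ : ρ < 1) : IsCompact {ζ ∈ A.dom | ‖A.lim ζ‖ ≤ ρ} := by
  have ht : Tendsto (fun k => A.b k - 2 * A.e k) atTop (𝓝 1) := by
    simpa using A.tendsto_b.sub (A.tendsto_e.const_mul 2)
  obtain ⟨k, hk⟩ := (ht.eventually_const_lt hρ).exists
  have hek := A.e_pos k
  have hcl : ∀ ζ ∈ {ζ ∈ A.dom | ‖A.lim ζ‖ ≤ ρ}, ‖A.F k ζ‖ ≤ ρ + 2 * A.e k := by
    rintro ζ ⟨h1, h2⟩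
    have h3 := A.dist_lim_le' h1 (h2.trans_lt hk)
    have h4 := norm_le_norm_add_norm_sub' (A.F k ζ) (A.lim ζ)
    rw [dist_comm, dist_eq_norm] at h3
    linarith
  refine isCompact_of_isClosed_isBounded ?_
    (((A.emb k).isBounded_norm_le (ρ + 2 * A.e k)).subset hcl)
  rw [← closure_subset_iff_isClosed]
  intro x hx
  have hxF : ‖A.F k x‖ < A.b k := by
    have : closure {ζ ∈ A.dom | ‖A.lim ζ‖ ≤ ρ} ⊆ {ζ | ‖A.F k ζ‖ ≤ ρ + 2 * A.e k} :=
      closure_minimal hcl (isClosed_le (A.continuous_F k).norm continuous_const)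
    have h : ‖A.F k x‖ ≤ ρ + 2 * A.e k := this hx
    linarith
  have hxd : x ∈ A.dom := by
    obtain ⟨η, hη, hball⟩ := Metric.isOpen_iff.1
      (isOpen_lt (A.continuous_F k).norm continuous_const) x hxF
    obtain ⟨y, hy, hyx⟩ := Metric.mem_closure_iff.1 hx η hη
    obtain ⟨m, hm⟩ := A.exists_mem_V hy.1
    have hkM : k < max m (k + 1) := by simp
    refine A.V_subset_dom (max m (k + 1)) (A.subset_V (convex_ball x η).isPreconnected
      ⟨y, by rwa [mem_ball, dist_comm], A.mem_V_of_le (le_max_left _ _) hm⟩ ?_ (mem_ball_self hη))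
    intro ζ hζ
    have h1 : ‖A.F k ζ‖ < A.b k := hball hζ
    have h2 := A.dist_F_le hkM.le h1.le
    have h3 := norm_le_norm_add_norm_sub' (A.F (max m (k + 1)) ζ) (A.F k ζ)
    have h4 := A.strictMono_b.monotone (Nat.succ_le_of_lt hkM)
    have h5 := A.b_succ k
    rw [dist_eq_norm] at h2
    linarith
  refine ⟨hxd, ?_⟩
  have hc : ContinuousAt A.lim x :=
    (A.differentiableOn_lim.differentiableAt (A.isOpen_dom.mem_nhds hxd)).continuousAt
  rw [mem_closure_iff_frequently] at hx
  by_contra hlt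
  exact hx ((hc.norm.eventually_const_lt (not_le.1 hlt)).mono fun y hy h => absurd h.2 hy.not_ge)

end ApproxSeq

theorem frontier_connectedComponentIn_compl_subset {K : Set ℂ} (hK : IsClosed K) (a : ℂ) :
    frontier (connectedComponentIn Kᶜ a) ⊆ K := by
  intro x hx
  by_contra hxK
  have hopen : ∀ y, IsOpen (connectedComponentIn Kᶜ y) := fun y =>
    hK.isOpen_compl.connectedComponentIn
  obtain ⟨y, hyx, hya⟩ := mem_closure_iff.1 (frontier_subset_closure hx) _ (hopen x)
    (mem_connectedComponentIn hxK)
  rw [(hopen a).frontier_eq] at hx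
  refine hx.2 ?_
  rw [connectedComponentIn_eq hya, ← connectedComponentIn_eq hyx]
  exact mem_connectedComponentIn hxK

theorem dist_sub_id_le {g : E2 → E2} {M ρ d : ℝ} (hd : 0 < d)
    (hg : Differentiable ℂ g) (hM : ∀ z, ‖z‖ < ρ + d → dist (g z) z ≤ M) {z w : E2}
    (hz : ‖z‖ ≤ ρ) (hw : ‖w‖ ≤ ρ) : ‖(g z - z) - (g w - w)‖ ≤ 2 * M / d * dist z w := by
  have hM' : ∀ y, ‖y‖ < ρ + d → ‖g y - y‖ ≤ M := fun y hy => by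
    rw [← dist_eq_norm]; exact hM y hy
  have hw' := hM' w (by linarith)
  have hM0 : 0 ≤ M := (norm_nonneg _).trans hw'
  rcases lt_or_ge (dist z w) d with h | h
  · have := Complex.dist_le_div_mul_dist_of_mapsTo_ball (f := fun y => g y - y) (c := w)
      (R₁ := d) (R₂ := 2 * M) (z := z) (hg.sub differentiable_id).differentiableOn ?_ h
    · rwa [dist_eq_norm] at this
    · intro y hy
      have h1 : ‖y‖ < ρ + d := by
        have := norm_le_norm_add_norm_sub' y w
        rw [mem_ball, dist_eq_norm] at hy
        linarith
      rw [mem_closedBall, dist_eq_norm]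
      exact (norm_sub_le _ _).trans (by linarith [hM' y h1])
  · have h1 : 1 ≤ dist z w / d := (one_le_div hd).2 h
    calc ‖(g z - z) - (g w - w)‖ ≤ 2 * M :=
          (norm_sub_le _ _).trans (by linarith [hM' z (by linarith)])
      _ ≤ 2 * M * (dist z w / d) := le_mul_of_one_le_right (by linarith) h1
      _ = 2 * M / d * dist z w := by ring

namespace ApproxSeq

variable {Λ : Set E2} (A : ApproxSeq Λ)

theorem hasUnboundedComplement_dom : HasUnboundedComplement A.dom := by
  intro K hK hKc a ha hbd
  obtain ⟨k, hk⟩ : ∃ k, K ⊆ A.V k := by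
    obtain ⟨k, hk⟩ := hKc.elim_directed_cover A.V A.isOpen_V hK A.monotone_V.directed_le
    exact ⟨k, hk⟩
  have haK : a ∈ Kᶜ := fun h => ha (hK h)
  have hfr := frontier_connectedComponentIn_compl_subset hKc.isClosed a
  obtain ⟨C, hC⟩ : ∃ C, C = connectedComponentIn Kᶜ a := ⟨_, rfl⟩
  rw [← hC] at hbd hfr
  have haC : a ∈ C := hC ▸ mem_connectedComponentIn haK
  have hCp : IsPreconnected C := hC ▸ isPreconnected_connectedComponentIn
  have hCu : C ≠ univ := fun h => by
    rw [h] at hbd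
    exact NoncompactSpace.noncompact_univ (X := ℂ)
      (isCompact_of_isClosed_isBounded isClosed_univ hbd)
  obtain ⟨x, hx⟩ := nonempty_frontier_iff.2 ⟨⟨a, haC⟩, hCu⟩
  obtain ⟨y, hyK, hy⟩ := hKc.exists_isMaxOn ⟨x, hfr hx⟩ (A.continuous_F k).norm.continuousOn
  have hyb := A.norm_lt_of_mem_V (hk hyK)
  have hmax : ∀ z ∈ closure C, ‖A.F k z‖ < A.b k := fun z hz =>
    (Complex.norm_le_of_forall_mem_frontier_norm_le hbd
      (A.emb k).poly.differentiable.diffContOnCl (fun u hu => hy (hfr hu)) hz).trans_lt hyb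
  exact ha (A.V_subset_dom k (A.subset_V hCp.closure
    ⟨x, frontier_subset_closure hx, hk (hfr hx)⟩ hmax (subset_closure haC)))

theorem exists_half_le (k : ℕ) : ∃ m, ∀ ζ ∈ A.V k, ∀ ζ' ∈ A.V k,
    ‖A.F m ζ - A.F m ζ'‖ ≤ 2 * ‖A.lim ζ - A.lim ζ'‖ := by
  have hd : 0 < A.b (k + 1) - (A.b k + 2 * A.e k) := by linarith [A.b_succ k]
  obtain ⟨d, hdd⟩ : ∃ d, d = A.b (k + 1) - (A.b k + 2 * A.e k) := ⟨_, rfl⟩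
  rw [← hdd] at hd
  obtain ⟨m, hm, hkm⟩ := ((A.tendsto_e.eventually_lt_const (by positivity : 0 < d / 8)).and
    (eventually_ge_atTop (k + 1))).exists
  have hb := A.strictMono_b.monotone hkm
  have hF : ∀ ζ ∈ A.V k, ‖A.F m ζ‖ ≤ A.b k + 2 * A.e k := by
    intro ζ hζ
    have h1 := A.norm_lt_of_mem_V hζ
    have h2 := A.dist_F_le (by linarith : k ≤ m) h1.le
    have h3 := norm_le_norm_add_norm_sub' (A.F m ζ) (A.F k ζ)
    rw [dist_eq_norm] at h2
    linarith
  refine ⟨m, fun ζ hζ ζ' hζ' => ?_⟩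
  have hl := (((A.tendsto_lim (A.V_subset_dom k hζ)).sub
    (A.tendsto_lim (A.V_subset_dom k hζ'))).norm).const_mul 2
  refine ge_of_tendsto hl ?_
  filter_upwards [eventually_ge_atTop m] with n hn
  obtain ⟨j, rfl⟩ := Nat.exists_eq_add_of_le hn
  have h := dist_sub_id_le (g := A.Φ m j) (M := 2 * A.e m) hd (A.isAut_Φ m j).diff
    (fun z hz => A.dist_Φ_le m j (by linarith)) (hF ζ hζ) (hF ζ' hζ')
  rw [← A.F_add, ← A.F_add, dist_eq_norm] at h
  have h4 : 2 * (2 * A.e m) / d ≤ 1 / 2 := by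
    rw [div_le_iff₀ hd]; linarith
  have h5 := h.trans (mul_le_mul_of_nonneg_right h4 (norm_nonneg _))
  have h6 := norm_sub_norm_le (A.F m ζ - A.F m ζ') (A.F (m + j) ζ - A.F (m + j) ζ')
  have h7 : ‖A.F m ζ - A.F m ζ' - (A.F (m + j) ζ - A.F (m + j) ζ')‖ =
      ‖(A.F (m + j) ζ - A.F m ζ) - (A.F (m + j) ζ' - A.F m ζ')‖ := by
    rw [← norm_neg]; congr 1; abel
  rw [h7] at h6
  linarith

theorem injOn_lim : InjOn A.lim A.dom := by
  intro x hx y hy hxy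
  obtain ⟨k, hk⟩ := A.exists_mem_V hx
  obtain ⟨l, hl⟩ := A.exists_mem_V hy
  obtain ⟨m, hm⟩ := A.exists_half_le (max k l)
  have := hm x (A.mem_V_of_le (le_max_left _ _) hk) y (A.mem_V_of_le (le_max_right _ _) hl)
  rw [hxy, sub_self, norm_zero, mul_zero] at this
  exact (A.emb m).inj (sub_eq_zero.1 (norm_le_zero_iff.1 this))

theorem hasDerivAt_lim {x : ℂ} (hx : x ∈ A.dom) : HasDerivAt A.lim (deriv A.lim x) x :=
  (A.differentiableOn_lim.differentiableAt (A.isOpen_dom.mem_nhds hx)).hasDerivAt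

theorem deriv_lim_ne_zero {x : ℂ} (hx : x ∈ A.dom) : deriv A.lim x ≠ 0 := by
  intro h0
  obtain ⟨k, hk⟩ := A.exists_mem_V hx
  obtain ⟨m, hm⟩ := A.exists_half_le k
  have h1 := (A.hasDerivAt_lim hx).tendsto_slope
  have h2 := ((A.emb m).poly.differentiable x).hasDerivAt.tendsto_slope
  rw [h0] at h1
  have h3 : ‖deriv (A.F m) x‖ ≤ 2 * ‖(0 : E2)‖ := by
    refine le_of_tendsto_of_tendsto h2.norm (h1.norm.const_mul 2) ?_
    filter_upwards [mem_nhdsWithin_of_mem_nhds ((A.isOpen_V k).mem_nhds hk)] with y hy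
    rw [slope_def_module, slope_def_module, norm_smul, norm_smul]
    have := mul_le_mul_of_nonneg_left (hm y hy x hk) (norm_nonneg (y - x)⁻¹)
    linarith
  rw [norm_zero, mul_zero] at h3
  exact (A.emb m).deriv_ne x (norm_le_zero_iff.1 h3)

theorem dom_ne_univ : A.dom ≠ univ := by
  intro h
  have hd : Differentiable ℂ A.lim := by
    rw [← differentiableOn_univ, ← h]
    exact A.differentiableOn_lim
  have hb : Bornology.IsBounded (range A.lim) := by
    refine isBounded_ball.subset (t := ball (0 : E2) 1) ?_
    rintro _ ⟨ζ, rfl⟩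
    exact mem_ball_zero_iff.2 (A.norm_lim_lt_one (h ▸ mem_univ ζ))
  have h01 := hd.apply_eq_apply_of_bounded hb 0 1
  exact zero_ne_one (A.injOn_lim (h ▸ mem_univ 0) (h ▸ mem_univ 1) h01)

theorem eVariationOn_eq_top {c : ℝ → E2} (hc : ContinuousOn c (Ico 0 1))
    (hc1 : ∀ t ∈ Ico (0 : ℝ) 1, ‖c t‖ < 1) (hcW : ∀ t ∈ Ico (0 : ℝ) 1, ∀ k, c t ∉ A.W k)
    (hlim : ∀ ρ < 1, ∃ t₀ ∈ Ico (0 : ℝ) 1, ∀ t ∈ Ico t₀ 1, ρ < ‖c t‖) :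
    eVariationOn c (Ico 0 1) = ⊤ := by
  have key : ∀ n : ℕ, ∃ t ∈ Ico (0 : ℝ) 1, (n : ℝ≥0∞) ≤ eVariationOn c (Icc 0 t) := by
    intro n
    induction n with
    | zero => exact ⟨0, by simp, by simp⟩
    | succ n ih =>
      obtain ⟨t, ht, hn⟩ := ih
      obtain ⟨k, hk⟩ := (A.tendsto_b.eventually_const_lt (hc1 t ht)).exists
      obtain ⟨t₀, ht₀, h⟩ := hlim _ (A.b_lt_one (k + 1))
      have ht' : max t t₀ ∈ Ico t₀ 1 := ⟨le_max_right _ _, max_lt ht.2 ht₀.2⟩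
      have hsub : Icc t (max t t₀) ⊆ Ico 0 1 := fun x hx =>
        ⟨ht.1.trans hx.1, hx.2.trans_lt ht'.2⟩
      have h1 := A.long k c t (max t t₀) (le_max_left _ _) (hc.mono hsub)
        (hk.le.trans (A.le_a k)) (h _ ht').le (fun x hx => hcW x (hsub hx) k)
      refine ⟨max t t₀, ⟨ht.1.trans (le_max_left _ _), ht'.2⟩, ?_⟩
      have h2 := eVariationOn.Icc_add_Icc c (s := univ) ht.1 (le_max_left t t₀) (mem_univ _)
      simp only [univ_inter] at h2
      rw [← h2]
      push_cast
      exact add_le_add hn h1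
  refine ENNReal.eq_top_of_forall_nnreal_le fun r => ?_
  obtain ⟨n, hn⟩ := exists_nat_ge r
  obtain ⟨t, ht, h⟩ := key n
  refine le_trans ?_ (h.trans (eVariationOn.mono c fun x hx => ⟨hx.1, hx.2.trans_lt ht.2⟩))
  exact_mod_cast hn

end ApproxSeq

theorem finite_inter_closedBall {Λ : Set E2} (hΛ : ∀ z ∈ ball (0 : E2) 1, ¬ AccPt z (𝓟 Λ))
    {R : ℝ} (hR : R < 1) : (Λ ∩ closedBall 0 R).Finite := by
  by_contra h
  obtain ⟨x, hx, hacc⟩ := Set.Infinite.exists_accPt_of_subset_isCompact h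
    (isCompact_closedBall (0 : E2) R) inter_subset_right
  exact hΛ x (closedBall_subset_ball hR hx) (hacc.mono (principal_mono.2 inter_subset_left))

/-- A biholomorphic inverse of a surjective disc chart. -/
theorem IsDiscChart.exists_inverse {Ω : Set ℂ} (hΩ : IsOpen Ω) {f : ℂ → ℂ}
    (hf : IsDiscChart Ω f) (hs : SurjOn f Ω (ball 0 1)) :
    ∃ g : ℂ → ℂ, (∀ w ∈ ball (0 : ℂ) 1, g w ∈ Ω ∧ f (g w) = w) ∧ (∀ z ∈ Ω, g (f z) = z) ∧
      ∀ w ∈ ball (0 : ℂ) 1, ∃ g' ≠ 0, HasDerivAt g g' w := by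
  have hex : ∀ w, ∃ z, w ∈ ball (0 : ℂ) 1 → z ∈ Ω ∧ f z = w := fun w => by
    by_cases hw : w ∈ ball (0 : ℂ) 1
    · obtain ⟨z, hz, h⟩ := hs hw
      exact ⟨z, fun _ => ⟨hz, h⟩⟩
    · exact ⟨0, fun h => absurd h hw⟩
  choose g hg using hex
  have hmaps : ∀ z ∈ Ω, f z ∈ ball (0 : ℂ) 1 := fun z hz =>
    mem_ball_zero_iff.2 (hf.maps z hz)
  have hgf : ∀ z ∈ Ω, g (f z) = z := fun z hz =>
    hf.inj (hg _ (hmaps z hz)).1 hz (hg _ (hmaps z hz)).2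
  refine ⟨g, hg, hgf, fun w hw => ?_⟩
  obtain ⟨hgw, hfg⟩ := hg w hw
  obtain ⟨f', hf'⟩ : ∃ f', f' = deriv f (g w) := ⟨_, rfl⟩
  have hne : f' ≠ 0 := hf' ▸ hf.deriv_ne _ hgw
  have hd : HasStrictDerivAt f f' (g w) := by
    rw [hf']
    exact ((hf.diff.analyticOnNhd hΩ) _ hgw).hasStrictDerivAt
  have hloc := hd.to_localInverse hne
  rw [hfg] at hloc
  refine ⟨f'⁻¹, inv_ne_zero hne, hloc.hasDerivAt.congr_of_eventuallyEq ?_⟩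
  have h1 := hd.eventually_right_inverse hne
  have h2 := hloc.hasDerivAt.continuousAt
  have h3 : hd.localInverse f f' (g w) hne w = g w := by
    have := hd.hasStrictFDerivAt_equiv hne |>.localInverse_apply_image
    rw [hfg] at this
    exact this
  have h4 : ∀ᶠ y in 𝓝 w, hd.localInverse f f' (g w) hne y ∈ Ω :=
    h2 (by rw [h3]; exact hΩ.mem_nhds hgw)
  rw [hfg] at h1
  filter_upwards [h1, h4] with y hy hyΩ
  have := hgf _ hyΩ
  rwa [hy] at this

end

/-- Simply connected case of the Alarcón–Globevnik hitting theorem: for every closed discrete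
subset `Λ` of 𝔹₂ there is a complete proper holomorphic embedding of the disc into 𝔹₂ whose
image contains `Λ`. -/
theorem complete_proper_embedded_disc_B2_hitting
    (Λ : Set (EuclideanSpace ℂ (Fin 2)))
    (hΛsub : Λ ⊆ Metric.ball (0 : EuclideanSpace ℂ (Fin 2)) 1)
    (hΛclosed : closure Λ ∩ Metric.ball (0 : EuclideanSpace ℂ (Fin 2)) 1 ⊆ Λ)
    (hΛdiscrete : ∀ z ∈ Metric.ball (0 : EuclideanSpace ℂ (Fin 2)) 1,
      ¬ AccPt z (Filter.principal Λ)) :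
    ∃ φ : ℂ → EuclideanSpace ℂ (Fin 2),
      DifferentiableOn ℂ φ (Metric.ball (0 : ℂ) 1) ∧
      Set.InjOn φ (Metric.ball (0 : ℂ) 1) ∧
      (∀ ζ ∈ Metric.ball (0 : ℂ) 1, deriv φ ζ ≠ 0) ∧
      (∀ ζ ∈ Metric.ball (0 : ℂ) 1, φ ζ ∈ Metric.ball (0 : EuclideanSpace ℂ (Fin 2)) 1) ∧
      Λ ⊆ φ '' Metric.ball (0 : ℂ) 1 ∧
      (∀ K : Set (EuclideanSpace ℂ (Fin 2)),
        K ⊆ Metric.ball (0 : EuclideanSpace ℂ (Fin 2)) 1 → IsCompact K →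
        IsCompact {ζ ∈ Metric.ball (0 : ℂ) 1 | φ ζ ∈ K}) ∧
      (∀ γ : ℝ → ℂ, DivergentPathIn (Metric.ball (0 : ℂ) 1) γ →
        eVariationOn (fun t => φ (γ t)) (Set.Ico 0 1) = ⊤) := by
  have hfin : ∀ R < 1, (insert 0 Λ ∩ closedBall (0 : E2) R).Finite := fun R hR => by
    rw [insert_eq, union_inter_distrib_right]
    exact ((finite_singleton _).inter_of_left _).union (finite_inter_closedBall hΛdiscrete hR)
  obtain ⟨A⟩ := exists_approxSeq hfin (mem_insert _ _)
  obtain ⟨f, hf, hfs⟩ := exists_isDiscChart_surjOn A.isOpen_dom A.isPreconnected_dom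
    (A.V_subset_dom 0 (A.zero_mem_V 0)) A.dom_ne_univ
    (hasHolomorphicSqrt_of_hasUnboundedComplement A.isOpen_dom A.isPreconnected_dom
      A.hasUnboundedComplement_dom)
  obtain ⟨g, hg, hgf, hg'⟩ := hf.exists_inverse A.isOpen_dom hfs
  have hfb : ∀ z ∈ A.dom, f z ∈ ball (0 : ℂ) 1 := fun z hz => mem_ball_zero_iff.2 (hf.maps z hz)
  have hφd : ∀ w ∈ ball (0 : ℂ) 1, ∃ v ≠ 0, HasDerivAt (fun w => A.lim (g w)) v w := by
    intro w hw
    obtain ⟨g', hg'0, hgd⟩ := hg' w hw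
    exact ⟨g' • deriv A.lim (g w), smul_ne_zero hg'0 (A.deriv_lim_ne_zero (hg w hw).1),
      (A.hasDerivAt_lim (hg w hw).1).scomp w hgd⟩
  have hφdiff : DifferentiableOn ℂ (fun w => A.lim (g w)) (ball 0 1) := fun w hw => by
    obtain ⟨v, -, hv⟩ := hφd w hw
    exact hv.differentiableAt.differentiableWithinAt
  have hproper : ∀ ρ < 1, IsCompact {w ∈ ball (0 : ℂ) 1 | ‖A.lim (g w)‖ ≤ ρ} := by
    intro ρ hρ
    have himg : {w ∈ ball (0 : ℂ) 1 | ‖A.lim (g w)‖ ≤ ρ} =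
        f '' {ζ ∈ A.dom | ‖A.lim ζ‖ ≤ ρ} := by
      ext w
      constructor
      · rintro ⟨hw, h⟩
        exact ⟨g w, ⟨(hg w hw).1, h⟩, (hg w hw).2⟩
      · rintro ⟨z, ⟨hz, h⟩, rfl⟩
        exact ⟨hfb z hz, by rwa [hgf z hz]⟩
    rw [himg]
    exact (A.isCompact_lim_le hρ).image_of_continuousOn
      (hf.diff.continuousOn.mono fun z hz => hz.1)
  refine ⟨fun w => A.lim (g w), hφdiff, ?_, ?_, ?_, ?_, ?_, ?_⟩
  · intro w hw w' hw' h
    have := A.injOn_lim (hg w hw).1 (hg w' hw').1 h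
    rw [← (hg w hw).2, this, (hg w' hw').2]
  · intro w hw
    obtain ⟨v, hv0, hv⟩ := hφd w hw
    rwa [hv.deriv]
  · exact fun w hw => mem_ball_zero_iff.2 (A.norm_lim_lt_one (hg w hw).1)
  · intro v hv
    obtain ⟨z, hz, h⟩ := A.subset_image_lim
      (insert_subset (mem_ball_self one_pos) hΛsub) (mem_insert_of_mem _ hv)
    exact ⟨f z, hfb z hz, (congrArg A.lim (hgf z hz)).trans h⟩
  · intro K hK hKc
    obtain ⟨ρ, hρ, hKρ⟩ : ∃ ρ < 1, ∀ z ∈ K, ‖z‖ ≤ ρ := by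
      rcases K.eq_empty_or_nonempty with rfl | hne
      · exact ⟨0, one_pos, fun z hz => absurd hz (notMem_empty z)⟩
      · obtain ⟨y, hy, hmax⟩ := hKc.exists_isMaxOn hne continuous_norm.continuousOn
        exact ⟨‖y‖, mem_ball_zero_iff.1 (hK hy), fun z hz => hmax hz⟩
    have hc := (hφdiff.continuousOn.mono fun w hw => hw.1).preimage_isClosed_of_isClosed
      (hproper ρ hρ).isClosed hKc.isClosed
    refine (hproper ρ hρ).of_isClosed_subset ?_ (fun w hw => ⟨hw.1, hKρ _ hw.2⟩)
    convert hc using 1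
    ext w
    exact ⟨fun h => ⟨⟨h.1, hKρ _ h.2⟩, h.2⟩, fun h => ⟨h.1.1, h.2⟩⟩
  · rintro γ ⟨hγ, hγb, hγK⟩
    refine A.eVariationOn_eq_top (hφdiff.continuousOn.comp hγ hγb)
      (fun t ht => A.norm_lim_lt_one (hg _ (hγb t ht)).1)
      (fun t ht k => A.lim_notMem_W (hg _ (hγb t ht)).1 k) fun ρ hρ => ?_
    obtain ⟨t₀, ht₀, h⟩ := hγK _ (fun w hw => hw.1) (hproper ρ hρ)
    refine ⟨t₀, ht₀, fun t ht => ?_⟩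
    by_contra hle
    exact h t ht ⟨hγb t ⟨ht₀.1.trans ht.1, ht.2⟩, not_lt.1 hle⟩
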